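/- arXiv:1901.04035 — 4 statements merged into one kernel-verified Lean document; each statement's English description precedes it below -/
import Mathlib

section
/- Let S = {S_1, …, S_m} be a self-similar IFS on ℝ^d with similarity dimension s, and assume the open set condition holds. Then for all i ≠ j one has H^s(S_i(Λ) ∩ S_j(Λ)) = 0, where Λ is the attractor and H^s is the s-dimensional Hausdorff measure. -/
open MeasureTheory Set
open scoped ENNReal

open scoped NNReal in
/-- An invariant set of a finite Lipschitz system is covered, at each level `n`, by pieces indexed
by words of length `n`, with diameters controlled by the products of the Lipschitz constants. -/
theorem exists_word_cover {X ι : Type*} [PseudoEMetricSpace X]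
    {c : ι → ℝ≥0} {S : ι → X → X} (hS : ∀ i, LipschitzWith (c i) (S i))
    {A : Set X} (hA : A ⊆ ⋃ i, S i '' A) (n : ℕ) :
    ∃ T : (Fin n → ι) → Set X, A ⊆ ⋃ w, T w ∧
      ∀ w, Metric.ediam (T w) ≤ (∏ k, (c (w k) : ℝ≥0∞)) * Metric.ediam A := by
  induction n with
  | zero => exact ⟨fun _ => A, by simp [iUnion_const], by simp⟩
  | succ n ih =>
    obtain ⟨T, hT, hd⟩ := ih
    refine ⟨fun w => S (w 0) '' T (Fin.tail w), fun x hx => ?_, fun w => ?_⟩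
    · obtain ⟨i, y, hy, rfl⟩ := mem_iUnion.1 (hA hx)
      obtain ⟨w, hw⟩ := mem_iUnion.1 (hT hy)
      exact mem_iUnion.2 ⟨Fin.cons i w, y, by simpa using hw, by simp⟩
    · rw [Fin.prod_univ_succ, mul_assoc]
      exact ((hS (w 0)).ediam_image_le _).trans (mul_le_mul_right (hd (Fin.tail w)) _)

open scoped NNReal in
/-- The Hausdorff measure, in the similarity dimension, of a set invariant under a finite
contracting Lipschitz system is bounded by a power of its diameter. -/
theorem hausdorffMeasure_le_ediam_rpow_of_invariant {X ι : Type*} [EMetricSpace X]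
    [MeasurableSpace X] [BorelSpace X] [Fintype ι]
    {c : ι → ℝ≥0} (hc : ∀ i, c i < 1) {S : ι → X → X} (hS : ∀ i, LipschitzWith (c i) (S i))
    {A : Set X} (hA : A ⊆ ⋃ i, S i '' A) (hfin : Metric.ediam A ≠ ∞)
    {s : ℝ} (hs : 0 ≤ s) (hsum : ∑ i, (c i : ℝ≥0∞) ^ s = 1) :
    μH[s] A ≤ Metric.ediam A ^ s := by
  choose T hT hd using exists_word_cover hS hA
  set ρ : ℝ≥0 := Finset.univ.sup c
  have hρ : ρ < 1 := (Finset.sup_lt_iff (by simp)).2 fun i _ => hc i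
  have hlim : Filter.Tendsto (fun n : ℕ => (ρ : ℝ≥0∞) ^ n * Metric.ediam A) Filter.atTop
      (nhds 0) := by
    simpa using ENNReal.Tendsto.mul_const
      (ENNReal.tendsto_pow_atTop_nhds_zero_of_lt_one (by exact_mod_cast hρ)) (Or.inr hfin)
  refine (Measure.hausdorffMeasure_le_liminf_sum s A _ hlim T
    (.of_forall fun n w => (hd n w).trans ?_) (.of_forall hT)).trans ?_
  · gcongr
    calc ∏ k, (c (w k) : ℝ≥0∞) ≤ ∏ _k : Fin n, (ρ : ℝ≥0∞) :=
          Finset.prod_le_prod' fun k _ => by exact_mod_cast Finset.le_sup (Finset.mem_univ (w k))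
      _ = ρ ^ n := by simp
  · refine (Filter.liminf_le_liminf (.of_forall fun n => ?_)).trans
      (Filter.liminf_const (f := Filter.atTop (α := ℕ)) _).le
    calc ∑ w, Metric.ediam (T n w) ^ s
        ≤ ∑ w : Fin n → ι, (∏ k, (c (w k) : ℝ≥0∞) ^ s) * Metric.ediam A ^ s := by
          refine Finset.sum_le_sum fun w _ => ?_
          rw [ENNReal.prod_rpow_of_nonneg hs, ← ENNReal.mul_rpow_of_nonneg _ _ hs]
          exact ENNReal.rpow_le_rpow (hd n w) hs
      _ = Metric.ediam A ^ s := by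
          rw [← Finset.sum_mul, ← Fintype.sum_pow (fun i => (c i : ℝ≥0∞) ^ s), hsum, one_pow,
            one_mul]

/-- If the measures of finitely many measurable sets add up to at most the finite measure of their
union, then the sets are pairwise almost disjoint. -/
theorem measure_inter_eq_zero_of_sum_le_measure_iUnion {X ι : Type*} [MeasurableSpace X]
    [Fintype ι] {μ : Measure X} {A : ι → Set X} (hA : ∀ i, MeasurableSet (A i))
    (hfin : μ (⋃ i, A i) ≠ ∞) (hsum : ∑ i, μ (A i) ≤ μ (⋃ i, A i)) {i j : ι} (hij : i ≠ j) :
    μ (A i ∩ A j) = 0 := by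
  classical
  set R := (Finset.univ.erase i).erase j
  have hsplit : ∑ k, μ (A k) = μ (A i) + μ (A j) + ∑ k ∈ R, μ (A k) := by
    rw [← Finset.add_sum_erase _ _ (Finset.mem_univ i),
      ← Finset.add_sum_erase (Finset.univ.erase i) _ (by simp [hij.symm] : j ∈ _), add_assoc]
  have hsub : μ (⋃ k, A k) ≤ μ (A i ∪ A j) + ∑ k ∈ R, μ (A k) := by
    refine (measure_mono (iUnion_subset fun k => ?_)).trans ((measure_union_le _ _).trans
      (add_le_add_right (measure_biUnion_finset_le R A) _))
    by_cases hki : k = i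
    · exact hki ▸ subset_union_left.trans subset_union_left
    by_cases hkj : k = j
    · exact hkj ▸ subset_union_right.trans subset_union_left
    · exact (subset_biUnion_of_mem (u := A) (show k ∈ (R : Set ι) by simp [R, hki, hkj])).trans
        subset_union_right
  have hle : μ (⋃ k, A k) + μ (A i ∩ A j) ≤ μ (⋃ k, A k) + 0 := by
    rw [add_zero]
    calc μ (⋃ k, A k) + μ (A i ∩ A j)
        ≤ μ (A i ∪ A j) + ∑ k ∈ R, μ (A k) + μ (A i ∩ A j) := by gcongr
      _ = ∑ k, μ (A k) := by
        rw [hsplit, ← measure_union_add_inter (A i) (hA j)]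
        ring
      _ ≤ _ := hsum
  exact nonpos_iff_eq_zero.1 ((ENNReal.add_le_add_iff_left hfin).1 hle)

theorem stmt2 {d m : ℕ} (hm : 2 ≤ m)
    (r : Fin m → ℝ) (hr : ∀ i, 0 < r i ∧ r i < 1)
    (O : Fin m → (EuclideanSpace ℝ (Fin d)) ≃ₗᵢ[ℝ] EuclideanSpace ℝ (Fin d))
    (t : Fin m → EuclideanSpace ℝ (Fin d))
    (S : Fin m → EuclideanSpace ℝ (Fin d) → EuclideanSpace ℝ (Fin d))
    (hS : ∀ i x, S i x = r i • (O i x) + t i)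
    (Λ : Set (EuclideanSpace ℝ (Fin d))) (hΛc : IsCompact Λ) (hΛne : Λ.Nonempty)
    (hΛ : Λ = ⋃ i, S i '' Λ)
    (s : ℝ) (hs : 0 ≤ s) (hsum : ∑ i, r i ^ s = 1)
    (V : Set (EuclideanSpace ℝ (Fin d))) (hVne : V.Nonempty)
    (hVbdd : Bornology.IsBounded V) (hVopen : IsOpen V)
    (hVmap : ∀ i, S i '' V ⊆ V)
    (hVdisj : ∀ i j, i ≠ j → Disjoint (S i '' V) (S j '' V)) :
    ∀ i j, i ≠ j → μH[s] ((S i '' Λ) ∩ (S j '' Λ)) = 0 := by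
  lift r to Fin m → NNReal using fun i => (hr i).1.le
  have hlip : ∀ i, LipschitzWith (r i) (S i) := fun i => by
    refine LipschitzWith.of_dist_le_mul fun x y => ?_
    rw [hS, hS, dist_add_right, dist_smul₀, (O i).dist_map]
    simp
  have hsum' : ∑ i, (r i : ℝ≥0∞) ^ s = 1 := by
    simp_rw [← ENNReal.coe_rpow_of_nonneg _ hs]
    dsimp only at hsum
    exact_mod_cast hsum
  have hfin : μH[s] Λ ≠ ∞ := ne_top_of_le_ne_top
    (ENNReal.rpow_ne_top_of_nonneg hs hΛc.isBounded.ediam_ne_top)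
    (hausdorffMeasure_le_ediam_rpow_of_invariant (fun i => by exact_mod_cast (hr i).2) hlip
      hΛ.subset hΛc.isBounded.ediam_ne_top hs hsum')
  intro i j hij
  refine measure_inter_eq_zero_of_sum_le_measure_iUnion (A := fun i => S i '' Λ)
    (fun i => (hΛc.image (hlip i).continuous).measurableSet) (hΛ ▸ hfin) ?_ hij
  calc ∑ k, μH[s] (S k '' Λ) ≤ ∑ k, (r k : ℝ≥0∞) ^ s * μH[s] Λ :=
        Finset.sum_le_sum fun k _ => (hlip k).hausdorffMeasure_image_le hs Λ
    _ = μH[s] (⋃ k, S k '' Λ) := by rw [← Finset.sum_mul, hsum', one_mul, ← hΛ]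
end

section
/- For any self-similar set Λ ⊂ ℝ^d (the attractor of a self-similar IFS), the lower box dimension, the upper box dimension, and the Hausdorff dimension of Λ all coincide; in particular the box dimension of Λ exists and equals dim_H Λ. -/
open MeasureTheory Filter Set
open scoped ENNReal

/-- The smallest number of sets of diameter at most `δ` needed to cover `E`. -/
noncomputable def coverNum {X : Type*} [EMetricSpace X] (E : Set X) (δ : ℝ) : ℕ :=
  sInf {n : ℕ | ∃ U : Fin n → Set X, (∀ i, EMetric.diam (U i) ≤ ENNReal.ofReal δ) ∧
    E ⊆ ⋃ i, U i}

/-- Lower box (Minkowski) dimension: `liminf_{δ→0⁺} log N_δ(E) / (- log δ)`. -/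
noncomputable def lowerBoxDim {X : Type*} [EMetricSpace X] (E : Set X) : ℝ :=
  liminf (fun δ : ℝ => Real.log (coverNum E δ) / (-Real.log δ)) (nhdsWithin 0 (Set.Ioi 0))

/-- Upper box (Minkowski) dimension: `limsup_{δ→0⁺} log N_δ(E) / (- log δ)`. -/
noncomputable def upperBoxDim {X : Type*} [EMetricSpace X] (E : Set X) : ℝ :=
  limsup (fun δ : ℝ => Real.log (coverNum E δ) / (-Real.log δ)) (nhdsWithin 0 (Set.Ioi 0))

/-- A finite cover of a set that contains separated expanded copies of itself cannot have small
total `s`-dimensional weight. -/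
lemma rpow_le_sum_of_separated_copies {X ι κ : Type*} [MetricSpace X] [Fintype ι]
    {Λ : Set X} (hΛ : Λ.Nonempty) {s lam η : ℝ} (hlam : 0 < lam) (hη : 0 < η)
    (hs : 0 < s) (φ : ι → X → X) (hmaps : ∀ i, MapsTo (φ i) Λ Λ)
    (hexp : ∀ i, ∀ x ∈ Λ, ∀ y ∈ Λ, lam * dist x y ≤ dist (φ i x) (φ i y))
    (hsep : ∀ i j, i ≠ j → ∀ x ∈ Λ, ∀ y ∈ Λ, η ≤ dist (φ i x) (φ j y))
    (hcard : 1 < Fintype.card ι) (hsum : 1 ≤ Fintype.card ι * lam ^ s)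
    (J : Finset κ) (U : κ → Set X) (a : κ → ℝ) (ha : ∀ j, 0 ≤ a j)
    (hU : ∀ j, ∀ x ∈ Λ ∩ U j, ∀ y ∈ Λ ∩ U j, dist x y ≤ a j)
    (hcov : Λ ⊆ ⋃ j ∈ J, U j) : η ^ s ≤ ∑ j ∈ J, a j ^ s := by
  classical
  induction J using Finset.strongInduction generalizing U a with
  | H J ih =>
  by_cases hbig : ∃ j ∈ J, η ≤ a j
  · obtain ⟨j, hj, hle⟩ := hbig
    calc η ^ s ≤ a j ^ s := Real.rpow_le_rpow hη.le hle hs.le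
      _ ≤ _ := Finset.single_le_sum (f := fun j => a j ^ s)
        (fun j _ => Real.rpow_nonneg (ha j) s) hj
  push Not at hbig
  set I : ι → Finset κ := fun i => J.filter fun j => ∃ x ∈ Λ, φ i x ∈ U j with hI
  have hdisj : ∀ i i', i ≠ i' → ∀ j ∈ I i, j ∉ I i' := by
    intro i i' hne j hj hj'
    simp only [hI, Finset.mem_filter] at hj hj'
    obtain ⟨hjJ, x, hx, hxU⟩ := hj
    obtain ⟨-, y, hy, hyU⟩ := hj'
    have h1 := hU j _ ⟨hmaps i hx, hxU⟩ _ ⟨hmaps i' hy, hyU⟩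
    linarith [hsep i i' hne x hx y hy, hbig j hjJ]
  have hssub : ∀ i, I i ⊂ J := by
    intro i
    refine (Finset.filter_subset _ _).ssubset_of_ne fun heq => ?_
    obtain ⟨i', hi'⟩ := Fintype.exists_ne_of_one_lt_card hcard i
    obtain ⟨x, hx⟩ := hΛ
    obtain ⟨j, hj, hxj⟩ := mem_iUnion₂.1 (hcov (hmaps i' hx))
    refine hdisj i i' hi'.symm j ((Finset.ext_iff.1 heq j).2 hj)
      (by simpa [hI] using ⟨hj, x, hx, hxj⟩)
  have hpart : ∀ i, lam ^ s * η ^ s ≤ ∑ j ∈ I i, a j ^ s := by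
    intro i
    have h := ih (I i) (hssub i) (fun j => φ i ⁻¹' U j) (fun j => a j / lam)
      (fun j => div_nonneg (ha j) hlam.le)
      (fun j x hx y hy => by
        rw [le_div_iff₀ hlam, mul_comm]
        exact (hexp i x hx.1 y hy.1).trans
          (hU j _ ⟨hmaps i hx.1, hx.2⟩ _ ⟨hmaps i hy.1, hy.2⟩))
      (fun x hx => by
        obtain ⟨j, hj, hxj⟩ := mem_iUnion₂.1 (hcov (hmaps i hx))
        exact mem_iUnion₂.2 ⟨j, by simpa [hI] using ⟨hj, x, hx, hxj⟩, hxj⟩)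
    simp only [fun j => Real.div_rpow (ha j) hlam.le s] at h
    rwa [← Finset.sum_div, le_div_iff₀ (by positivity), mul_comm] at h
  calc η ^ s ≤ (Fintype.card ι * lam ^ s) * η ^ s :=
        le_mul_of_one_le_left (by positivity) hsum
    _ = ∑ _i : ι, lam ^ s * η ^ s := by simp [mul_assoc]
    _ ≤ ∑ i, ∑ j ∈ I i, a j ^ s := Finset.sum_le_sum fun i _ => hpart i
    _ = ∑ j ∈ Finset.univ.biUnion I, a j ^ s :=
        (Finset.sum_biUnion fun i _ i' _ hne => Finset.disjoint_left.2 (hdisj i i' hne)).symm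
    _ ≤ ∑ j ∈ J, a j ^ s := Finset.sum_le_sum_of_subset_of_nonneg
        (Finset.biUnion_subset.2 fun i _ => (hssub i).subset)
        fun j _ _ => Real.rpow_nonneg (ha j) s

/-- A compact set of dimension less than `s` has finite covers of small total `s`-dimensional
weight. -/
lemma exists_finset_cover_sum_lt {X : Type*} [MetricSpace X] {Λ : Set X} (hΛ : IsCompact Λ)
    {s : ℝ} (hs : 0 < s) (hdim : dimH Λ < ENNReal.ofReal s) {c : ℝ} (hc : 0 < c) :
    ∃ (J : Finset ℕ) (U : ℕ → Set X) (a : ℕ → ℝ), (∀ j, 0 ≤ a j) ∧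
      (∀ j, ∀ x ∈ U j, ∀ y ∈ U j, dist x y ≤ a j) ∧ (Λ ⊆ ⋃ j ∈ J, U j) ∧
      ∑ j ∈ J, a j ^ s < c := by
  borelize X
  have h0 : μH[s] Λ = 0 := by
    have := hausdorffMeasure_of_dimH_lt (d := s.toNNReal) hdim
    rwa [Real.coe_toNNReal s hs.le] at this
  have hc2 : (0 : ℝ≥0∞) < ENNReal.ofReal (c / 2) := ENNReal.ofReal_pos.2 (by positivity)
  rw [Measure.hausdorffMeasure_apply] at h0
  have h1 := le_iSup₂ (f := fun (r : ℝ≥0∞) (_ : 0 < r) =>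
    ⨅ (t : ℕ → Set X) (_ : Λ ⊆ ⋃ n, t n) (_ : ∀ n, Metric.ediam (t n) ≤ r),
      ∑' n, ⨆ _ : (t n).Nonempty, Metric.ediam (t n) ^ s) 1 one_pos
  replace h1 := (h1.trans h0.le).trans_lt hc2
  simp only [iInf_lt_iff] at h1
  obtain ⟨t, htΛ, ht1, htsum⟩ := h1
  obtain ⟨ε, hε, hεsum⟩ := ENNReal.exists_pos_sum_of_countable' hc2.ne' ℕ
  have hbdd : ∀ n, Bornology.IsBounded (t n) := fun n =>
    Metric.isBounded_iff_ediam_ne_top.2 ((ht1 n).trans_lt ENNReal.one_lt_top).ne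
  have hρ : ∀ n, ∃ ρ : ℝ, 0 < ρ ∧ ENNReal.ofReal ((Metric.diam (t n) + 2 * ρ) ^ s) ≤
      ENNReal.ofReal (Metric.diam (t n) ^ s) + ε n := by
    intro n
    have hcont : Continuous fun ρ : ℝ =>
        ENNReal.ofReal ((Metric.diam (t n) + 2 * ρ) ^ s) :=
      ENNReal.continuous_ofReal.comp
        ((by fun_prop : Continuous fun ρ : ℝ => Metric.diam (t n) + 2 * ρ).rpow_const
          fun _ => Or.inr hs.le)
    have hlt : ENNReal.ofReal ((Metric.diam (t n) + 2 * 0) ^ s) <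
        ENNReal.ofReal (Metric.diam (t n) ^ s) + ε n := by
      rw [mul_zero, add_zero]
      exact ENNReal.lt_add_right ENNReal.ofReal_ne_top (hε n).ne'
    have hev := (hcont.tendsto 0).eventually_lt_const hlt
    obtain ⟨ρ, hρ, hρ0⟩ := ((hev.filter_mono nhdsWithin_le_nhds).and
      (self_mem_nhdsWithin (s := Ioi (0 : ℝ)))).exists
    exact ⟨ρ, hρ0, hρ.le⟩
  choose ρ hρ0 hρ using hρ
  obtain ⟨J, hJ⟩ := hΛ.elim_finite_subcover (fun n => Metric.thickening (ρ n) (t n))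
    (fun n => Metric.isOpen_thickening)
    (htΛ.trans (iUnion_mono fun n => Metric.self_subset_thickening (hρ0 n) _))
  have ha : ∀ n, 0 ≤ Metric.diam (t n) + 2 * ρ n := fun n => by
    have := hρ0 n; have := Metric.diam_nonneg (s := t n); positivity
  refine ⟨J, _, fun n => Metric.diam (t n) + 2 * ρ n, ha, fun n x hx y hy => ?_, hJ, ?_⟩
  · obtain ⟨x', hx', hxx⟩ := Metric.mem_thickening_iff.1 hx
    obtain ⟨y', hy', hyy⟩ := Metric.mem_thickening_iff.1 hy
    have h1 := Metric.dist_le_diam_of_mem (hbdd n) hx' hy'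
    have h2 := dist_triangle4 x x' y' y
    rw [dist_comm y' y] at h2
    linarith
  · rw [← ENNReal.ofReal_lt_ofReal_iff hc,
      ENNReal.ofReal_sum_of_nonneg fun n _ => Real.rpow_nonneg (ha n) s]
    have hterm : ∀ n, ENNReal.ofReal (Metric.diam (t n) ^ s) ≤
        ⨆ _ : (t n).Nonempty, Metric.ediam (t n) ^ s := by
      intro n
      rcases (t n).eq_empty_or_nonempty with h | h
      · simp [h, Real.zero_rpow hs.ne']
      · rw [← ENNReal.ofReal_rpow_of_nonneg Metric.diam_nonneg hs.le, Metric.diam,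
          ENNReal.ofReal_toReal (Metric.isBounded_iff_ediam_ne_top.1 (hbdd n))]
        exact le_iSup (fun _ : (t n).Nonempty => Metric.ediam (t n) ^ s) h
    calc ∑ n ∈ J, ENNReal.ofReal ((Metric.diam (t n) + 2 * ρ n) ^ s)
        ≤ ∑ n ∈ J, ((⨆ _ : (t n).Nonempty, Metric.ediam (t n) ^ s) + ε n) :=
          Finset.sum_le_sum fun n _ => (hρ n).trans (by gcongr; exact hterm n)
      _ ≤ ∑' n, ((⨆ _ : (t n).Nonempty, Metric.ediam (t n) ^ s) + ε n) :=
          ENNReal.sum_le_tsum J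
      _ < ENNReal.ofReal (c / 2) + ENNReal.ofReal (c / 2) := by
          rw [ENNReal.tsum_add]; exact ENNReal.add_lt_add htsum hεsum
      _ = ENNReal.ofReal c := by
          rw [← ENNReal.ofReal_add (by positivity) (by positivity), add_halves]

/-- If a compact set contains at least `lam ^ (-s)` separated copies of itself, each expanding
distances by at least `lam`, then its Hausdorff dimension is at least `s`. -/
lemma le_dimH_of_separated_copies {X ι : Type*} [MetricSpace X] [Fintype ι]
    {Λ : Set X} (hΛc : IsCompact Λ) (hΛ : Λ.Nonempty) {s lam η : ℝ} (hlam : 0 < lam)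
    (hη : 0 < η) (hs : 0 < s) (φ : ι → X → X) (hmaps : ∀ i, MapsTo (φ i) Λ Λ)
    (hexp : ∀ i, ∀ x ∈ Λ, ∀ y ∈ Λ, lam * dist x y ≤ dist (φ i x) (φ i y))
    (hsep : ∀ i j, i ≠ j → ∀ x ∈ Λ, ∀ y ∈ Λ, η ≤ dist (φ i x) (φ j y))
    (hcard : 1 < Fintype.card ι) (hsum : 1 ≤ Fintype.card ι * lam ^ s) :
    ENNReal.ofReal s ≤ dimH Λ := by
  by_contra! hlt
  obtain ⟨J, U, a, ha, hU, hcov, hlt⟩ :=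
    exists_finset_cover_sum_lt hΛc hs hlt (Real.rpow_pos_of_pos hη s)
  exact hlt.not_ge (rpow_le_sum_of_separated_copies hΛ hlam hη hs φ hmaps hexp hsep hcard hsum
    J U a ha (fun j x hx y hy => hU j x hx.2 y hy.2) hcov)

lemma coverNum_le_card {X κ : Type*} [EMetricSpace X] [Fintype κ] {E : Set X} {δ : ℝ}
    (U : κ → Set X) (hU : ∀ i, Metric.ediam (U i) ≤ ENNReal.ofReal δ) (hE : E ⊆ ⋃ i, U i) :
    coverNum E δ ≤ Fintype.card κ :=
  Nat.sInf_le ⟨fun i => U ((Fintype.equivFin κ).symm i), fun _ => hU _,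
    by rwa [(Fintype.equivFin κ).symm.surjective.iUnion_comp U]⟩

lemma ediam_closedBall_half_le {X : Type*} [PseudoMetricSpace X] (x : X) (δ : ℝ) :
    Metric.ediam (Metric.closedBall x (δ / 2)) ≤ ENNReal.ofReal δ := by
  refine Metric.ediam_le fun y hy z hz => ?_
  rw [edist_dist]
  refine ENNReal.ofReal_le_ofReal ?_
  have := dist_triangle_right y z x
  rw [Metric.mem_closedBall] at hy hz
  linarith

/-- A compact set has a finite `δ`-separated subset whose closed `δ`-balls cover it. -/
lemma exists_separated_cover {X : Type*} [PseudoMetricSpace X] {E : Set X} (hE : IsCompact E)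
    {δ : ℝ} (hδ : 0 < δ) :
    ∃ T : Finset X, ↑T ⊆ E ∧ (∀ x ∈ T, ∀ y ∈ T, x ≠ y → δ < dist x y) ∧
      E ⊆ ⋃ x : T, Metric.closedBall (x : X) δ := by
  lift δ to NNReal using hδ.le
  have hδ2 : δ / 2 ≠ 0 := by
    have : 0 < δ := hδ
    positivity
  obtain ⟨N, -, hN, hcov⟩ := Metric.exists_finite_isCover_of_isCompact hδ2 hE
  have hfin : Metric.packingNumber δ E ≠ ⊤ := by
    have h := (Metric.packingNumber_two_mul_le_externalCoveringNumber (δ / 2) E).trans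
      hcov.externalCoveringNumber_le_encard
    rw [mul_div_cancel₀ δ (two_ne_zero)] at h
    exact (h.trans_lt hN.encard_lt_top).ne
  obtain ⟨T, hT⟩ : ∃ T : Finset X, ↑T = Metric.maximalSeparatedSet δ E := by
    refine (Set.encard_ne_top_iff.1 ?_).exists_finset_coe
    rwa [Metric.encard_maximalSeparatedSet hfin]
  refine ⟨T, hT ▸ Metric.maximalSeparatedSet_subset, fun x hx y hy hne => ?_, ?_⟩
  · have h := Metric.isSeparated_maximalSeparatedSet (ε := δ) (A := E)
      (hT ▸ Finset.mem_coe.2 hx) (hT ▸ Finset.mem_coe.2 hy) hne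
    simp only [edist_nndist, ENNReal.coe_lt_coe] at h
    exact_mod_cast h
  · have h := Metric.isCover_iff_subset_iUnion_closedBall.1
      (Metric.isCover_maximalSeparatedSet hfin)
    rw [← hT] at h
    simpa only [Finset.mem_coe, ← iUnion_subtype (fun x => x ∈ T)
      (fun x => Metric.closedBall (x : X) δ)] using h

lemma exists_coverNum_cover {X : Type*} [MetricSpace X] {E : Set X} (hE : IsCompact E)
    {δ : ℝ} (hδ : 0 < δ) :
    ∃ U : Fin (coverNum E δ) → Set X, (∀ i, Metric.ediam (U i) ≤ ENNReal.ofReal δ) ∧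
      E ⊆ ⋃ i, U i := by
  obtain ⟨T, -, -, hT⟩ := exists_separated_cover hE (half_pos hδ)
  refine Nat.sInf_mem (s := {n : ℕ | ∃ U : Fin n → Set X,
    (∀ i, Metric.ediam (U i) ≤ ENNReal.ofReal δ) ∧ E ⊆ ⋃ i, U i})
    ⟨Fintype.card T, fun i => Metric.closedBall ((Fintype.equivFin T).symm i : X) (δ / 2),
      fun _ => ediam_closedBall_half_le _ _, ?_⟩
  rwa [(Fintype.equivFin T).symm.surjective.iUnion_comp
    (fun x : T => Metric.closedBall (x : X) (δ / 2))]

lemma coverNum_pos {X : Type*} [MetricSpace X] {E : Set X} (hE : IsCompact E)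
    (hne : E.Nonempty) {δ : ℝ} (hδ : 0 < δ) : 0 < coverNum E δ := by
  obtain ⟨U, -, hU⟩ := exists_coverNum_cover hE hδ
  obtain ⟨x, hx⟩ := hne
  obtain ⟨i, -⟩ := mem_iUnion.1 (hU hx)
  exact i.pos

/-- The Hausdorff dimension of a compact set is bounded by `s` if its covering numbers are at most
`δ ^ (-s)` along arbitrarily small scales `δ`. -/
lemma dimH_le_of_frequently_coverNum_le {X : Type*} [MetricSpace X] {E : Set X}
    (hE : IsCompact E) {s : ℝ} (hs : 0 ≤ s)
    (h : ∃ᶠ δ in nhdsWithin (0 : ℝ) (Ioi 0), (coverNum E δ : ℝ) ≤ δ ^ (-s)) :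
    dimH E ≤ ENNReal.ofReal s := by
  borelize X
  refine dimH_le_of_hausdorffMeasure_ne_top (d := s.toNNReal)
    (ne_top_of_le_ne_top ENNReal.one_ne_top ?_)
  rw [Real.coe_toNNReal s hs, Measure.hausdorffMeasure_apply]
  refine iSup₂_le fun r hr => ?_
  have hev : ∀ᶠ δ in nhdsWithin (0 : ℝ) (Ioi 0), 0 < δ ∧ ENNReal.ofReal δ ≤ r := by
    have h0 := (ENNReal.continuous_ofReal.tendsto 0).eventually_le_const (u := r) (by simpa)
    exact (eventually_mem_nhdsWithin (s := Ioi (0 : ℝ))).and (h0.filter_mono nhdsWithin_le_nhds)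
  obtain ⟨δ, hN, hδ, hδr⟩ := (h.and_eventually hev).exists
  obtain ⟨U, hU, hcov⟩ := exists_coverNum_cover hE hδ
  let t : ℕ → Set X := fun n => if hn : n < coverNum E δ then U ⟨n, hn⟩ else ∅
  have htd : ∀ n, Metric.ediam (t n) ≤ ENNReal.ofReal δ := by
    intro n
    by_cases hn : n < coverNum E δ <;> simp [t, hn, hU]
  refine (iInf₂_le t fun x hx => ?_).trans ((iInf_le _ fun n => (htd n).trans hδr).trans ?_)
  · obtain ⟨i, hi⟩ := mem_iUnion.1 (hcov hx)
    exact mem_iUnion.2 ⟨i, by simpa [t] using hi⟩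
  rw [tsum_eq_sum (s := Finset.range (coverNum E δ))
    (fun n hn => by simp [t, Finset.mem_range.not.1 hn])]
  calc ∑ n ∈ Finset.range (coverNum E δ), ⨆ _ : (t n).Nonempty, Metric.ediam (t n) ^ s
      ≤ ∑ _n ∈ Finset.range (coverNum E δ), ENNReal.ofReal (δ ^ s) :=
        Finset.sum_le_sum fun n _ => iSup_le fun _ => by
          rw [← ENNReal.ofReal_rpow_of_pos hδ]
          exact ENNReal.rpow_le_rpow (htd n) hs
    _ = ENNReal.ofReal (coverNum E δ * δ ^ s) := by
        rw [Finset.sum_const, Finset.card_range, nsmul_eq_mul,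
          ENNReal.ofReal_mul (Nat.cast_nonneg _), ENNReal.ofReal_natCast]
    _ ≤ 1 := by
        rw [← ENNReal.ofReal_one]
        refine ENNReal.ofReal_le_ofReal ?_
        calc (coverNum E δ : ℝ) * δ ^ s ≤ δ ^ (-s) * δ ^ s := by gcongr
          _ = 1 := by rw [← Real.rpow_add hδ]; simp

/-- A set `Λ` has large small copies if every ball centred on it of radius at most `R` contains the
image of a map of `Λ` into itself that expands distances by at least `c` times the radius. -/
def HasLargeCopies {X : Type*} [MetricSpace X] (Λ : Set X) (c R : ℝ) : Prop :=
  ∀ x ∈ Λ, ∀ ρ, 0 < ρ → ρ ≤ R → ∃ φ : X → X, MapsTo φ Λ (Λ ∩ Metric.closedBall x ρ) ∧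
    ∀ y ∈ Λ, ∀ z ∈ Λ, c * ρ * dist y z ≤ dist (φ y) (φ z)

lemma HasLargeCopies.le_dimH {X : Type*} [MetricSpace X] {Λ : Set X} {c R : ℝ}
    (h : HasLargeCopies Λ c R) (hΛc : IsCompact Λ) (hΛ : Λ.Nonempty) (hc : 0 < c) (hR : 0 < R)
    {s s' : ℝ} (hs : 0 < s) (hss : s < s')
    (hN : ∃ᶠ δ in nhdsWithin (0 : ℝ) (Ioi 0), δ ^ (-s') ≤ (coverNum Λ δ : ℝ)) :
    ENNReal.ofReal s ≤ dimH Λ := by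
  have hev : ∀ᶠ δ in nhdsWithin (0 : ℝ) (Ioi 0), 0 < δ ∧ δ < 8 * R ∧ δ < 1 ∧
      δ ^ (s' - s) ≤ (c / 8) ^ s := by
    have hlt : ∀ a : ℝ, 0 < a → ∀ᶠ δ in nhdsWithin (0 : ℝ) (Ioi 0), δ < a := fun a ha =>
      (eventually_lt_nhds ha).filter_mono nhdsWithin_le_nhds
    have hcont : ContinuousAt (fun δ : ℝ => δ ^ (s' - s)) 0 :=
      Real.continuousAt_rpow_const _ _ (Or.inr (by linarith))
    have h0 := hcont.eventually_le_const (u := (c / 8) ^ s)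
      (by simp only [Real.zero_rpow (sub_pos.2 hss).ne']; positivity)
    filter_upwards [eventually_mem_nhdsWithin, hlt (8 * R) (by positivity), hlt 1 one_pos,
      h0.filter_mono nhdsWithin_le_nhds] with δ h1 h2 h3 h4 using ⟨h1, h2, h3, h4⟩
  obtain ⟨δ, hN, hδ, hδR, hδ1, hδs⟩ := (hN.and_eventually hev).exists
  obtain ⟨T, hTΛ, hTsep, hTcov⟩ := exists_separated_cover hΛc (half_pos hδ)
  have hcard : δ ^ (-s') ≤ (Fintype.card T : ℝ) := hN.trans <| by
    exact_mod_cast coverNum_le_card (fun x : T => Metric.closedBall (x : X) (δ / 2))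
      (fun _ => ediam_closedBall_half_le _ _) hTcov
  choose φ hφ hφexp using fun x : T => h x (hTΛ x.2) (δ / 8) (by positivity) (by linarith)
  have hlam : 0 < c * (δ / 8) := by positivity
  refine le_dimH_of_separated_copies hΛc hΛ hlam (half_pos (half_pos hδ)) hs φ
    (fun x y hy => (hφ x hy).1) hφexp (fun x y hne u hu v hv => ?_) ?_ ?_
  · have h1 := hTsep x x.2 y y.2 fun h => hne (Subtype.ext h)
    have h2 := Metric.mem_closedBall.1 (hφ x hu).2
    have h3 := Metric.mem_closedBall.1 (hφ y hv).2
    have h4 := dist_triangle4 (x : X) (φ x u) (φ y v) y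
    rw [dist_comm (x : X) (φ x u)] at h4
    linarith
  · have : 1 < δ ^ (-s') := Real.one_lt_rpow_of_pos_of_lt_one_of_neg hδ hδ1 (by linarith)
    exact_mod_cast this.trans_le hcard
  · calc (1 : ℝ) = δ ^ (-s') * (δ ^ (s' - s) * δ ^ s) := by
          rw [← Real.rpow_add hδ, ← Real.rpow_add hδ]; simp
      _ ≤ δ ^ (-s') * ((c / 8) ^ s * δ ^ s) := by gcongr
      _ = δ ^ (-s') * (c * (δ / 8)) ^ s := by
          rw [← Real.mul_rpow (by positivity) hδ.le]; ring_nf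
      _ ≤ _ := by gcongr

/-- In a compact set of finite Hausdorff dimension with large copies of itself, the box counting
ratios converge to the Hausdorff dimension. -/
lemma HasLargeCopies.tendsto_log_coverNum {X : Type*} [MetricSpace X] {Λ : Set X} {c R : ℝ}
    (h : HasLargeCopies Λ c R) (hΛc : IsCompact Λ) (hΛ : Λ.Nonempty) (hc : 0 < c) (hR : 0 < R)
    (hfin : dimH Λ ≠ ⊤) :
    Tendsto (fun δ : ℝ => Real.log (coverNum Λ δ) / (-Real.log δ)) (nhdsWithin 0 (Ioi 0))
      (nhds (dimH Λ).toReal) := by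
  have h01 : ∀ᶠ δ in nhdsWithin (0 : ℝ) (Ioi 0), 0 < δ ∧ δ < 1 :=
    eventually_mem_nhdsWithin.and
      ((eventually_lt_nhds one_pos).filter_mono nhdsWithin_le_nhds)
  have hlog : ∀ δ : ℝ, 0 < δ ∧ δ < 1 → 0 < -Real.log δ := fun δ hδ =>
    neg_pos.2 (Real.log_neg hδ.1 hδ.2)
  have hpos : ∀ δ : ℝ, 0 < δ → (0 : ℝ) < coverNum Λ δ := fun δ hδ => by
    exact_mod_cast coverNum_pos hΛc hΛ hδ
  refine tendsto_order.2 ⟨fun a ha => ?_, fun b hb => ?_⟩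
  · rcases lt_or_ge a 0 with ha0 | ha0
    · filter_upwards [h01] with δ hδ
      exact ha0.trans_le (div_nonneg (Real.log_natCast_nonneg _) (hlog δ hδ).le)
    by_contra hcon
    have hle : dimH Λ ≤ ENNReal.ofReal a := by
      refine dimH_le_of_frequently_coverNum_le hΛc ha0
        (((not_eventually.1 hcon).and_eventually h01).mono fun δ hδ => ?_)
      obtain ⟨hδ, hδ01⟩ := hδ
      rw [not_lt, div_le_iff₀ (hlog δ hδ01)] at hδ
      rw [← Real.log_le_log_iff (hpos δ hδ01.1) (Real.rpow_pos_of_pos hδ01.1 _),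
        Real.log_rpow hδ01.1]
      linarith
    exact ha.not_ge (ENNReal.toReal_le_of_le_ofReal ha0 hle)
  · by_contra hcon
    obtain ⟨s, hs, hsb⟩ := exists_between hb
    have hs0 : 0 < s := ENNReal.toReal_nonneg.trans_lt hs
    have hle : ENNReal.ofReal s ≤ dimH Λ := by
      refine h.le_dimH hΛc hΛ hc hR hs0 hsb
        (((not_eventually.1 hcon).and_eventually h01).mono fun δ hδ => ?_)
      obtain ⟨hδ, hδ01⟩ := hδ
      rw [not_lt, le_div_iff₀ (hlog δ hδ01)] at hδ
      rw [← Real.log_le_log_iff (Real.rpow_pos_of_pos hδ01.1 _) (hpos δ hδ01.1),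
        Real.log_rpow hδ01.1]
      linarith
    exact hs.not_ge ((ENNReal.ofReal_le_iff_le_toReal hfin).1 hle)

/-- The attractor of finitely many contracting similarities has large small copies of itself. -/
lemma hasLargeCopies_of_similarities {X ι : Type*} [MetricSpace X] [Finite ι] {Λ : Set X}
    (hΛc : IsCompact Λ) (hΛne : Λ.Nonempty) (r : ι → ℝ) (hr : ∀ i, 0 < r i ∧ r i < 1)
    (S : ι → X → X) (hS : ∀ i x y, dist (S i x) (S i y) = r i * dist x y)
    (hΛ : Λ = ⋃ i, S i '' Λ) :
    ∃ c R : ℝ, 0 < c ∧ 0 < R ∧ HasLargeCopies Λ c R := by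
  have : Nonempty ι := by
    obtain ⟨x, hx⟩ := hΛne
    rw [hΛ] at hx
    exact ⟨(mem_iUnion.1 hx).choose⟩
  obtain ⟨imin, hmin⟩ := Finite.exists_min r
  obtain ⟨imax, hmax⟩ := Finite.exists_max r
  obtain ⟨D, hD, hdiam⟩ : ∃ D : ℝ, 0 < D ∧ ∀ x ∈ Λ, ∀ y ∈ Λ, dist x y ≤ D :=
    ⟨Metric.diam Λ + 1, by positivity, fun x hx y hy =>
      (Metric.dist_le_diam_of_mem hΛc.isBounded hx hy).trans (by linarith)⟩
  have hSΛ : ∀ i, MapsTo (S i) Λ Λ := fun i x hx => by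
    rw [hΛ]
    exact mem_iUnion.2 ⟨i, mem_image_of_mem _ hx⟩
  have key : ∀ n : ℕ, ∀ x ∈ Λ, ∀ ρ, ρ ≤ D → D * r imax ^ n ≤ ρ →
      ∃ (φ : X → X) (lam : ℝ), MapsTo φ Λ Λ ∧ (∀ y z, dist (φ y) (φ z) = lam * dist y z) ∧
        (∃ y ∈ Λ, φ y = x) ∧ 0 < lam ∧ lam * D ≤ ρ ∧ r imin * ρ ≤ lam * D := by
    intro n
    induction n with
    | zero =>
      intro x hx ρ hρ hρ'
      refine ⟨id, 1, mapsTo_id _, by simp, ⟨x, hx, rfl⟩, one_pos, by simpa using hρ', ?_⟩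
      nlinarith [hr imin]
    | succ n ih =>
      intro x hx ρ hρ hρ'
      rw [hΛ] at hx
      obtain ⟨i, y, hy, rfl⟩ := mem_iUnion.1 hx
      obtain ⟨hri, -⟩ := hr i
      by_cases hbig : r i * D ≤ ρ
      · refine ⟨S i, r i, hSΛ i, hS i, ⟨y, hy, rfl⟩, hri, hbig, ?_⟩
        exact mul_le_mul (hmin i) hρ (le_trans (by have := (hr imax).1; positivity) hρ') hri.le
      · push Not at hbig
        obtain ⟨φ, lam, hφ, hφd, ⟨z, hz, hzy⟩, hlam, hle, hge⟩ := ih y hy (ρ / r i)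
          (by rw [div_le_iff₀ hri]; linarith)
          (by
            rw [le_div_iff₀ hri]
            refine le_trans ?_ hρ'
            rw [pow_succ, ← mul_assoc]
            exact mul_le_mul_of_nonneg_left (hmax i) (by have := (hr imax).1; positivity))
        refine ⟨S i ∘ φ, r i * lam, (hSΛ i).comp hφ, fun u v => ?_, ⟨z, hz, by simp [hzy]⟩,
          mul_pos hri hlam, ?_, ?_⟩
        · rw [Function.comp_apply, Function.comp_apply, hS, hφd, mul_assoc]
        · rw [le_div_iff₀ hri] at hle
          linarith
        · rw [← mul_div_assoc, div_le_iff₀ hri] at hge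
          linarith
  refine ⟨r imin / D, D, div_pos (hr imin).1 hD, hD, fun x hx ρ hρ hρD => ?_⟩
  obtain ⟨n, hn⟩ := exists_pow_lt_of_lt_one (div_pos hρ hD) (hr imax).2
  obtain ⟨φ, lam, hφ, hφd, ⟨w, hw, rfl⟩, hlam, hle, hge⟩ := key n x hx ρ hρD
    (by rw [lt_div_iff₀ hD] at hn; linarith)
  refine ⟨φ, fun y hy => ⟨hφ hy, ?_⟩, fun y _ z _ => ?_⟩
  · rw [Metric.mem_closedBall, hφd]
    exact (mul_le_mul_of_nonneg_left (hdiam y hy w hw) hlam.le).trans hle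
  · rw [hφd]
    refine mul_le_mul_of_nonneg_right ?_ dist_nonneg
    rw [div_mul_eq_mul_div, div_le_iff₀ hD]
    exact hge

theorem stmt3 {d m : ℕ} (hm : 2 ≤ m)
    (r : Fin m → ℝ) (hr : ∀ i, 0 < r i ∧ r i < 1)
    (O : Fin m → (EuclideanSpace ℝ (Fin d)) ≃ₗᵢ[ℝ] EuclideanSpace ℝ (Fin d))
    (t : Fin m → EuclideanSpace ℝ (Fin d))
    (S : Fin m → EuclideanSpace ℝ (Fin d) → EuclideanSpace ℝ (Fin d))
    (hS : ∀ i x, S i x = r i • (O i x) + t i)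
    (Λ : Set (EuclideanSpace ℝ (Fin d))) (hΛc : IsCompact Λ) (hΛne : Λ.Nonempty)
    (hΛ : Λ = ⋃ i, S i '' Λ) :
    lowerBoxDim Λ = upperBoxDim Λ ∧ ENNReal.ofReal (upperBoxDim Λ) = dimH Λ := by
  have hfin : dimH Λ ≠ ⊤ := ne_top_of_le_ne_top (ENNReal.natCast_ne_top _)
    ((dimH_mono (subset_univ Λ)).trans (Real.dimH_univ_eq_finrank _).le)
  obtain ⟨c, R, hc, hR, h⟩ := hasLargeCopies_of_similarities hΛc hΛne r hr S
    (fun i x y => by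
      rw [hS, hS, dist_add_right, dist_smul₀, (O i).dist_map, Real.norm_of_nonneg (hr i).1.le])
    hΛ
  have ht := h.tendsto_log_coverNum hΛc hΛne hc hR hfin
  have hupper : upperBoxDim Λ = (dimH Λ).toReal := ht.limsup_eq
  exact ⟨ht.liminf_eq.trans hupper.symm, by rw [hupper, ENNReal.ofReal_toReal hfin]⟩
end

section
/- For each λ ∈ (1/4, 2/5), let Λ̃_λ = { ∑_{i=0}^∞ a_i λ^i : a_i ∈ {0,1,3} }, the attractor of the IFS {S_i^λ(x) = λx + i}_{i ∈ {0,1,3}} on ℝ. Then for Lebesgue-almost every λ ∈ (1/3, 2/5), dim_H Λ̃_λ = 1. -/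
open MeasureTheory Set
open scoped ENNReal

/-- The digits `0, 1, 3`. -/
def digit : Fin 3 → ℝ := ![0, 1, 3]

/-- The value of a finite word in the digits `0, 1, 3` at base `lam`. -/
def wordValue {n : ℕ} (u : Fin n → Fin 3) (lam : ℝ) : ℝ :=
  ∑ i, digit (u i) * lam ^ (i : ℕ)

/-- The attractor of the system `x ↦ lam * x + i` for `i ∈ {0, 1, 3}`. -/
def attractor (lam : ℝ) : Set ℝ :=
  range fun w : ℕ → Fin 3 => ∑' i, digit (w i) * lam ^ i

lemma digit_mem (i : Fin 3) : digit i ∈ ({0, 1, 3} : Set ℝ) := by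
  fin_cases i <;> simp [digit]

lemma exists_digit_eq {x : ℝ} (hx : x ∈ ({0, 1, 3} : Set ℝ)) : ∃ i, digit i = x := by
  rcases hx with rfl | rfl | rfl
  · exact ⟨0, rfl⟩
  · exact ⟨1, rfl⟩
  · exact ⟨2, rfl⟩

lemma abs_digit_le (i : Fin 3) : |digit i| ≤ 3 := by
  fin_cases i <;> norm_num [digit]

lemma abs_digit_sub_le (i j : Fin 3) : |digit i - digit j| ≤ 3 := by
  fin_cases i <;> fin_cases j <;> norm_num [digit]

lemma one_le_abs_digit_sub {i j : Fin 3} (h : i ≠ j) : 1 ≤ |digit i - digit j| := by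
  fin_cases i <;> fin_cases j <;> first | exact absurd rfl h | norm_num [digit]

lemma setOf_expansions_eq_attractor (lam : ℝ) :
    {x : ℝ | ∃ a : ℕ → ℝ, (∀ i, a i ∈ ({0, 1, 3} : Set ℝ)) ∧ x = ∑' i : ℕ, a i * lam ^ i} =
      attractor lam := by
  ext x
  constructor
  · rintro ⟨a, ha, rfl⟩
    choose w hw using fun i => exists_digit_eq (ha i)
    exact ⟨w, by simp only [hw]⟩
  · rintro ⟨w, rfl⟩
    exact ⟨fun i => digit (w i), fun i => digit_mem _, rfl⟩

lemma isCompact_attractor {lam : ℝ} (h0 : 0 ≤ lam) (h1 : lam < 1) :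
    IsCompact (attractor lam) := by
  refine isCompact_range (continuous_tsum (u := fun i => 3 * lam ^ i) (fun i => ?_)
    ((summable_geometric_of_lt_one h0 h1).mul_left 3) fun i w => ?_)
  · exact (continuous_of_discreteTopology.comp (continuous_apply i)).mul continuous_const
  · rw [Real.norm_eq_abs, abs_mul, abs_of_nonneg (pow_nonneg h0 i)]
    exact mul_le_mul_of_nonneg_right (abs_digit_le _) (pow_nonneg h0 i)

lemma wordValue_mem_attractor {n : ℕ} (u : Fin n → Fin 3) (lam : ℝ) :
    wordValue u lam ∈ attractor lam := by
  refine ⟨fun i => if h : i < n then u ⟨i, h⟩ else 0, ?_⟩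
  dsimp only
  rw [tsum_eq_sum (s := Finset.range n), wordValue, ← Fin.sum_univ_eq_sum_range
    (fun i => digit (if h : i < n then u ⟨i, h⟩ else 0) * lam ^ i)]
  · simp
  · intro i hi
    rw [Finset.mem_range] at hi
    simp [hi, digit]

lemma wordValue_cons {n : ℕ} (i : Fin 3) (u : Fin n → Fin 3) (lam : ℝ) :
    wordValue (Fin.cons i u : Fin (n + 1) → Fin 3) lam = digit i + lam * wordValue u lam := by
  simp only [wordValue, Fin.sum_univ_succ, Fin.cons_zero, Fin.cons_succ, Fin.val_zero, pow_zero,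
    mul_one, Fin.val_succ, Finset.mul_sum]
  congr 1
  exact Finset.sum_congr rfl fun k _ => by ring

lemma continuous_wordValue {n : ℕ} (u : Fin n → Fin 3) : Continuous (wordValue u) := by
  unfold wordValue
  fun_prop

lemma sum_range_pow_sub_pow_le {x y : ℝ} (hx : 0 ≤ x) (hxy : x ≤ y) (hy : y < 1) (n : ℕ) :
    ∑ k ∈ Finset.range n, (y ^ (k + 1) - x ^ (k + 1)) ≤ (y - x) / ((1 - x) * (1 - y)) := by
  have key := (((hasSum_geometric_of_lt_one (hx.trans hxy) hy).mul_left y).sub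
    ((hasSum_geometric_of_lt_one hx (hxy.trans_lt hy)).mul_left x))
  have hle := sum_le_hasSum (Finset.range n) (fun k _ => ?_) key
  · refine le_trans (le_of_eq (Finset.sum_congr rfl fun k _ => by ring)) (hle.trans (le_of_eq ?_))
    have h1 : 1 - x ≠ 0 := by linarith
    have h2 : 1 - y ≠ 0 := by linarith
    field_simp
    ring
  · have := pow_le_pow_left₀ hx hxy (k + 1)
    simp only [pow_succ'] at this
    linarith

/-- After division by `x ^ 2`, a power series with constant coefficient at least `1` and
coefficients bounded by `3` is expanding on `(0, 2/5]`. -/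
lemma mul_sub_le_abs_div_sq_sub {n : ℕ} {c₀ : ℝ} {c : Fin n → ℝ} (h₀ : 1 ≤ |c₀|)
    (hc : ∀ k, |c k| ≤ 3) {x y : ℝ} (hx : 0 < x) (hxy : x ≤ y) (hy : y ≤ 2 / 5) :
    4 * (y - x) ≤ |(c₀ + ∑ k, c k * x ^ ((k : ℕ) + 1)) / x ^ 2 -
      (c₀ + ∑ k, c k * y ^ ((k : ℕ) + 1)) / y ^ 2| := by
  have hy0 : 0 < y := hx.trans_le hxy
  set g : ℕ → ℝ := fun k => x ^ k / x ^ 2 - y ^ k / y ^ 2 with hg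
  have hdecomp : (c₀ + ∑ k, c k * x ^ ((k : ℕ) + 1)) / x ^ 2 -
      (c₀ + ∑ k, c k * y ^ ((k : ℕ) + 1)) / y ^ 2 = c₀ * g 0 + ∑ k, c k * g ((k : ℕ) + 1) := by
    simp only [hg, mul_sub, Finset.sum_sub_distrib, add_div, Finset.sum_div, mul_div_assoc,
      pow_zero, mul_one_div]
    ring
  have hg0 : g 0 = (y - x) * ((x + y) / (x * y)) / (x * y) := by
    simp only [hg]; field_simp; ring
  have hg1 : |g 1| = (y - x) / (x * y) := by
    rw [show g 1 = (y - x) / (x * y) by simp only [hg]; field_simp]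
    exact abs_of_nonneg (div_nonneg (by linarith) (by positivity))
  have hg2 : |g 2| = 0 := by
    simp only [hg]
    rw [div_self (by positivity), div_self (by positivity), sub_self, abs_zero]
  have hg3 (k : ℕ) : |g (k + 3)| = y ^ (k + 1) - x ^ (k + 1) := by
    rw [show g (k + 3) = x ^ (k + 1) - y ^ (k + 1) by simp only [hg]; field_simp; ring,
      abs_sub_comm]
    exact abs_of_nonneg (sub_nonneg.2 (pow_le_pow_left₀ hx.le hxy _))
  have htail : |∑ k, c k * g ((k : ℕ) + 1)| ≤
      3 * ((y - x) / (x * y) + (y - x) / ((1 - x) * (1 - y))) := by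
    calc |∑ k, c k * g ((k : ℕ) + 1)| ≤ ∑ k : Fin n, 3 * |g ((k : ℕ) + 1)| := by
          refine (Finset.abs_sum_le_sum_abs _ _).trans (Finset.sum_le_sum fun k _ => ?_)
          rw [abs_mul]
          exact mul_le_mul_of_nonneg_right (hc k) (abs_nonneg _)
      _ = 3 * ∑ k ∈ Finset.range n, |g (k + 1)| := by
          rw [← Finset.mul_sum, Fin.sum_univ_eq_sum_range (fun k => |g (k + 1)|)]
      _ ≤ 3 * ∑ k ∈ Finset.range (n + 2), |g (k + 1)| := by
          gcongr
          omega
      _ ≤ 3 * ((y - x) / (x * y) + (y - x) / ((1 - x) * (1 - y))) := by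
          rw [Finset.sum_range_succ', Finset.sum_range_succ']
          simp only [zero_add, add_assoc, Nat.reduceAdd, hg1, hg2, hg3]
          have := sum_range_pow_sub_pow_le hx.le hxy (by linarith) n
          linarith
  have hxy0 : 0 < x * y := by positivity
  have hfive : 5 ≤ (x + y) / (x * y) := by
    rw [le_div_iff₀ hxy0]
    nlinarith
  have hprod : 25 / 4 ≤ 1 / (x * y) := by
    rw [le_div_iff₀ hxy0]
    nlinarith
  have hprod' : 1 / ((1 - x) * (1 - y)) ≤ 25 / 9 := by
    rw [div_le_iff₀ (by nlinarith)]
    nlinarith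
  have hhead : 5 * ((y - x) / (x * y)) ≤ |c₀ * g 0| := by
    have h5 : 5 * ((y - x) / (x * y)) ≤ g 0 := by
      rw [hg0, mul_div_assoc', mul_comm 5]
      gcongr
    calc _ ≤ |g 0| := h5.trans (le_abs_self _)
      _ ≤ |c₀| * |g 0| := le_mul_of_one_le_left (abs_nonneg _) h₀
      _ = _ := (abs_mul _ _).symm
  have htri := abs_sub_abs_le_abs_sub (c₀ * g 0) (-∑ k, c k * g ((k : ℕ) + 1))
  rw [sub_neg_eq_add, abs_neg] at htri
  rw [hdecomp]
  have h1 := mul_le_mul_of_nonneg_left hprod (sub_nonneg.2 hxy)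
  have h2 := mul_le_mul_of_nonneg_left hprod' (sub_nonneg.2 hxy)
  rw [mul_one_div] at h1 h2
  linarith

/-- Transversality in measure form. -/
lemma volume_real_small_values_le {n : ℕ} {c₀ : ℝ} {c : Fin n → ℝ} (h₀ : 1 ≤ |c₀|)
    (hc : ∀ k, |c k| ≤ 3) {r : ℝ} (hr : 0 ≤ r) :
    volume.real {x ∈ Icc (1 / 3 : ℝ) (2 / 5) | |c₀ + ∑ k, c k * x ^ ((k : ℕ) + 1)| ≤ r} ≤
      5 * r := by
  refine ENNReal.toReal_le_of_le_ofReal (by positivity) ((Real.volume_le_diam _).trans ?_)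
  refine Metric.ediam_le_of_forall_dist_le fun x hx y hy => ?_
  wlog hxy : x ≤ y generalizing x y
  · rw [dist_comm]
    exact this y hy x hx (le_of_not_ge hxy)
  have hdiv {z : ℝ} (hz : z ∈ {x ∈ Icc (1 / 3 : ℝ) (2 / 5) |
      |c₀ + ∑ k, c k * x ^ ((k : ℕ) + 1)| ≤ r}) :
      |(c₀ + ∑ k, c k * z ^ ((k : ℕ) + 1)) / z ^ 2| ≤ 9 * r := by
    have hz0 : 0 < z := by linarith [hz.1.1]
    rw [abs_div, abs_of_pos (by positivity : 0 < z ^ 2), div_le_iff₀ (by positivity)]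
    have : 1 ≤ 9 * z ^ 2 := by nlinarith [hz.1.1]
    nlinarith [hz.2]
  have key := mul_sub_le_abs_div_sq_sub h₀ hc (by linarith [hx.1.1]) hxy hy.1.2
  have := key.trans (abs_sub _ _)
  rw [dist_comm, Real.dist_eq, abs_of_nonneg (sub_nonneg.2 hxy)]
  linarith [hdiv hx, hdiv hy]

/-- The parameters in `[a, 2/5]` for which two words have values within `r`. -/
def closeParams {n : ℕ} (a r : ℝ) (u v : Fin n → Fin 3) : Set ℝ :=
  {x ∈ Icc a (2 / 5) | |wordValue u x - wordValue v x| ≤ r}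

lemma measurableSet_closeParams {n : ℕ} (a r : ℝ) (u v : Fin n → Fin 3) :
    MeasurableSet (closeParams a r u v) :=
  measurableSet_Icc.inter (measurableSet_le
    ((continuous_wordValue u).sub (continuous_wordValue v)).abs.measurable measurable_const)

lemma volume_closeParams_ne_top {n : ℕ} (a r : ℝ) (u v : Fin n → Fin 3) :
    volume (closeParams a r u v) ≠ ∞ :=
  measure_ne_top_of_subset (fun _ hx => hx.1) isCompact_Icc.measure_lt_top.ne

lemma volume_real_closeParams_cons_of_ne {n : ℕ} {a r : ℝ} (ha : 1 / 3 ≤ a) (hr : 0 ≤ r)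
    {i j : Fin 3} (hij : i ≠ j) (u v : Fin n → Fin 3) :
    volume.real (closeParams a r (Fin.cons i u : Fin (n + 1) → Fin 3) (Fin.cons j v)) ≤
      5 * r := by
  refine le_trans ?_ (volume_real_small_values_le (one_le_abs_digit_sub hij)
    (fun k => abs_digit_sub_le (u k) (v k)) hr)
  refine measureReal_mono (fun x hx => ⟨⟨ha.trans hx.1.1, hx.1.2⟩, ?_⟩)
    (measure_ne_top_of_subset (fun _ hx => hx.1) isCompact_Icc.measure_lt_top.ne)
  convert hx.2 using 2
  rw [wordValue_cons, wordValue_cons, add_sub_add_comm, ← mul_sub, wordValue, wordValue,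
    ← Finset.sum_sub_distrib, Finset.mul_sum]
  congr 1
  exact Finset.sum_congr rfl fun k _ => by ring

lemma volume_real_closeParams_cons_self {n : ℕ} {a r : ℝ} (ha : 0 < a)
    (i : Fin 3) (u v : Fin n → Fin 3) :
    volume.real (closeParams a r (Fin.cons i u : Fin (n + 1) → Fin 3) (Fin.cons i v)) ≤
      volume.real (closeParams a (r / a) u v) := by
  refine measureReal_mono (fun x hx => ⟨hx.1, ?_⟩) (volume_closeParams_ne_top _ _ _ _)
  have h := hx.2
  have hx0 : 0 < x := ha.trans_le hx.1.1
  rw [wordValue_cons, wordValue_cons, add_sub_add_left_eq_sub, ← mul_sub, abs_mul,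
    abs_of_pos hx0] at h
  rw [le_div_iff₀' ha]
  exact (mul_le_mul_of_nonneg_right hx.1.1 (abs_nonneg _)).trans h

lemma sum_fin_succ_arrow {M : Type*} [AddCommMonoid M] {n : ℕ} (f : (Fin (n + 1) → Fin 3) → M) :
    ∑ u, f u = ∑ i : Fin 3, ∑ u : Fin n → Fin 3, f (Fin.cons i u) := by
  rw [← Fintype.sum_prod_type' fun (i : Fin 3) (u : Fin n → Fin 3) => f (Fin.cons i u)]
  exact (Fintype.sum_equiv (Fin.consEquiv fun _ => Fin 3) _ _ fun _ => rfl).symm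

lemma sum_volume_real_closeParams_le {a : ℝ} (ha : 1 / 3 < a) (n : ℕ) {r : ℝ} (hr : 0 ≤ r) :
    ∑ u : Fin n → Fin 3, ∑ v : Fin n → Fin 3, volume.real (closeParams a r u v) ≤
      9 ^ n * ((1 / 3) ^ n + 15 * a / (3 * a - 1) * r) := by
  have ha0 : 0 < a := by linarith
  have ha1 : 0 < 3 * a - 1 := by linarith
  induction n generalizing r with
  | zero =>
    have h1 (u v : Fin 0 → Fin 3) : volume.real (closeParams a r u v) ≤ 1 := by
      refine (measureReal_mono (s₂ := Icc (1 / 3) (2 / 5))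
        (fun x hx => ⟨ha.le.trans hx.1.1, hx.1.2⟩) isCompact_Icc.measure_lt_top.ne).trans ?_
      rw [Real.volume_real_Icc]
      norm_num
    simp only [Fintype.sum_unique, pow_zero, one_mul]
    have : 0 ≤ 15 * a / (3 * a - 1) * r := by positivity
    exact (h1 _ _).trans (by linarith)
  | succ n ih =>
    set S := ∑ u : Fin n → Fin 3, ∑ v : Fin n → Fin 3, volume.real (closeParams a (r / a) u v)
    have hpair (i j : Fin 3) : ∑ u : Fin n → Fin 3, ∑ v : Fin n → Fin 3,
        volume.real (closeParams a r (Fin.cons i u : Fin (n + 1) → Fin 3) (Fin.cons j v)) ≤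
          if i = j then S else 9 ^ n * (5 * r) := by
      split_ifs with h
      · subst h
        exact Finset.sum_le_sum fun u _ => Finset.sum_le_sum fun v _ =>
          volume_real_closeParams_cons_self ha0 i u v
      · refine (Finset.sum_le_sum fun u _ => Finset.sum_le_sum fun v _ =>
          volume_real_closeParams_cons_of_ne ha.le hr h u v).trans (le_of_eq ?_)
        simp only [Finset.sum_const, Finset.card_univ, Fintype.card_pi, Fintype.card_fin,
          Finset.prod_const, nsmul_eq_mul]
        push_cast
        rw [← mul_assoc, ← mul_pow]
        norm_num
    have hsplit : ∑ u : Fin (n + 1) → Fin 3, ∑ v : Fin (n + 1) → Fin 3,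
        volume.real (closeParams a r u v) ≤ 3 * S + 6 * (9 ^ n * (5 * r)) := by
      calc _ = ∑ i : Fin 3, ∑ j : Fin 3, ∑ u : Fin n → Fin 3, ∑ v : Fin n → Fin 3,
            volume.real
              (closeParams a r (Fin.cons i u : Fin (n + 1) → Fin 3) (Fin.cons j v)) := by
            simp only [sum_fin_succ_arrow]
            exact Finset.sum_congr rfl fun i _ => Finset.sum_comm
        _ ≤ ∑ i : Fin 3, ∑ j : Fin 3, if i = j then S else 9 ^ n * (5 * r) :=
            Finset.sum_le_sum fun i _ => Finset.sum_le_sum fun j _ => hpair i j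
        _ = _ := by
            simp [Fin.sum_univ_succ]
            ring
    have hih := ih (r := r / a) (by positivity)
    refine hsplit.trans ?_
    have hnr : 0 ≤ 9 ^ n * r := by positivity
    have hid : 9 ^ (n + 1) * ((1 / 3) ^ (n + 1) + 15 * a / (3 * a - 1) * r) =
        3 * (9 ^ n * ((1 / 3) ^ n + 15 * a / (3 * a - 1) * (r / a))) + 45 * (9 ^ n * r) := by
      field_simp
      ring
    rw [hid]
    linarith

/-- The number of pairs of words of length `n` whose values at `lam` are within `r`. -/
noncomputable def closePairs (n : ℕ) (r lam : ℝ) : ℕ :=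
  ∑ u : Fin n → Fin 3, ∑ v : Fin n → Fin 3,
    if |wordValue u lam - wordValue v lam| ≤ r then 1 else 0

lemma cast_closePairs_eq {a r lam : ℝ} (n : ℕ) (h : lam ∈ Icc a (2 / 5)) :
    (closePairs n r lam : ℝ≥0∞) = ∑ u : Fin n → Fin 3, ∑ v : Fin n → Fin 3,
      (closeParams a r u v).indicator 1 lam := by
  simp only [closePairs, Nat.cast_sum, indicator, closeParams, mem_ofPred_eq, h, true_and,
    Nat.cast_ite, Nat.cast_one, Nat.cast_zero, Pi.one_apply]

lemma lintegral_closePairs_le {a : ℝ} (ha : 1 / 3 < a) (n : ℕ) {r : ℝ} (hr : 0 ≤ r) :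
    ∫⁻ lam in Icc a (2 / 5), (closePairs n r lam : ℝ≥0∞) ≤
      ENNReal.ofReal (9 ^ n * ((1 / 3) ^ n + 15 * a / (3 * a - 1) * r)) := by
  calc _ = ∫⁻ lam in Icc a (2 / 5), ∑ u : Fin n → Fin 3, ∑ v : Fin n → Fin 3,
        (closeParams a r u v).indicator 1 lam :=
        setLIntegral_congr_fun measurableSet_Icc fun lam h => cast_closePairs_eq n h
    _ ≤ ∫⁻ lam, ∑ u : Fin n → Fin 3, ∑ v : Fin n → Fin 3,
        (closeParams a r u v).indicator 1 lam := setLIntegral_le_lintegral _ _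
    _ = ∑ u : Fin n → Fin 3, ∑ v : Fin n → Fin 3, volume (closeParams a r u v) := by
        have hm (u v : Fin n → Fin 3) :
            Measurable ((closeParams a r u v).indicator (1 : ℝ → ℝ≥0∞)) :=
          measurable_one.indicator (measurableSet_closeParams a r u v)
        rw [lintegral_finsetSum _ fun u _ => Finset.measurable_fun_sum _ fun v _ => hm u v]
        refine Finset.sum_congr rfl fun u _ => ?_
        rw [lintegral_finsetSum _ fun v _ => hm u v]
        exact Finset.sum_congr rfl fun v _ =>
          lintegral_indicator_one (measurableSet_closeParams a r u v)
    _ = ENNReal.ofReal (∑ u : Fin n → Fin 3, ∑ v : Fin n → Fin 3,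
          volume.real (closeParams a r u v)) := by
        rw [ENNReal.ofReal_sum_of_nonneg fun u _ => Finset.sum_nonneg fun v _ =>
          measureReal_nonneg]
        refine Finset.sum_congr rfl fun u _ => ?_
        rw [ENNReal.ofReal_sum_of_nonneg fun v _ => measureReal_nonneg]
        exact Finset.sum_congr rfl fun v _ =>
          (ofReal_measureReal (volume_closeParams_ne_top a r u v)).symm
    _ ≤ _ := ENNReal.ofReal_le_ofReal (sum_volume_real_closeParams_le ha n hr)

lemma measurable_closePairs (n : ℕ) (r : ℝ) :
    Measurable fun lam => (closePairs n r lam : ℝ≥0∞) := by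
  simp only [closePairs, Nat.cast_sum, Nat.cast_ite, Nat.cast_one, Nat.cast_zero]
  refine Finset.measurable_fun_sum _ fun u _ => Finset.measurable_fun_sum _ fun v _ => ?_
  exact Measurable.ite (measurableSet_le
    ((continuous_wordValue u).sub (continuous_wordValue v)).abs.measurable measurable_const)
    measurable_const measurable_const

lemma sq_card_le_card_image_mul {ι κ : Type*} [Fintype ι] [DecidableEq κ] (f : ι → κ) :
    Fintype.card ι ^ 2 ≤
      (Finset.univ.image f).card * ∑ u, ∑ v, if f v = f u then 1 else 0 := by
  have hmaps (u : ι) (_ : u ∈ Finset.univ) : f u ∈ Finset.univ.image f :=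
    Finset.mem_image_of_mem f (Finset.mem_univ u)
  have hcard : Fintype.card ι = ∑ j ∈ Finset.univ.image f, (Finset.univ.filter (f · = j)).card :=
    Finset.card_eq_sum_card_fiberwise hmaps
  rw [hcard]
  refine sq_sum_le_card_mul_sum_sq.trans (Nat.mul_le_mul_left _ (le_of_eq ?_))
  rw [← Finset.sum_fiberwise_of_maps_to hmaps]
  refine Finset.sum_congr rfl fun j _ => ?_
  rw [Finset.sum_congr rfl (g := fun _ => (Finset.univ.filter (f · = j)).card), Finset.sum_const,
    sq, smul_eq_mul]
  intro u hu
  rw [(Finset.mem_filter.1 hu).2, Finset.card_filter]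

lemma card_mul_le_volume_cthickening {s : Set ℝ} {r : ℝ} (hr : 0 < r) (t : Finset ℤ)
    (ht : ∀ j ∈ t, ∃ x ∈ s, ⌊x / r⌋ = j) :
    t.card * ENNReal.ofReal r ≤ volume (Metric.cthickening r s) := by
  have hmem (j : ℤ) (y : ℝ) : y ∈ Ico (j * r) ((j + 1) * r) ↔ ⌊y / r⌋ = j := by
    rw [Int.floor_eq_iff, mem_Ico, le_div_iff₀ hr, div_lt_iff₀ hr]
  calc t.card * ENNReal.ofReal r = ∑ j ∈ t, volume (Ico (j * r) (((j : ℝ) + 1) * r)) := by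
        simp only [Real.volume_Ico, ← sub_mul, add_sub_cancel_left, one_mul, Finset.sum_const,
          nsmul_eq_mul]
    _ = volume (⋃ j ∈ t, Ico (j * r) (((j : ℝ) + 1) * r)) := by
        refine (measure_biUnion_finset (fun i _ j _ hij => ?_) fun _ _ => measurableSet_Ico).symm
        exact disjoint_left.2 fun y hi hj => hij (((hmem i y).1 hi).symm.trans ((hmem j y).1 hj))
    _ ≤ _ := by
        refine measure_mono (iUnion₂_subset fun j hj y hy => ?_)
        obtain ⟨x, hx, hxj⟩ := ht j hj
        have hx' := (hmem j x).2 hxj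
        refine Metric.mem_cthickening_of_dist_le y x r s hx ?_
        rw [Real.dist_eq, abs_le]
        constructor <;> nlinarith [hx'.1, hx'.2, hy.1, hy.2]

lemma nine_pow_mul_le (n : ℕ) {r : ℝ} (hr : 0 < r) (lam : ℝ) :
    9 ^ n * ENNReal.ofReal r ≤
      volume (Metric.cthickening r (attractor lam)) * closePairs n r lam := by
  set f : (Fin n → Fin 3) → ℤ := fun u => ⌊wordValue u lam / r⌋ with hf
  have hpairs : (∑ u, ∑ v, if f v = f u then 1 else 0) ≤ closePairs n r lam := by
    refine Finset.sum_le_sum fun u _ => Finset.sum_le_sum fun v _ => ?_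
    by_cases h : f v = f u
    · have h1 := Int.abs_sub_lt_one_of_floor_eq_floor h.symm
      rw [← sub_div, abs_div, abs_of_pos hr, div_lt_one hr] at h1
      rw [if_pos h, if_pos h1.le]
    · rw [if_neg h]
      exact Nat.zero_le _
  have hcs := (sq_card_le_card_image_mul f).trans (Nat.mul_le_mul_left _ hpairs)
  rw [show Fintype.card (Fin n → Fin 3) ^ 2 = 9 ^ n by
    rw [Fintype.card_fun, Fintype.card_fin, Fintype.card_fin, ← pow_mul, mul_comm, pow_mul]
    norm_num] at hcs
  have hvol := card_mul_le_volume_cthickening (s := attractor lam) hr (Finset.univ.image f)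
    fun j hj => by
      obtain ⟨u, -, rfl⟩ := Finset.mem_image.1 hj
      exact ⟨_, wordValue_mem_attractor u lam, rfl⟩
  calc (9 : ℝ≥0∞) ^ n * ENNReal.ofReal r
      ≤ ((Finset.univ.image f).card * closePairs n r lam) * ENNReal.ofReal r := by
        gcongr
        exact_mod_cast hcs
    _ = ((Finset.univ.image f).card * ENNReal.ofReal r) * closePairs n r lam := by ring
    _ ≤ _ := by gcongr

lemma one_le_volume_cthickening_mul (n : ℕ) (lam : ℝ) :
    1 ≤ volume (Metric.cthickening ((1 / 3) ^ n) (attractor lam)) *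
      (closePairs n ((1 / 3) ^ n) lam / 3 ^ n) := by
  have h := nine_pow_mul_le n (r := (1 / 3) ^ n) (by positivity) lam
  have h3 : (9 : ℝ≥0∞) ^ n * ENNReal.ofReal ((1 / 3) ^ n) = 3 ^ n := by
    rw [ENNReal.ofReal_pow (by norm_num), ← mul_pow, ENNReal.ofReal_div_of_pos (by norm_num),
      ENNReal.ofReal_one, ENNReal.ofReal_ofNat, show (9 : ℝ≥0∞) = 3 * 3 by norm_num, mul_assoc,
      ENNReal.mul_div_cancel (by norm_num) (by norm_num), mul_one]
  rw [h3] at h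
  rw [← mul_div_assoc, ENNReal.le_div_iff_mul_le (by simp) (by simp), one_mul]
  exact h

lemma ae_volume_attractor_ne_zero {a : ℝ} (ha : 1 / 3 < a) :
    ∀ᵐ lam ∂(volume.restrict (Icc a (2 / 5))), volume (attractor lam) ≠ 0 := by
  set G : ℕ → ℝ → ℝ≥0∞ := fun n lam => closePairs n ((1 / 3) ^ n) lam / 3 ^ n with hG
  have hGm (n : ℕ) : Measurable (G n) := (measurable_closePairs n _).div_const _
  set B : ℝ≥0∞ := ENNReal.ofReal (1 + 15 * a / (3 * a - 1)) with hB
  have hGB (n : ℕ) : ∫⁻ lam in Icc a (2 / 5), G n lam ≤ B := by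
    simp only [hG, div_eq_mul_inv]
    rw [lintegral_mul_const _ (measurable_closePairs n _), ← div_eq_mul_inv]
    refine ENNReal.div_le_of_le_mul ((lintegral_closePairs_le ha n (by positivity)).trans
      (le_of_eq ?_))
    rw [hB, ← ENNReal.ofReal_ofNat 3, ← ENNReal.ofReal_pow (by norm_num),
      ← ENNReal.ofReal_mul' (by positivity)]
    congr 1
    have h13 : (1 / 3 : ℝ) ^ n * 3 ^ n = 1 := by rw [← mul_pow]; norm_num
    rw [show (9 : ℝ) = 3 * 3 by norm_num, mul_pow]
    linear_combination (3 ^ n * (1 + 15 * a / (3 * a - 1))) * h13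
  have hfin : ∫⁻ lam in Icc a (2 / 5), Filter.liminf (fun n => G n lam) Filter.atTop ≠ ∞ := by
    refine ne_top_of_le_ne_top (b := B) ENNReal.ofReal_ne_top ((lintegral_liminf_le hGm).trans ?_)
    exact (Filter.liminf_le_liminf (v := fun _ => B) (Filter.Eventually.of_forall hGB)).trans
      (Filter.liminf_const B).le
  filter_upwards [ae_lt_top (.liminf hGm) hfin, ae_restrict_mem measurableSet_Icc]
    with lam hlt hlam h0
  obtain ⟨c, hc, hctop⟩ := exists_between hlt
  have hfreq : ∃ᶠ n in Filter.atTop, G n lam < c := Filter.frequently_lt_of_liminf_lt (h := hc)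
  have hlim := ((tendsto_measure_cthickening_of_isCompact (μ := volume)
    (isCompact_attractor (by linarith [hlam.1]) (by linarith [hlam.2] : lam < 1))).comp
    (tendsto_pow_atTop_nhds_zero_of_lt_one (r := (1 / 3 : ℝ)) (by norm_num) (by norm_num)))
  rw [h0] at hlim
  have hlim' := ENNReal.Tendsto.mul_const hlim (Or.inr hctop.ne)
  rw [zero_mul] at hlim'
  obtain ⟨n, hn, hn'⟩ := (hfreq.and_eventually (hlim'.eventually_lt_const one_pos)).exists
  exact absurd ((one_le_volume_cthickening_mul n lam).trans
    (mul_le_mul_right hn.le _)) (not_le.2 hn')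

lemma dimH_eq_one_of_volume_ne_zero {s : Set ℝ} (h : volume s ≠ 0) : dimH s = 1 := by
  refine le_antisymm ((dimH_mono (subset_univ s)).trans Real.dimH_univ.le) ?_
  have := le_dimH_of_hausdorffMeasure_ne_zero (s := s) (d := 1)
    (by rwa [NNReal.coe_one, hausdorffMeasure_real])
  simpa using this

theorem stmt7 :
    ∀ᵐ lam ∂(volume.restrict (Set.Ioo (1/3 : ℝ) (2/5))),
      dimH {x : ℝ | ∃ a : ℕ → ℝ, (∀ i, a i ∈ ({0, 1, 3} : Set ℝ)) ∧
        x = ∑' i : ℕ, a i * lam ^ i} = 1 := by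
  simp only [setOf_expansions_eq_attractor]
  have h : ∀ᵐ lam : ℝ, ∀ q : ℚ, (1 / 3 : ℝ) < q → lam ∈ Icc (q : ℝ) (2 / 5) →
      volume (attractor lam) ≠ 0 := by
    refine ae_all_iff.2 fun q => ?_
    by_cases hq : (1 / 3 : ℝ) < q
    · filter_upwards [(ae_restrict_iff' measurableSet_Icc).1 (ae_volume_attractor_ne_zero hq)]
        with lam hlam _ using hlam
    · exact Filter.Eventually.of_forall fun _ h => absurd h hq
  rw [ae_restrict_iff' measurableSet_Ioo]
  filter_upwards [h] with lam hlam hmem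
  obtain ⟨q, hq, hq'⟩ := exists_rat_btwn hmem.1
  exact dimH_eq_one_of_volume_ne_zero (hlam q hq ⟨hq'.le, hmem.2.le⟩)
end

section
/- Fix non-singular d×d real matrices A_1, …, A_m with max_i ‖A_i‖ < 1/2 and let ν be an ergodic shift-invariant measure on Σ = {1,…,m}^ℕ. For t = (t_1,…,t_m) ∈ ℝ^{md}, let Π^t(i) = lim_{n→∞} f_{i_1} ∘ ⋯ ∘ f_{i_n}(0) be the natural projection of the IFS {f_i(x) = A_i x + t_i}. Then for Lebesgue-almost every t ∈ ℝ^{md}, dim_H (Π^t_* ν) = min{d, D(ν)}, where D(ν) is the Lyapunov dimension of ν. -/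
open MeasureTheory Filter Set
open scoped ENNReal

/-- The `k`-th largest singular value of a linear map on Euclidean space
(Courant–Fischer max-min characterization). -/
noncomputable def singVal {d : ℕ}
    (B : EuclideanSpace ℝ (Fin d) →L[ℝ] EuclideanSpace ℝ (Fin d)) (k : ℕ) : ℝ :=
  sSup {c : ℝ | ∃ V : Submodule ℝ (EuclideanSpace ℝ (Fin d)),
    Module.finrank ℝ V = k ∧ ∀ v ∈ V, c * ‖v‖ ≤ ‖B v‖}

/-- The product `A_{w₁} ⋯ A_{w_n}` of linear maps along a finite word. -/
noncomputable def wordProd {d m : ℕ}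
    (A : Fin m → (EuclideanSpace ℝ (Fin d) →L[ℝ] EuclideanSpace ℝ (Fin d))) :
    List (Fin m) → (EuclideanSpace ℝ (Fin d) →L[ℝ] EuclideanSpace ℝ (Fin d))
  | [] => ContinuousLinearMap.id ℝ _
  | i :: w => (A i).comp (wordProd A w)

/-- `f_{w₁} ∘ ⋯ ∘ f_{w_n}` for the affine maps `f_i x = A_i x + t_i`. -/
noncomputable def affWord {d m : ℕ}
    (A : Fin m → (EuclideanSpace ℝ (Fin d) →L[ℝ] EuclideanSpace ℝ (Fin d)))
    (t : Fin m → EuclideanSpace ℝ (Fin d)) :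
    List (Fin m) → EuclideanSpace ℝ (Fin d) → EuclideanSpace ℝ (Fin d)
  | [] => id
  | i :: w => fun y => A i (affWord A t w y) + t i

/-- Hausdorff dimension of a measure: `inf {dim_H A : μ Aᶜ = 0}`. -/
noncomputable def dimHMeasure {X : Type*} [EMetricSpace X] [MeasurableSpace X]
    [BorelSpace X] (μ : Measure X) : ℝ≥0∞ :=
  sInf (dimH '' {A : Set X | μ Aᶜ = 0})

theorem exists_basis_norm_sq {d : ℕ}
    (B : EuclideanSpace ℝ (Fin d) →L[ℝ] EuclideanSpace ℝ (Fin d)) :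
    ∃ (e : OrthonormalBasis (Fin d) ℝ (EuclideanSpace ℝ (Fin d))) (l : Fin d → ℝ),
      Antitone l ∧ (∀ i, 0 ≤ l i) ∧ ∀ y, ‖B y‖ ^ 2 = ∑ i, l i * (inner ℝ (e i) y) ^ 2 := by
  have hn : Module.finrank ℝ (EuclideanSpace ℝ (Fin d)) = d := finrank_euclideanSpace_fin
  let T : EuclideanSpace ℝ (Fin d) →ₗ[ℝ] EuclideanSpace ℝ (Fin d) := B
  have hp := T.isPositive_adjoint_comp_self
  have hs := hp.isSymmetric
  refine ⟨hs.eigenvectorBasis hn, hs.eigenvalues hn, hs.eigenvalues_antitone hn,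
    hp.nonneg_eigenvalues hn, fun y => ?_⟩
  set e := hs.eigenvectorBasis hn
  have h1 : ‖B y‖ ^ 2 = inner ℝ ((T.adjoint ∘ₗ T) y) y := by
    rw [LinearMap.comp_apply, LinearMap.adjoint_inner_left, ← real_inner_self_eq_norm_sq]
    rfl
  rw [h1, ← e.sum_inner_mul_inner]
  refine Finset.sum_congr rfl fun i _ => ?_
  have h2 : inner ℝ ((T.adjoint ∘ₗ T) y) (e i) = hs.eigenvalues hn i * inner ℝ (e i) y := by
    rw [hs y (e i), hs.apply_eigenvectorBasis, inner_smul_right, real_inner_comm]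
    rfl
  rw [h2]; ring

theorem singVal_set_bddAbove {d : ℕ}
    (B : EuclideanSpace ℝ (Fin d) →L[ℝ] EuclideanSpace ℝ (Fin d)) {k : ℕ} (hk : 1 ≤ k) :
    ‖B‖ ∈ upperBounds {c : ℝ | ∃ V : Submodule ℝ (EuclideanSpace ℝ (Fin d)),
      Module.finrank ℝ V = k ∧ ∀ v ∈ V, c * ‖v‖ ≤ ‖B v‖} := by
  rintro c ⟨V, hV, hc⟩
  have : 0 < Module.finrank ℝ V := by omega
  have := Module.finrank_pos_iff.1 this
  obtain ⟨v, hv⟩ := exists_ne (0 : V)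
  have hv' : 0 < ‖(v : EuclideanSpace ℝ (Fin d))‖ := by simpa using hv
  exact le_of_mul_le_mul_right ((hc v v.2).trans (B.le_opNorm v)) hv'

theorem exists_basis_singVal {d : ℕ}
    (B : EuclideanSpace ℝ (Fin d) →L[ℝ] EuclideanSpace ℝ (Fin d)) :
    ∃ e : OrthonormalBasis (Fin d) ℝ (EuclideanSpace ℝ (Fin d)),
      (Antitone fun i : Fin d => singVal B (i + 1)) ∧
      ∀ i : Fin d, ‖B (e i)‖ = singVal B (i + 1) ∧
        ∀ y, singVal B (i + 1) * |inner ℝ (e i) y| ≤ ‖B y‖ := by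
  obtain ⟨e, l, hl, hl0, hB⟩ := exists_basis_norm_sq B
  have hBe : ∀ i, ‖B (e i)‖ = √(l i) := by
    intro i
    rw [← Real.sqrt_sq (norm_nonneg (B (e i))), hB, Finset.sum_eq_single i]
    · simp
    · intro j _ hj
      simp [e.inner_eq_zero hj]
    · simp
  have hsum : ∀ y, ‖y‖ ^ 2 = ∑ i, (inner ℝ (e i) y) ^ 2 := by
    intro y
    rw [← e.sum_sq_norm_inner_right]; simp
  have hs : ∀ i : Fin d, singVal B (i + 1) = √(l i) := by
    intro i
    apply le_antisymm
    · refine Real.sSup_le ?_ (Real.sqrt_nonneg _)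
      rintro c ⟨V, hV, hc⟩
      let f : V →ₗ[ℝ] (Fin i → ℝ) :=
        LinearMap.pi fun j => (innerSL ℝ (e (Fin.castLE i.2.le j))).toLinearMap ∘ₗ V.subtype
      have hf : LinearMap.ker f ≠ ⊥ := LinearMap.ker_ne_bot_of_finrank_lt (by simp [hV])
      obtain ⟨v, hv, hv0⟩ := (Submodule.ne_bot_iff _).1 hf
      have hv1 : ∀ j : Fin d, j < i → inner ℝ (e j) (v : EuclideanSpace ℝ (Fin d)) = 0 := by
        intro j hj
        exact congrFun (LinearMap.mem_ker.1 hv) ⟨j, hj⟩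
      have hv' : 0 < ‖(v : EuclideanSpace ℝ (Fin d))‖ := by simpa using hv0
      have h2 : ‖B v‖ ^ 2 ≤ (√(l i) * ‖(v : EuclideanSpace ℝ (Fin d))‖) ^ 2 := by
        rw [mul_pow, Real.sq_sqrt (hl0 i), hB, hsum, Finset.mul_sum]
        refine Finset.sum_le_sum fun j _ => ?_
        rcases lt_or_ge j i with h | h
        · simp [hv1 j h]
        · exact mul_le_mul_of_nonneg_right (hl h) (sq_nonneg _)
      have h3 := abs_le_of_sq_le_sq h2 (by positivity)
      exact le_of_mul_le_mul_right ((hc v v.2).trans ((le_abs_self _).trans h3)) hv'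
    · refine le_csSup ⟨_, singVal_set_bddAbove B (by omega)⟩ ?_
      let b : Fin (i + 1) → EuclideanSpace ℝ (Fin d) := fun j => e (Fin.castLE i.2 j)
      refine ⟨Submodule.span ℝ (Set.range b), ?_, fun v hv => ?_⟩
      · rw [finrank_span_eq_card, Fintype.card_fin]
        exact e.orthonormal.linearIndependent.comp _ (Fin.castLE_injective _)
      · have hv1 : ∀ j : Fin d, i < j → inner ℝ (e j) v = 0 := by
          intro j hj
          have : Submodule.span ℝ (Set.range b) ≤ LinearMap.ker (innerSL ℝ (e j)).toLinearMap := by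
            rw [Submodule.span_le]
            rintro _ ⟨k, rfl⟩
            have : j ≠ Fin.castLE i.2 k := by
              intro h; have := k.2; rw [h] at hj; simp [Fin.lt_def] at hj; omega
            exact e.inner_eq_zero this
          exact this hv
        refine le_of_sq_le_sq ?_ (norm_nonneg _)
        rw [mul_pow, Real.sq_sqrt (hl0 i), hB, hsum, Finset.mul_sum]
        refine Finset.sum_le_sum fun j _ => ?_
        rcases lt_or_ge i j with h | h
        · simp [hv1 j h]
        · exact mul_le_mul_of_nonneg_right (hl h) (sq_nonneg _)
  refine ⟨e, fun i j hij => ?_, fun i => ⟨by rw [hBe, hs], fun y => ?_⟩⟩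
  · simp only [hs]
    exact Real.sqrt_le_sqrt (hl hij)
  rw [hs]
  refine le_of_sq_le_sq ?_ (norm_nonneg _)
  rw [mul_pow, Real.sq_sqrt (hl0 i), hB, sq_abs]
  exact Finset.single_le_sum (f := fun i => l i * inner ℝ (e i) y ^ 2)
    (fun j _ => mul_nonneg (hl0 j) (sq_nonneg _)) (Finset.mem_univ i)

theorem singVal_le_norm {d : ℕ}
    (B : EuclideanSpace ℝ (Fin d) →L[ℝ] EuclideanSpace ℝ (Fin d)) {k : ℕ} (hk : 1 ≤ k) :
    singVal B k ≤ ‖B‖ :=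
  Real.sSup_le (singVal_set_bddAbove B hk) (norm_nonneg _)

theorem singVal_pos {d : ℕ}
    (B : EuclideanSpace ℝ (Fin d) →L[ℝ] EuclideanSpace ℝ (Fin d))
    (hB : Function.Injective B) (i : Fin d) : 0 < singVal B (i + 1) := by
  obtain ⟨e, -, he⟩ := exists_basis_singVal B
  rw [← (he i).1, norm_pos_iff, ne_eq, map_eq_zero_iff B hB]
  exact fun h => by simpa [h] using e.norm_eq_one i

theorem lintegral_pi_prod_eq_prod {n : ℕ} (f : Fin n → ℝ → ℝ≥0∞) (hf : ∀ i, Measurable (f i)) :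
    ∫⁻ x : Fin n → ℝ, ∏ i, f i (x i) = ∏ i, ∫⁻ x, f i x := by
  induction n with
  | zero => simp [volume_pi]
  | succ n ih =>
    have hm : Measurable fun x : Fin n → ℝ => ∏ i, f (Fin.succ i) (x i) :=
      Finset.measurable_fun_prod _ fun i _ => (hf _).comp (measurable_pi_apply i)
    have h := (volume_preserving_piFinSuccAbove (fun _ : Fin (n + 1) => ℝ) 0).lintegral_comp
      (f := fun p : ℝ × (Fin n → ℝ) => f 0 p.1 * ∏ i, f (Fin.succ i) (p.2 i))
      (((hf 0).comp measurable_fst).mul (hm.comp measurable_snd))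
    rw [Fin.prod_univ_succ, ← ih _ fun i => hf _, ← lintegral_prod_mul (hf 0).aemeasurable
      hm.aemeasurable]
    refine Eq.trans ?_ h
    refine lintegral_congr fun x => ?_
    rw [Fin.prod_univ_succ]
    rfl

theorem lintegral_indicator_rpow_neg_lt_top {a : ℝ} (ha : a < 1) (ρ : ℝ) :
    ∫⁻ x : ℝ, (Icc (-ρ) ρ).indicator (fun x => ‖x‖ₑ ^ (-a)) x < ∞ := by
  have h0 : ∫⁻ x : ℝ, (Ioc 0 ρ).indicator (fun x => ‖x‖ₑ ^ (-a)) x < ∞ := by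
    rcases le_or_gt ρ 0 with h | h
    · simp [Ioc_eq_empty_of_le h]
    have h1 : IntervalIntegrable (fun x : ℝ => x ^ (-a)) volume 0 ρ :=
      intervalIntegral.intervalIntegrable_rpow' (by linarith)
    rw [intervalIntegrable_iff_integrableOn_Ioc_of_le h.le] at h1
    rw [lintegral_indicator measurableSet_Ioc]
    refine lt_of_le_of_lt (le_of_eq ?_) h1.hasFiniteIntegral
    refine setLIntegral_congr_fun measurableSet_Ioc fun x hx => ?_
    have hx0 : 0 < x := hx.1
    simp only [Real.enorm_eq_ofReal_abs, abs_of_pos hx0, abs_of_pos (Real.rpow_pos_of_pos hx0 _)]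
    rw [ENNReal.ofReal_rpow_of_pos hx0]
  have hmeas : Measurable ((Ioc 0 ρ).indicator fun x : ℝ => ‖x‖ₑ ^ (-a)) :=
    Measurable.indicator (by fun_prop) measurableSet_Ioc
  have h1 : ∫⁻ x : ℝ, (Ioc 0 ρ).indicator (fun x => ‖x‖ₑ ^ (-a)) (-x) < ∞ := by
    rwa [(Measure.measurePreserving_neg (volume : Measure ℝ)).lintegral_comp hmeas]
  have h2 := ENNReal.add_lt_top.2 ⟨h0, h1⟩
  rw [← lintegral_add_left hmeas] at h2
  refine lt_of_le_of_lt (lintegral_mono_ae ?_) h2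
  have h3 : ∀ᵐ x : ℝ, x ≠ 0 := by simp [ae_iff]
  filter_upwards [h3] with x hx
  by_cases hx' : x ∈ Icc (-ρ) ρ
  · rw [indicator_of_mem hx']
    rcases lt_or_gt_of_ne hx with h | h
    · refine le_trans ?_ le_add_self
      rw [indicator_of_mem (by constructor <;> linarith [hx'.1, hx'.2])]
      simp
    · refine le_trans ?_ le_self_add
      rw [indicator_of_mem (show x ∈ Ioc 0 ρ from ⟨h, hx'.2⟩)]
  · simp [indicator_of_notMem hx']

theorem exists_lintegral_norm_rpow_neg_le {d : ℕ} (a : Fin d → ℝ) (ha0 : ∀ i, 0 < a i)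
    (ha1 : ∀ i, a i < 1) (ρ : ℝ) :
    ∃ C : ℝ≥0∞, C < ∞ ∧ ∀ B : EuclideanSpace ℝ (Fin d) →L[ℝ] EuclideanSpace ℝ (Fin d),
      Function.Injective B →
      ∫⁻ y in Metric.closedBall 0 ρ, ‖B y‖ₑ ^ (-∑ i, a i) ≤
        C * ∏ i : Fin d, ENNReal.ofReal (singVal B (i + 1) ^ (-a i)) := by
  let f : Fin d → ℝ → ℝ≥0∞ := fun i => (Icc (-ρ) ρ).indicator fun x => ‖x‖ₑ ^ (-a i)
  have hf : ∀ i, Measurable (f i) := fun i => Measurable.indicator (by fun_prop) measurableSet_Icc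
  refine ⟨∏ i, ∫⁻ x, f i x, ENNReal.prod_lt_top fun i _ =>
    lintegral_indicator_rpow_neg_lt_top (ha1 i) ρ, fun B hB => ?_⟩
  obtain ⟨e, -, he⟩ := exists_basis_singVal B
  have hmp := (PiLp.volume_preserving_ofLp (Fin d)).comp e.measurePreserving_repr
  have hm : Measurable fun x : Fin d → ℝ => ∏ i, f i (x i) :=
    Finset.measurable_fun_prod _ fun i _ => (hf _).comp (measurable_pi_apply i)
  rw [← lintegral_pi_prod_eq_prod f hf, ← hmp.lintegral_comp hm, mul_comm, ← lintegral_const_mul]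
  swap
  · exact hm.comp hmp.measurable
  rw [← lintegral_indicator Metric.isClosed_closedBall.measurableSet]
  refine lintegral_mono fun y => ?_
  by_cases hy : y ∈ Metric.closedBall (0 : EuclideanSpace ℝ (Fin d)) ρ
  swap
  · simp [indicator_of_notMem hy]
  rw [indicator_of_mem hy, ← Finset.prod_mul_distrib]
  rw [mem_closedBall_zero_iff] at hy
  have hfi : ∀ i, f i (e.repr y i) = ‖inner ℝ (e i) y‖ₑ ^ (-a i) := by
    intro i
    rw [e.repr_apply_apply]
    refine indicator_of_mem ?_ _
    rw [mem_Icc, ← abs_le]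
    have := abs_real_inner_le_norm (e i) y
    rw [e.norm_eq_one, one_mul] at this
    exact this.trans hy
  change _ ≤ ∏ i : Fin d, ENNReal.ofReal (singVal B (i + 1) ^ (-a i)) * f i (e.repr y i)
  have hs := singVal_pos B hB
  have hmul : ∀ i : Fin d, ENNReal.ofReal (singVal B (i + 1) ^ (-a i)) * f i (e.repr y i)
      = ‖singVal B (i + 1) * inner ℝ (e i) y‖ₑ ^ (-a i) := by
    intro i
    rw [hfi, enorm_mul, ENNReal.mul_rpow_of_ne_top (by simp) (by simp),
      ← ENNReal.ofReal_rpow_of_pos (hs i), Real.enorm_eq_ofReal (hs i).le]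
  have hle : ∀ i : Fin d, ‖B y‖ₑ ^ (-a i) ≤
      ENNReal.ofReal (singVal B (i + 1) ^ (-a i)) * f i (e.repr y i) := by
    intro i
    rw [hmul, ENNReal.rpow_neg, ENNReal.rpow_neg, ENNReal.inv_le_inv]
    refine ENNReal.rpow_le_rpow ?_ (ha0 i).le
    rw [enorm_le_iff_norm_le]
    rw [norm_mul, Real.norm_eq_abs, Real.norm_eq_abs, abs_of_pos (hs i)]
    exact (he i).2 y
  by_cases hy0 : y = 0
  · subst hy0
    have hd : ∏ i : Fin d, ENNReal.ofReal (singVal B (i + 1) ^ (-a i)) * f i (e.repr 0 i) =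
        ∏ i : Fin d, (⊤ : ℝ≥0∞) := by
      refine Finset.prod_congr rfl fun i _ => top_le_iff.1 (le_trans ?_ (hle i))
      simp [ENNReal.zero_rpow_of_neg, ha0 i]
    rw [hd]
    rcases Nat.eq_zero_or_pos d with h | h
    · subst h; simp
    · rw [Finset.prod_const, ENNReal.top_pow]
      · exact le_top
      · simp; omega
  · have : ‖B y‖ₑ ^ (-∑ i, a i) = ∏ i, ‖B y‖ₑ ^ (-a i) := by
      rw [← Finset.sum_neg_distrib]
      have h0 : ‖B y‖ₑ ≠ 0 := by simpa [map_eq_zero_iff B hB] using hy0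
      induction (Finset.univ : Finset (Fin d)) using Finset.induction_on with
      | empty => simp
      | insert i s hi ih => rw [Finset.sum_insert hi, Finset.prod_insert hi,
          ENNReal.rpow_add _ _ h0 (by simp), ih]
    rw [this]
    exact Finset.prod_le_prod' fun i _ => hle i

/-- The left shift on sequences. -/
def shift {α : Type*} (ω : ℕ → α) : ℕ → α := fun n => ω (n + 1)

/-- The word formed by the first `n` symbols of a sequence. -/
def pre {α : Type*} (ω : ℕ → α) (n : ℕ) : List α := List.ofFn fun j : Fin n => ω j

theorem pre_zero {α : Type*} (ω : ℕ → α) : pre ω 0 = [] := by simp [pre]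

theorem pre_succ {α : Type*} (ω : ℕ → α) (n : ℕ) : pre ω (n + 1) = ω 0 :: pre (shift ω) n := by
  simp [pre, List.ofFn_succ, shift]

theorem shift_iterate_apply {α : Type*} (ω : ℕ → α) (n k : ℕ) : shift^[n] ω k = ω (k + n) := by
  induction n generalizing k with
  | zero => rfl
  | succ n ih => rw [Function.iterate_succ_apply', shift, ih]; congr 1; omega

theorem pre_eq_pre_iff {α : Type*} (ω τ : ℕ → α) (n : ℕ) :
    pre ω n = pre τ n ↔ ∀ k < n, ω k = τ k := by
  rw [pre, pre, List.ofFn_inj]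
  exact ⟨fun h k hk => congrFun h ⟨k, hk⟩, fun h => funext fun j => h j j.2⟩

section Projection

variable {d m : ℕ} {A : Fin m → (EuclideanSpace ℝ (Fin d) →L[ℝ] EuclideanSpace ℝ (Fin d))}
  {r : ℝ} {proj : (Fin m → EuclideanSpace ℝ (Fin d)) → (ℕ → Fin m) → EuclideanSpace ℝ (Fin d)}

theorem norm_wordProd_le (hA : ∀ i, ‖A i‖ ≤ r) (ω : ℕ → Fin m) (n : ℕ) :
    ‖wordProd A (pre ω n)‖ ≤ r ^ n := by
  induction n generalizing ω with
  | zero => simpa [pre_zero, wordProd] using ContinuousLinearMap.norm_id_le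
  | succ n ih =>
    rw [pre_succ, wordProd, pow_succ']
    exact (ContinuousLinearMap.opNorm_comp_le _ _).trans
      (mul_le_mul (hA _) (ih _) (norm_nonneg _) ((norm_nonneg _).trans (hA (ω 0))))

theorem wordProd_injective (hA : ∀ i, Function.Injective (A i)) (w : List (Fin m)) :
    Function.Injective (wordProd A w) := by
  induction w with
  | nil => exact Function.injective_id
  | cons i w ih => exact (hA i).comp ih

theorem proj_eq (hproj : ∀ t ω, Tendsto (fun n => affWord A t (pre ω n) 0) atTop
    (nhds (proj t ω))) (t : Fin m → EuclideanSpace ℝ (Fin d)) (ω : ℕ → Fin m) :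
    proj t ω = A (ω 0) (proj t (shift ω)) + t (ω 0) := by
  refine tendsto_nhds_unique ((tendsto_add_atTop_iff_nat 1).2 (hproj t ω)) ?_
  have := (((A (ω 0)).continuous.tendsto _).comp (hproj t (shift ω))).add_const (t (ω 0))
  refine this.congr fun n => ?_
  rw [pre_succ]
  rfl

theorem norm_proj_le (hA : ∀ i, ‖A i‖ ≤ r) (hr : r ≤ 1 / 2)
    (hproj : ∀ t ω, Tendsto (fun n => affWord A t (pre ω n) 0) atTop (nhds (proj t ω)))
    {t : Fin m → EuclideanSpace ℝ (Fin d)} {R : ℝ} (hR : 0 ≤ R) (ht : ∀ i, ‖t i‖ ≤ R)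
    (ω : ℕ → Fin m) : ‖proj t ω‖ ≤ 2 * R := by
  refine le_of_tendsto (hproj t ω).norm (Eventually.of_forall fun n => ?_)
  induction n generalizing ω with
  | zero => simpa [pre_zero, affWord] using hR
  | succ n ih =>
    rw [pre_succ, affWord]
    have h1 := (A (ω 0)).le_of_opNorm_le (hA _) (affWord A t (pre (shift ω) n) 0)
    have h2 := mul_le_mul hr (ih (shift ω)) (norm_nonneg _) (by norm_num)
    have h3 := norm_add_le (A (ω 0) (affWord A t (pre (shift ω) n) 0)) (t (ω 0))
    linarith [ht (ω 0)]

theorem proj_sub_eq (hproj : ∀ t ω, Tendsto (fun n => affWord A t (pre ω n) 0) atTop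
    (nhds (proj t ω))) (t : Fin m → EuclideanSpace ℝ (Fin d)) (ω τ : ℕ → Fin m) (n : ℕ)
    (h : ∀ k < n, ω k = τ k) :
    proj t ω - proj t τ =
      wordProd A (pre ω n) (proj t (shift^[n] ω) - proj t (shift^[n] τ)) := by
  induction n generalizing ω τ with
  | zero => simp [pre_zero, wordProd]
  | succ n ih =>
    rw [proj_eq hproj t ω, proj_eq hproj t τ, ← h 0 (by omega), pre_succ, wordProd,
      Function.iterate_succ_apply, Function.iterate_succ_apply, ContinuousLinearMap.comp_apply,
      ← ih (shift ω) (shift τ) fun k hk => h (k + 1) (by omega), map_sub]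
    abel

/-- The discounted number of occurrences of a symbol in a sequence. -/
noncomputable def discountedCount (r : ℝ) (i : Fin m) (ω : ℕ → Fin m) : ℝ :=
  ∑' n, if ω n = i then r ^ n else 0

theorem summable_discountedCount (hr0 : 0 ≤ r) (hr : r < 1) (i : Fin m) (ω : ℕ → Fin m) :
    Summable fun n => if ω n = i then r ^ n else 0 := by
  refine Summable.of_nonneg_of_le (fun n => ?_) (fun n => ?_)
    (summable_geometric_of_lt_one hr0 hr)
  · split_ifs <;> positivity
  · split_ifs
    · exact le_rfl
    · positivity

theorem discountedCount_eq (hr0 : 0 ≤ r) (hr : r < 1) (i : Fin m) (ω : ℕ → Fin m) :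
    discountedCount r i ω = (if ω 0 = i then 1 else 0) + r * discountedCount r i (shift ω) := by
  rw [discountedCount, (summable_discountedCount hr0 hr i ω).tsum_eq_zero_add, discountedCount,
    ← tsum_mul_left]
  simp only [pow_zero, mul_ite, mul_zero, pow_succ']
  rfl

theorem discountedCount_add_le (hr0 : 0 ≤ r) (hr : r < 1) {i j : Fin m} (hij : i ≠ j)
    (ω : ℕ → Fin m) : discountedCount r i ω + discountedCount r j ω ≤ (1 - r)⁻¹ := by
  rw [← tsum_geometric_of_lt_one hr0 hr, discountedCount, discountedCount,
    ← (summable_discountedCount hr0 hr i ω).tsum_add (summable_discountedCount hr0 hr j ω)]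
  refine Summable.tsum_le_tsum (fun n => ?_) ((summable_discountedCount hr0 hr i ω).add
    (summable_discountedCount hr0 hr j ω)) (summable_geometric_of_lt_one hr0 hr)
  by_cases h : ω n = i
  · simp [h, hij]
  · have : 0 ≤ r ^ n := by positivity
    simp only [h, if_false, zero_add]
    split_ifs <;> simp [this]

theorem norm_proj_sub_le (hA : ∀ i, ‖A i‖ ≤ r) (hr0 : 0 ≤ r) (hr : r < 1)
    (hproj : ∀ t ω, Tendsto (fun n => affWord A t (pre ω n) 0) atTop (nhds (proj t ω)))
    {t t' : Fin m → EuclideanSpace ℝ (Fin d)} {i : Fin m} (ht : ∀ k, k ≠ i → t k = t' k)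
    (ω : ℕ → Fin m) : ‖proj t ω - proj t' ω‖ ≤ discountedCount r i ω * ‖t i - t' i‖ := by
  refine le_of_tendsto ((hproj t ω).sub (hproj t' ω)).norm (Eventually.of_forall fun n => ?_)
  induction n generalizing ω with
  | zero =>
    simp only [pre_zero, affWord, id, sub_self, norm_zero]
    refine mul_nonneg (tsum_nonneg fun n => ?_) (norm_nonneg _)
    split_ifs <;> positivity
  | succ n ih =>
    rw [pre_succ, affWord, affWord, discountedCount_eq hr0 hr, add_sub_add_comm, ← map_sub, add_mul,
      add_comm]
    refine (norm_add_le _ _).trans (add_le_add ?_ ?_)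
    · split_ifs with h
      · rw [h, one_mul]
      · simp [ht _ h]
    · refine ((A (ω 0)).le_of_opNorm_le (hA _) _).trans ?_
      rw [mul_assoc]
      exact mul_le_mul_of_nonneg_left (ih _) hr0

theorem le_norm_proj_sub_of_ne (hA : ∀ i, ‖A i‖ ≤ r) (hr0 : 0 ≤ r) (hr : r < 1)
    (hproj : ∀ t ω, Tendsto (fun n => affWord A t (pre ω n) 0) atTop (nhds (proj t ω)))
    {t t' : Fin m → EuclideanSpace ℝ (Fin d)} (ω τ : ℕ → Fin m) (h : τ 0 ≠ ω 0)
    (ht : ∀ k, k ≠ ω 0 → t k = t' k) :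
    (1 - r * (discountedCount r (ω 0) (shift ω) + discountedCount r (ω 0) (shift τ))) *
      ‖t (ω 0) - t' (ω 0)‖ ≤ ‖(proj t ω - proj t τ) - (proj t' ω - proj t' τ)‖ := by
  set Δ := t (ω 0) - t' (ω 0) with hΔ
  have e1 : (proj t ω - proj t τ) - (proj t' ω - proj t' τ) =
      Δ - (A (τ 0) (proj t (shift τ) - proj t' (shift τ)) -
        A (ω 0) (proj t (shift ω) - proj t' (shift ω))) := by
    rw [proj_eq hproj t ω, proj_eq hproj t τ, proj_eq hproj t' ω, proj_eq hproj t' τ, ht _ h, hΔ,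
      map_sub, map_sub]
    abel
  have e2 : ∀ (k : Fin m) (η : ℕ → Fin m), ‖A k (proj t η - proj t' η)‖ ≤
      r * (discountedCount r (ω 0) η * ‖Δ‖) := fun k η =>
    ((A k).le_of_opNorm_le (hA _) _).trans
      (mul_le_mul_of_nonneg_left (norm_proj_sub_le hA hr0 hr hproj ht η) hr0)
  rw [e1]
  have e3 := norm_sub_norm_le Δ (A (τ 0) (proj t (shift τ) - proj t' (shift τ)) -
        A (ω 0) (proj t (shift ω) - proj t' (shift ω)))
  have e4 := norm_sub_le (A (τ 0) (proj t (shift τ) - proj t' (shift τ)))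
        (A (ω 0) (proj t (shift ω) - proj t' (shift ω)))
  have := e2 (τ 0) (shift τ)
  have := e2 (ω 0) (shift ω)
  linarith

theorem exists_coordinate_expanding (hA : ∀ i, ‖A i‖ ≤ r) (hr0 : 0 ≤ r) (hr : r < 1 / 2)
    (hproj : ∀ t ω, Tendsto (fun n => affWord A t (pre ω n) 0) atTop (nhds (proj t ω)))
    (ω τ : ℕ → Fin m) (h : ω 0 ≠ τ 0) :
    ∃ i, ∀ t t' : Fin m → EuclideanSpace ℝ (Fin d), (∀ k, k ≠ i → t k = t' k) →
      (1 - r * (1 - r)⁻¹) * ‖t i - t' i‖ ≤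
        ‖(proj t ω - proj t τ) - (proj t' ω - proj t' τ)‖ := by
  have hr1 : r < 1 := by linarith
  have h1 := discountedCount_add_le hr0 hr1 h (shift ω)
  have h2 := discountedCount_add_le hr0 hr1 h (shift τ)
  by_cases hc : discountedCount r (ω 0) (shift ω) + discountedCount r (ω 0) (shift τ) ≤ (1 - r)⁻¹
  · refine ⟨ω 0, fun t t' ht => le_trans ?_
      (le_norm_proj_sub_of_ne hA hr0 hr1 hproj ω τ h.symm ht)⟩
    gcongr
  · refine ⟨τ 0, fun t t' ht => le_trans ?_
      ((le_norm_proj_sub_of_ne hA hr0 hr1 hproj τ ω h ht).trans_eq ?_)⟩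
    · gcongr
      linarith
    · rw [← norm_neg]
      congr 1
      abel

theorem measurable_affWord : ∀ w : List (Fin m),
    Measurable fun t : Fin m → EuclideanSpace ℝ (Fin d) => affWord A t w 0
  | [] => measurable_const
  | i :: w => ((A i).continuous.measurable.comp (measurable_affWord w)).add (measurable_pi_apply i)

theorem measurable_proj_uncurry
    (hproj : ∀ t ω, Tendsto (fun n => affWord A t (pre ω n) 0) atTop (nhds (proj t ω))) :
    Measurable fun p : (Fin m → EuclideanSpace ℝ (Fin d)) × (ℕ → Fin m) => proj p.1 p.2 := by
  refine measurable_of_tendsto_metrizable (f := fun n p => affWord A p.1 (pre p.2 n) 0)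
    (fun n => ?_) (tendsto_pi_nhds.2 fun p => hproj p.1 p.2)
  have : Measurable fun p : (Fin m → EuclideanSpace ℝ (Fin d)) × (Fin n → Fin m) =>
      affWord A p.1 (List.ofFn p.2) 0 :=
    measurable_from_prod_countable_left fun w => measurable_affWord (List.ofFn w)
  exact this.comp (measurable_fst.prodMk (measurable_pi_lambda _ fun j =>
    (measurable_pi_apply (j : ℕ)).comp measurable_snd))

end Projection

theorem AntilipschitzWith.lintegral_comp_le {d : ℕ} {K : NNReal}
    {g : EuclideanSpace ℝ (Fin d) → EuclideanSpace ℝ (Fin d)} (hg : AntilipschitzWith K g)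
    (hgm : Measurable g) {F : EuclideanSpace ℝ (Fin d) → ℝ≥0∞} (hF : Measurable F) :
    ∫⁻ x, F (g x) ≤ (K : ℝ≥0∞) ^ d * ∫⁻ y, F y := by
  rw [← lintegral_map hF hgm, ← smul_eq_mul, ← lintegral_smul_measure]
  refine lintegral_mono' (Measure.le_iff.2 fun s hs => ?_) le_rfl
  rw [Measure.map_apply hgm hs, ← EuclideanSpace.euclideanHausdorffMeasure_eq_volume,
    Measure.euclideanHausdorffMeasure_def, Measure.smul_apply, Measure.smul_apply,
    Measure.smul_apply, smul_comm]
  refine smul_le_smul_of_nonneg_left ?_ (by simp)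
  simpa using hg.hausdorffMeasure_preimage_le (Nat.cast_nonneg d) s

section Transversality

variable {d m : ℕ} {A : Fin m → (EuclideanSpace ℝ (Fin d) →L[ℝ] EuclideanSpace ℝ (Fin d))}
  {r : ℝ} {proj : (Fin m → EuclideanSpace ℝ (Fin d)) → (ℕ → Fin m) → EuclideanSpace ℝ (Fin d)}

theorem exists_lintegral_proj_sub_le (hA : ∀ i, ‖A i‖ ≤ r) (hr0 : 0 ≤ r) (hr : r < 1 / 2)
    (hproj : ∀ t ω, Tendsto (fun n => affWord A t (pre ω n) 0) atTop (nhds (proj t ω)))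
    {R : ℝ} (hR : 0 ≤ R) :
    ∃ C : ℝ≥0∞, C < ∞ ∧ ∀ ω τ : ℕ → Fin m, ω 0 ≠ τ 0 →
      ∀ F : EuclideanSpace ℝ (Fin d) → ℝ≥0∞, Measurable F →
      ∫⁻ t in univ.pi fun _ : Fin m => Metric.closedBall (0 : EuclideanSpace ℝ (Fin d)) R,
        F (proj t ω - proj t τ) ≤ C * ∫⁻ y in Metric.closedBall 0 (4 * R), F y := by
  have hr1 : 0 < 1 - r := by linarith
  set c := 1 - r * (1 - r)⁻¹ with hc
  have hc0 : 0 < c := by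
    have : r * (1 - r)⁻¹ < 1 := by
      rw [← div_eq_mul_inv, div_lt_one hr1]; linarith
    linarith
  let K : NNReal := ⟨c⁻¹, by positivity⟩
  have hpm : ∀ ω : ℕ → Fin m, Measurable fun t => proj t ω := fun ω =>
    (measurable_proj_uncurry hproj).comp (measurable_id.prodMk measurable_const)
  rcases m with _ | n
  · exact ⟨1, by simp, fun ω => (ω 0).elim0⟩
  set P := univ.pi fun _ : Fin n => Metric.closedBall (0 : EuclideanSpace ℝ (Fin d)) R with hP
  have hPm : MeasurableSet P :=
    MeasurableSet.univ_pi fun _ => Metric.isClosed_closedBall.measurableSet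
  refine ⟨volume P * (K : ℝ≥0∞) ^ d, ENNReal.mul_lt_top ?_ (by finiteness), ?_⟩
  · rw [hP, volume_pi_pi]
    exact ENNReal.prod_lt_top fun _ _ => measure_closedBall_lt_top
  intro ω τ hne F hF
  obtain ⟨i, hi⟩ := exists_coordinate_expanding hA hr0 hr hproj ω τ hne
  set Q := univ.pi fun _ : Fin (n + 1) => Metric.closedBall (0 : EuclideanSpace ℝ (Fin d)) R
    with hQ
  have hQm : MeasurableSet Q :=
    MeasurableSet.univ_pi fun _ => Metric.isClosed_closedBall.measurableSet
  let G : EuclideanSpace ℝ (Fin d) → ℝ≥0∞ := (Metric.closedBall 0 (4 * R)).indicator F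
  have hG : Measurable G := hF.indicator Metric.isClosed_closedBall.measurableSet
  let e := MeasurableEquiv.piFinSuccAbove (fun _ : Fin (n + 1) => EuclideanSpace ℝ (Fin d)) i
  let H : EuclideanSpace ℝ (Fin d) × (Fin n → EuclideanSpace ℝ (Fin d)) → ℝ≥0∞ :=
    fun p => P.indicator 1 p.2 * G (proj (e.symm p) ω - proj (e.symm p) τ)
  have hHm : Measurable H :=
    ((measurable_one.indicator hPm).comp measurable_snd).mul
      (hG.comp (((hpm ω).comp e.symm.measurable).sub ((hpm τ).comp e.symm.measurable)))
  have hle : ∀ t, Q.indicator (fun t => F (proj t ω - proj t τ)) t ≤ H (e t) := by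
    intro t
    by_cases ht : t ∈ Q
    swap
    · simp [indicator_of_notMem ht]
    have ht' : ∀ k, ‖t k‖ ≤ R := fun k => by simpa using ht k (mem_univ k)
    have h1 : (e t).2 ∈ P := fun k _ =>
      mem_closedBall_zero_iff.2 (ht' (i.succAbove k))
    have h2 : proj t ω - proj t τ ∈ Metric.closedBall (0 : EuclideanSpace ℝ (Fin d)) (4 * R) := by
      rw [mem_closedBall_zero_iff]
      have := norm_proj_le hA hr.le hproj hR ht' ω
      have := norm_proj_le hA hr.le hproj hR ht' τ
      linarith [norm_sub_le (proj t ω) (proj t τ)]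
    simp only [H, G, e.symm_apply_apply, indicator_of_mem ht, indicator_of_mem h1,
      indicator_of_mem h2, Pi.one_apply, one_mul, le_refl]
  have hmp := volume_preserving_piFinSuccAbove (fun _ : Fin (n + 1) => EuclideanSpace ℝ (Fin d)) i
  calc ∫⁻ t in Q, F (proj t ω - proj t τ)
      = ∫⁻ t, Q.indicator (fun t => F (proj t ω - proj t τ)) t := (lintegral_indicator hQm _).symm
    _ ≤ ∫⁻ t, H (e t) := lintegral_mono hle
    _ = ∫⁻ p, H p := hmp.lintegral_comp hHm
    _ = ∫⁻ u, ∫⁻ x, H (x, u) := lintegral_prod_symm' _ hHm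
    _ ≤ ∫⁻ u, P.indicator 1 u * ((K : ℝ≥0∞) ^ d * ∫⁻ y, G y) := by
        refine lintegral_mono fun u => ?_
        have hem : Measurable fun x => e.symm (x, u) :=
          e.symm.measurable.comp (measurable_id.prodMk measurable_const)
        have hgm : Measurable fun x => proj (e.symm (x, u)) ω - proj (e.symm (x, u)) τ :=
          ((hpm ω).comp hem).sub ((hpm τ).comp hem)
        simp only [H]
        rw [lintegral_const_mul]
        swap
        · exact hG.comp hgm
        gcongr
        refine AntilipschitzWith.lintegral_comp_le
          (g := fun x => proj (e.symm (x, u)) ω - proj (e.symm (x, u)) τ) ?_ hgm hG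
        refine AntilipschitzWith.of_le_mul_dist fun x x' => ?_
        have hoff : ∀ k, k ≠ i → e.symm (x, u) k = e.symm (x', u) k := by
          intro k hk
          obtain ⟨j, rfl⟩ := Fin.exists_succAbove_eq hk
          simp [e]
        have hxi := hi _ _ hoff
        have h1 : e.symm (x, u) i = x := by simp [e]
        have h2 : e.symm (x', u) i = x' := by simp [e]
        rw [h1, h2] at hxi
        rw [dist_eq_norm, dist_eq_norm]
        change _ ≤ c⁻¹ * _
        rw [inv_mul_eq_div, le_div_iff₀ hc0, mul_comm]
        exact hxi
    _ = volume P * (K : ℝ≥0∞) ^ d * ∫⁻ y in Metric.closedBall 0 (4 * R), F y := by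
        rw [lintegral_mul_const _ (measurable_one.indicator hPm), lintegral_indicator_one hPm,
          ← lintegral_indicator Metric.isClosed_closedBall.measurableSet, mul_assoc]

theorem exists_lintegral_proj_rpow_le (hA : ∀ i, ‖A i‖ ≤ r) (hr0 : 0 ≤ r) (hr : r < 1 / 2)
    (hinj : ∀ i, Function.Injective (A i))
    (hproj : ∀ t ω, Tendsto (fun n => affWord A t (pre ω n) 0) atTop (nhds (proj t ω)))
    {R : ℝ} (hR : 0 ≤ R) (a : Fin d → ℝ) (ha0 : ∀ i, 0 < a i) (ha1 : ∀ i, a i < 1) :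
    ∃ C : ℝ≥0∞, C < ∞ ∧ ∀ (ω τ : ℕ → Fin m) (n : ℕ), (∀ k < n, ω k = τ k) → ω n ≠ τ n →
      ∫⁻ t in univ.pi fun _ : Fin m => Metric.closedBall (0 : EuclideanSpace ℝ (Fin d)) R,
        ‖proj t ω - proj t τ‖ₑ ^ (-∑ i, a i) ≤
        C * ∏ i : Fin d, ENNReal.ofReal (singVal (wordProd A (pre ω n)) (i + 1) ^ (-a i)) := by
  obtain ⟨C₁, hC₁, h₁⟩ := exists_lintegral_proj_sub_le hA hr0 hr hproj hR
  obtain ⟨C₂, hC₂, h₂⟩ := exists_lintegral_norm_rpow_neg_le a ha0 ha1 (4 * R)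
  refine ⟨C₁ * C₂, ENNReal.mul_lt_top hC₁ hC₂, fun ω τ n hlt hne => ?_⟩
  have hB := wordProd_injective hinj (pre ω n)
  calc _ = ∫⁻ t in univ.pi fun _ : Fin m => Metric.closedBall (0 : EuclideanSpace ℝ (Fin d)) R,
        ‖wordProd A (pre ω n) (proj t (shift^[n] ω) - proj t (shift^[n] τ))‖ₑ ^ (-∑ i, a i) := by
        simp_rw [proj_sub_eq hproj _ ω τ n hlt]
    _ ≤ C₁ * ∫⁻ y in Metric.closedBall 0 (4 * R), ‖wordProd A (pre ω n) y‖ₑ ^ (-∑ i, a i) := by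
        refine h₁ (shift^[n] ω) (shift^[n] τ) ?_
          (fun y => ‖wordProd A (pre ω n) y‖ₑ ^ (-∑ i, a i)) ?_
        · simpa [shift_iterate_apply] using hne
        · fun_prop
    _ ≤ _ := by
        rw [mul_assoc]
        gcongr
        exact h₂ _ hB

end Transversality

theorem ofReal_le_dimHMeasure {d : ℕ} (μ : Measure (EuclideanSpace ℝ (Fin d))) [SFinite μ] {s : ℝ}
    (hs : 0 < s) (h : μ {x | ∫⁻ y, ‖x - y‖ₑ ^ (-s) ∂μ < ∞} ≠ 0) :
    ENNReal.ofReal s ≤ dimHMeasure μ := by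
  have hpm : Measurable fun x => ∫⁻ y, ‖x - y‖ₑ ^ (-s) ∂μ :=
    Measurable.lintegral_prod_right' (f := fun p : EuclideanSpace ℝ (Fin d) ×
      EuclideanSpace ℝ (Fin d) => ‖p.1 - p.2‖ₑ ^ (-s)) (by fun_prop)
  obtain ⟨M, hM⟩ : ∃ M : ℕ, μ {x | ∫⁻ y, ‖x - y‖ₑ ^ (-s) ∂μ ≤ ((M + 1 : ℕ) : ℝ≥0∞)} ≠ 0 := by
    by_contra! hcon
    refine h (measure_mono_null (fun x hx => ?_) (measure_iUnion_null hcon))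
    obtain ⟨n, hn⟩ := ENNReal.exists_nat_gt (ne_of_lt hx)
    exact mem_iUnion.2 ⟨n, hn.le.trans (by norm_cast; omega)⟩
  set P := {x | ∫⁻ y, ‖x - y‖ₑ ^ (-s) ∂μ ≤ ((M + 1 : ℕ) : ℝ≥0∞)} with hP
  have hPm : MeasurableSet P := measurableSet_le hpm measurable_const
  have hM0 : ((M + 1 : ℕ) : ℝ≥0∞) ≠ 0 := by simp
  have hMt : ((M + 1 : ℕ) : ℝ≥0∞) ≠ ∞ := ENNReal.natCast_ne_top _
  have hle : (((M + 1 : ℕ) : ℝ≥0∞))⁻¹ • μ.restrict P ≤ Measure.hausdorffMeasure s := by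
    refine Measure.le_hausdorffMeasure s _ 1 one_pos fun U hU => ?_
    rw [Measure.smul_apply, Measure.restrict_apply' hPm, smul_eq_mul, mul_comm, ← div_eq_mul_inv,
      ENNReal.div_le_iff_le_mul (Or.inl hM0) (Or.inl hMt)]
    rcases (U ∩ P).eq_empty_or_nonempty with he | ⟨x, hxU, hxP⟩
    · simp [he]
    have hsub : U ⊆ Metric.closedEBall x (Metric.ediam U) := fun y hy =>
      Metric.edist_le_ediam_of_mem hy hxU
    have h1 : μ U * Metric.ediam U ^ (-s) ≤ ((M + 1 : ℕ) : ℝ≥0∞) := by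
      calc μ U * Metric.ediam U ^ (-s)
          ≤ Metric.ediam U ^ (-s) * μ (Metric.closedEBall x (Metric.ediam U)) := by
            rw [mul_comm]; gcongr
        _ = ∫⁻ _ in Metric.closedEBall x (Metric.ediam U), Metric.ediam U ^ (-s) ∂μ :=
            (setLIntegral_const _ _).symm
        _ ≤ ∫⁻ y in Metric.closedEBall x (Metric.ediam U), ‖x - y‖ₑ ^ (-s) ∂μ := by
            refine setLIntegral_mono' Metric.isClosed_closedEBall.measurableSet fun y hy => ?_
            rw [ENNReal.rpow_neg, ENNReal.rpow_neg, ENNReal.inv_le_inv]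
            refine ENNReal.rpow_le_rpow ?_ hs.le
            rw [← edist_eq_enorm_sub, edist_comm]
            exact hy
        _ ≤ ∫⁻ y, ‖x - y‖ₑ ^ (-s) ∂μ := setLIntegral_le_lintegral _ _
        _ ≤ _ := hxP
    rw [ENNReal.rpow_neg, ← div_eq_mul_inv, ENNReal.div_le_iff_le_mul (Or.inr hMt)
      (Or.inr hM0), mul_comm] at h1
    exact (measure_mono inter_subset_left).trans h1
  refine le_csInf ⟨_, ⟨univ, by simp, rfl⟩⟩ ?_
  rintro _ ⟨S, hS, rfl⟩
  refine le_dimH_of_hausdorffMeasure_ne_zero (d := s.toNNReal) ?_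
  rw [Real.coe_toNNReal _ hs.le]
  intro h0
  have h1 := (hle S).trans_eq h0
  rw [Measure.smul_apply, Measure.restrict_apply' hPm, smul_eq_mul, nonpos_iff_eq_zero,
    mul_eq_zero] at h1
  rcases h1 with h1 | h1
  · exact ENNReal.inv_ne_zero.2 hMt h1
  · refine hM (measure_mono_null (t := S ∩ P ∪ Sᶜ) (fun x hx => ?_) (measure_union_null h1 hS))
    by_cases hxS : x ∈ S
    · exact Or.inl ⟨hxS, hx⟩
    · exact Or.inr hxS

theorem ae_ofReal_le_dimHMeasure_map {d m : ℕ}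
    {proj : (Fin m → EuclideanSpace ℝ (Fin d)) → (ℕ → Fin m) → EuclideanSpace ℝ (Fin d)}
    (hproj : Measurable fun p : (Fin m → EuclideanSpace ℝ (Fin d)) × (ℕ → Fin m) => proj p.1 p.2)
    (ν : Measure (ℕ → Fin m)) [IsFiniteMeasure ν] {E : Set (ℕ → Fin m)} (hE : MeasurableSet E)
    (hνE : ν E ≠ 0) {s : ℝ} (hs : 0 < s) {Q : Set (Fin m → EuclideanSpace ℝ (Fin d))}
    (h : ∀ ω ∈ E, ∫⁻ τ, (∫⁻ t in Q, ‖proj t ω - proj t τ‖ₑ ^ (-s)) ∂ν ≠ ∞) :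
    ∀ᵐ t ∂volume.restrict Q, ENNReal.ofReal s ≤ dimHMeasure (Measure.map (proj t) ν) := by
  have hptm : ∀ t, Measurable (proj t) := fun t =>
    hproj.comp (measurable_const.prodMk measurable_id)
  have hptω : ∀ ω, Measurable fun t => proj t ω := fun ω =>
    hproj.comp (measurable_id.prodMk measurable_const)
  obtain ⟨Φ, hΦ⟩ : ∃ Φ : (Fin m → EuclideanSpace ℝ (Fin d)) → (ℕ → Fin m) → ℝ≥0∞,
      ∀ t ω, Φ t ω = ∫⁻ τ, ‖proj t ω - proj t τ‖ₑ ^ (-s) ∂ν := ⟨_, fun _ _ => rfl⟩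
  have hjm : Measurable fun p : ((Fin m → EuclideanSpace ℝ (Fin d)) × (ℕ → Fin m)) ×
      (ℕ → Fin m) => ‖proj p.1.1 p.1.2 - proj p.1.1 p.2‖ₑ ^ (-s) := by
    have h1 : Measurable fun p : ((Fin m → EuclideanSpace ℝ (Fin d)) × (ℕ → Fin m)) ×
      (ℕ → Fin m) => proj p.1.1 p.1.2 := hproj.comp measurable_fst
    have h2 : Measurable fun p : ((Fin m → EuclideanSpace ℝ (Fin d)) × (ℕ → Fin m)) ×
      (ℕ → Fin m) => proj p.1.1 p.2 :=
      hproj.comp ((measurable_fst.comp measurable_fst).prodMk measurable_snd)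
    exact (h1.sub h2).enorm.pow_const _
  have hΦm : Measurable fun p : (Fin m → EuclideanSpace ℝ (Fin d)) × (ℕ → Fin m) => Φ p.1 p.2 := by
    simp_rw [hΦ]
    exact hjm.lintegral_prod_right'
  have hae : ∀ᵐ ω ∂ν.restrict E, ∀ᵐ t ∂volume.restrict Q, Φ t ω < ∞ := by
    rw [ae_restrict_iff' hE]
    refine Eventually.of_forall fun ω hω => ?_
    have hm2 : Measurable fun p : (ℕ → Fin m) × (Fin m → EuclideanSpace ℝ (Fin d)) =>
        ‖proj p.2 ω - proj p.2 p.1‖ₑ ^ (-s) := by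
      have h1 : Measurable fun p : (ℕ → Fin m) × (Fin m → EuclideanSpace ℝ (Fin d)) =>
        proj p.2 ω := (hptω ω).comp measurable_snd
      have h2 : Measurable fun p : (ℕ → Fin m) × (Fin m → EuclideanSpace ℝ (Fin d)) =>
        proj p.2 p.1 := hproj.comp measurable_swap
      exact (h1.sub h2).enorm.pow_const _
    have hΦω : Measurable fun t => Φ t ω := hΦm.of_uncurry_right
    refine ae_lt_top hΦω ?_
    simp_rw [hΦ]
    rw [← lintegral_lintegral_swap (f := fun τ t => ‖proj t ω - proj t τ‖ₑ ^ (-s))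
      hm2.aemeasurable]
    exact h ω hω
  rw [Measure.ae_ae_comm (p := fun ω t => Φ t ω < ∞)] at hae
  swap
  · exact measurableSet_lt (hΦm.comp measurable_swap) measurable_const
  filter_upwards [hae] with t ht
  have : IsFiniteMeasure (Measure.map (proj t) ν) := inferInstance
  refine ofReal_le_dimHMeasure _ hs ?_
  have hpot : ∀ x, ∫⁻ y, ‖x - y‖ₑ ^ (-s) ∂Measure.map (proj t) ν =
      ∫⁻ τ, ‖x - proj t τ‖ₑ ^ (-s) ∂ν := fun x =>
    lintegral_map (by fun_prop) (hptm t)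
  simp_rw [hpot]
  intro h0
  have h1 : ν {ω | Φ t ω < ∞} = 0 := by
    refine measure_mono_null ?_
      (Measure.preimage_null_of_map_null (hptm t).aemeasurable h0)
    intro ω hω
    rw [mem_ofPred_eq, hΦ] at hω
    exact hω
  rw [ae_restrict_iff' hE] at ht
  refine hνE (measure_mono_null (t := {ω | Φ t ω < ∞} ∪ {ω | ¬(ω ∈ E → Φ t ω < ∞)}) ?_
    (measure_union_null h1 (ae_iff.1 ht)))
  intro ω hω
  by_cases hlt : Φ t ω < ∞
  · exact Or.inl hlt
  · exact Or.inr fun hcon => hlt (hcon hω)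

section WordSum

variable {α : Type*}

/-- The sum of a function over all words of a given length. -/
def wordSum [Fintype α] : ℕ → (List α → ℝ) → ℝ
  | 0, G => G []
  | n + 1, G => ∑ i, wordSum n fun w => G (i :: w)

theorem sum_ofFn_eq_wordSum [Fintype α] (n : ℕ) (G : List α → ℝ) :
    ∑ w : Fin n → α, G (List.ofFn w) = wordSum n G := by
  induction n generalizing G with
  | zero => simp [wordSum]
  | succ n ih =>
    rw [wordSum, ← (Fin.consEquiv fun _ : Fin (n + 1) => α).sum_comp, Fintype.sum_prod_type]
    refine Finset.sum_congr rfl fun i _ => ?_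
    rw [← ih]
    refine Finset.sum_congr rfl fun w _ => ?_
    simp [Fin.consEquiv, List.ofFn_succ]

theorem wordSum_take_mul_drop [Fintype α] (n k : ℕ) (a b : List α → ℝ) :
    wordSum (n + k) (fun w => a (w.take n) * b (w.drop n)) = wordSum n a * wordSum k b := by
  induction n generalizing a with
  | zero =>
    simp only [zero_add, List.take_zero, List.drop_zero, wordSum]
    rw [← sum_ofFn_eq_wordSum, ← sum_ofFn_eq_wordSum, Finset.mul_sum]
  | succ n ih =>
    rw [Nat.add_right_comm, wordSum, wordSum, Finset.sum_mul]
    refine Finset.sum_congr rfl fun i _ => ?_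
    simp only [List.take_succ_cons, List.drop_succ_cons]
    exact ih fun w => a (i :: w)

theorem wordSum_sum [Fintype α] {ι : Type*} (s : Finset ι) (n : ℕ) (G : ι → List α → ℝ) :
    wordSum n (fun w => ∑ j ∈ s, G j w) = ∑ j ∈ s, wordSum n (G j) := by
  simp_rw [← sum_ofFn_eq_wordSum]
  exact Finset.sum_comm

/-- The total weight of all factorizations of a word of length `N` into nonempty words. -/
noncomputable def factorWeight (q : List α → ℝ) : ℕ → List α → ℝ
  | 0, _ => 1
  | N + 1, w => ∑ n : Fin (N + 1), q (w.take (n + 1)) * factorWeight q (N - n) (w.drop (n + 1))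
  termination_by N => N
  decreasing_by omega


theorem factorWeight_nonneg {q : List α → ℝ} (hq : ∀ w, 0 ≤ q w) (N : ℕ) (w : List α) :
    0 ≤ factorWeight q N w := by
  induction N using Nat.strong_induction_on generalizing w with
  | _ N ih =>
    cases N with
    | zero => simp [factorWeight]
    | succ N =>
      rw [factorWeight]
      exact Finset.sum_nonneg fun n _ => mul_nonneg (hq _) (ih _ (by omega) _)

theorem mul_factorWeight_le {q : List α → ℝ} (hq : ∀ w, 0 ≤ q w) {n N : ℕ} (hn : 1 ≤ n)
    (hnN : n ≤ N) (w : List α) : q (w.take n) * factorWeight q (N - n) (w.drop n) ≤ factorWeight q N w := by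
  obtain ⟨n, rfl⟩ := Nat.exists_eq_add_of_le' hn
  obtain ⟨N, rfl⟩ := Nat.exists_eq_add_of_le' (hn.trans hnN)
  rw [factorWeight, Nat.add_sub_add_right]
  exact Finset.single_le_sum (f := fun n : Fin (N + 1) => q (w.take (n + 1)) *
    factorWeight q (N - n) (w.drop (n + 1)))
    (fun n _ => mul_nonneg (hq _) (factorWeight_nonneg hq _ _))
    (Finset.mem_univ (⟨n, by omega⟩ : Fin (N + 1)))

theorem wordSum_factorWeight_le_one [Fintype α] {q : List α → ℝ} (hq : ∀ w, 0 ≤ q w)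
    (hq1 : ∀ N, ∑ n ∈ Finset.range N, wordSum (n + 1) q ≤ 1) (N : ℕ) :
    wordSum N (factorWeight q N) ≤ 1 := by
  induction N using Nat.strong_induction_on with
  | _ N ih =>
    cases N with
    | zero => simp [factorWeight, wordSum]
    | succ N =>
      have : factorWeight q (N + 1) = fun w => ∑ n : Fin (N + 1),
          q (w.take (n + 1)) * factorWeight q (N - n) (w.drop (n + 1)) := by
        funext w; rw [factorWeight]
      rw [this, wordSum_sum]
      refine le_trans ?_ (hq1 (N + 1))
      rw [← Fin.sum_univ_eq_sum_range (fun n => wordSum (n + 1) q)]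
      refine Finset.sum_le_sum fun n _ => ?_
      have h1 := wordSum_take_mul_drop (n + 1) (N - n) q (factorWeight q (N - n))
      rw [show (n : ℕ) + 1 + (N - n) = N + 1 by omega] at h1
      rw [h1]
      refine mul_le_of_le_one_right ?_ (ih _ (by omega))
      rw [← sum_ofFn_eq_wordSum]
      exact Finset.sum_nonneg fun _ _ => hq _

end WordSum

theorem take_pre {α : Type*} (ω : ℕ → α) {n N : ℕ} (h : n ≤ N) : (pre ω N).take n = pre ω n := by
  induction n generalizing ω N with
  | zero => simp [pre_zero]
  | succ n ih =>
    obtain ⟨N, rfl⟩ := Nat.exists_eq_add_of_le' (show 1 ≤ N by omega)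
    rw [pre_succ, pre_succ, List.take_succ_cons, ih _ (by omega)]

theorem drop_pre {α : Type*} (ω : ℕ → α) {n N : ℕ} (h : n ≤ N) :
    (pre ω N).drop n = pre (shift^[n] ω) (N - n) := by
  induction n generalizing ω N with
  | zero => simp
  | succ n ih =>
    obtain ⟨N, rfl⟩ := Nat.exists_eq_add_of_le' (show 1 ≤ N by omega)
    rw [pre_succ, List.drop_succ_cons, ih _ (by omega), Function.iterate_succ_apply,
      Nat.add_sub_add_right]

theorem length_pre {α : Type*} (ω : ℕ → α) (n : ℕ) : (pre ω n).length = n := by simp [pre]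

theorem measurable_shift {α : Type*} [MeasurableSpace α] :
    Measurable (shift : (ℕ → α) → ℕ → α) :=
  measurable_pi_lambda _ fun n => measurable_pi_apply (n + 1)

section Mass

variable {m : ℕ} {ν : Measure (ℕ → Fin m)}

theorem measurable_comp_pre {β : Type*} [MeasurableSpace β] (F : List (Fin m) → β) (n : ℕ) :
    Measurable fun ω : ℕ → Fin m => F (pre ω n) := by
  have h1 : Measurable fun (ω : ℕ → Fin m) (j : Fin n) => ω j :=
    measurable_pi_lambda _ fun j => measurable_pi_apply _
  exact (measurable_of_finite fun w : Fin n → Fin m => F (List.ofFn w)).comp h1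

theorem measurableSet_pre_eq (u : List (Fin m)) (n : ℕ) :
    MeasurableSet {τ : ℕ → Fin m | pre τ n = u} :=
  measurableSet_setOfPred.2 (measurable_comp_pre (fun w => w = u) n)

/-- The measure of the cylinder of a word. -/
noncomputable def wordMass (ν : Measure (ℕ → Fin m)) (w : List (Fin m)) : ℝ :=
  ν.real {τ | pre τ w.length = w}

theorem wordMass_pre (ω : ℕ → Fin m) (n : ℕ) :
    wordMass ν (pre ω n) = ν.real {τ | pre τ n = pre ω n} := by
  rw [wordMass, length_pre]

theorem wordMass_ofFn {n : ℕ} (w : Fin n → Fin m) :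
    wordMass ν (List.ofFn w) = (ν {ω | ∀ j : Fin n, ω j = w j}).toReal := by
  rw [wordMass, Measure.real, List.length_ofFn]
  congr 2
  ext ω
  rw [mem_ofPred_eq, mem_ofPred_eq, pre, List.ofFn_inj, funext_iff]

theorem wordMass_nonneg (w : List (Fin m)) : 0 ≤ wordMass ν w := measureReal_nonneg

theorem wordMass_le_one [IsProbabilityMeasure ν] (w : List (Fin m)) : wordMass ν w ≤ 1 :=
  measureReal_le_one

theorem integral_comp_pre [IsProbabilityMeasure ν] (F : List (Fin m) → ℝ) (n : ℕ) :
    ∫ ω, F (pre ω n) ∂ν = wordSum n fun w => wordMass ν w * F w := by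
  have h1 : Measurable fun (ω : ℕ → Fin m) (j : Fin n) => ω j :=
    measurable_pi_lambda _ fun j => measurable_pi_apply _
  have h2 := integral_map (μ := ν) h1.aemeasurable
    (f := fun w : Fin n → Fin m => F (List.ofFn w)) (by fun_prop)
  have : IsProbabilityMeasure (Measure.map (fun (ω : ℕ → Fin m) (j : Fin n) => ω j) ν) :=
    Measure.isProbabilityMeasure_map h1.aemeasurable
  rw [← sum_ofFn_eq_wordSum]
  refine h2.symm.trans ?_
  rw [integral_fintype (Integrable.of_finite)]
  refine Finset.sum_congr rfl fun w _ => ?_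
  rw [smul_eq_mul, wordMass_ofFn, Measure.real, Measure.map_apply h1 (measurableSet_singleton _)]
  congr 3
  ext ω
  simp [funext_iff]

theorem integrable_comp_pre [IsProbabilityMeasure ν] (F : List (Fin m) → ℝ) (n : ℕ) :
    Integrable (fun ω => F (pre ω n)) ν := by
  obtain ⟨C, hC⟩ := (finite_range fun w : Fin n → Fin m => ‖F (List.ofFn w)‖).bddAbove
  exact Integrable.of_bound (measurable_comp_pre F n).aestronglyMeasurable C
    (Eventually.of_forall fun ω => hC ⟨_, rfl⟩)

theorem wordSum_wordMass [IsProbabilityMeasure ν] (n : ℕ) : wordSum n (wordMass ν) = 1 := by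
  have := integral_comp_pre (ν := ν) (fun _ => 1) n
  simpa using this.symm

theorem ae_wordMass_pre_pos [IsProbabilityMeasure ν] : ∀ᵐ ω ∂ν, ∀ n, 0 < wordMass ν (pre ω n) := by
  rw [ae_all_iff]
  intro n
  have hfin : (range fun ω : ℕ → Fin m => pre ω n).Countable :=
    ((finite_range fun w : Fin n → Fin m => List.ofFn w).subset
      (by rintro _ ⟨ω, rfl⟩; exact ⟨_, rfl⟩)).countable
  refine measure_mono_null (t := ⋃ w ∈ range fun ω : ℕ → Fin m => pre ω n,
    {τ | pre τ n = w ∧ ν {τ | pre τ n = w} = 0}) ?_ ((measure_biUnion_null_iff hfin).2 ?_)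
  · intro ω hω
    refine mem_iUnion₂.2 ⟨pre ω n, ⟨ω, rfl⟩, rfl, ?_⟩
    have h1 : wordMass ν (pre ω n) ≤ 0 := not_lt.1 hω
    rw [wordMass_pre] at h1
    exact (measureReal_eq_zero_iff).1 (le_antisymm h1 measureReal_nonneg)
  · intro w _
    by_cases h0 : ν {τ | pre τ n = w} = 0
    · exact measure_mono_null (fun τ hτ => hτ.1) h0
    · simp [h0]

theorem wordMass_pre_succ_le [IsProbabilityMeasure ν] (hν : MeasurePreserving shift ν ν)
    (ω : ℕ → Fin m) (n : ℕ) : wordMass ν (pre ω (n + 1)) ≤ wordMass ν (pre (shift ω) n) := by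
  have hmeas := measurableSet_pre_eq (pre (shift ω) n) n
  rw [wordMass_pre, wordMass_pre, Measure.real, Measure.real, ← hν.measure_preimage
    hmeas.nullMeasurableSet]
  refine ENNReal.toReal_mono (measure_ne_top _ _) (measure_mono fun τ hτ => ?_)
  have h1 : pre τ (n + 1) = pre ω (n + 1) := hτ
  rw [pre_succ, pre_succ] at h1
  exact (List.cons.inj h1).2

end Mass

section EntropyFormula

variable {m : ℕ} {ν : Measure (ℕ → Fin m)} [IsProbabilityMeasure ν]

theorem integral_neg_log_wordMass (n : ℕ) : ∫ ω, -Real.log (wordMass ν (pre ω n)) ∂ν =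
    -∑ w : Fin n → Fin m, ((ν {ω | ∀ j : Fin n, ω j = w j}).toReal *
          Real.log (ν {ω | ∀ j : Fin n, ω j = w j}).toReal) := by
  rw [integral_comp_pre (fun w => -Real.log (wordMass ν w)), ← sum_ofFn_eq_wordSum,
    ← Finset.sum_neg_distrib]
  refine Finset.sum_congr rfl fun w _ => ?_
  rw [wordMass_ofFn]
  ring

theorem neg_log_wordMass_nonneg (w : List (Fin m)) : 0 ≤ -Real.log (wordMass ν w) :=
  neg_nonneg.2 (Real.log_nonpos (wordMass_nonneg w) (wordMass_le_one w))

theorem ae_frequently_exp_lt_wordMass (hν : Ergodic shift ν) {h c : ℝ}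
    (hh : Tendsto (fun n : ℕ => (n : ℝ)⁻¹ * ∫ ω, -Real.log (wordMass ν (pre ω n)) ∂ν) atTop
      (nhds h)) (hc : h < c) :
    ∀ᵐ ω ∂ν, ∃ᶠ n : ℕ in atTop, Real.exp (-(n * c)) < wordMass ν (pre ω n) := by
  have h0 : 0 ≤ h := ge_of_tendsto' hh fun n =>
    mul_nonneg (by positivity) (integral_nonneg fun ω => neg_log_wordMass_nonneg _)
  set C : Set (ℕ → Fin m) := {ω | ∃ K : ℕ, ∀ᶠ n : ℕ in atTop,
    wordMass ν (pre ω n) ≤ K * Real.exp (-(n * c))} with hC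
  have hCm : MeasurableSet C := by
    have : C = ⋃ K : ℕ, ⋃ N : ℕ, ⋂ n : ℕ, ⋂ _ : N ≤ n,
        {ω | wordMass ν (pre ω n) ≤ K * Real.exp (-(n * c))} := by
      ext ω
      simp [hC, eventually_atTop]
    rw [this]
    refine MeasurableSet.iUnion fun K => MeasurableSet.iUnion fun N => MeasurableSet.iInter
      fun n => MeasurableSet.iInter fun _ => ?_
    exact measurableSet_le (measurable_comp_pre (wordMass ν) n) measurable_const
  have hsub : shift ⁻¹' C ⊆ C := by
    rintro ω ⟨K, hK⟩
    obtain ⟨K', hK'⟩ := exists_nat_ge (K * Real.exp c)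
    refine ⟨K', ?_⟩
    rw [← map_add_atTop_eq_nat 1, eventually_map]
    filter_upwards [hK] with n hn
    calc wordMass ν (pre ω (n + 1)) ≤ wordMass ν (pre (shift ω) n) :=
          wordMass_pre_succ_le hν.toMeasurePreserving ω n
      _ ≤ K * Real.exp (-(n * c)) := hn
      _ = K * Real.exp c * Real.exp (-((n + 1 : ℕ) * c)) := by
          rw [mul_assoc, ← Real.exp_add]; congr 2; push_cast; ring
      _ ≤ _ := by gcongr
  rcases hν.ae_empty_or_univ_of_preimage_ae_le hCm.nullMeasurableSet
    (Eventually.of_forall hsub) with hC0 | hC1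
  · have : ∀ᵐ ω ∂ν, ω ∉ C := by
      filter_upwards [hC0.mem_iff] with ω hω
      simpa using hω
    filter_upwards [this] with ω hω hcon
    refine hω ⟨1, ?_⟩
    simpa using hcon
  · exfalso
    have hall : ∀ᵐ ω ∂ν, ω ∈ C := by
      filter_upwards [hC1.mem_iff] with ω hω
      simpa using hω
    obtain ⟨c', hc1, hc2⟩ := exists_between hc
    have hlow : ∀ᵐ ω ∂ν, ENNReal.ofReal c' ≤ liminf (fun n : ℕ =>
        ENNReal.ofReal ((n : ℝ)⁻¹ * -Real.log (wordMass ν (pre ω n)))) atTop := by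
      filter_upwards [hall, ae_wordMass_pre_pos] with ω ⟨K, hK⟩ hpos
      refine le_liminf_of_le (by isBoundedDefault) ?_
      have hlim : Tendsto (fun n : ℕ => c - Real.log K * (n : ℝ)⁻¹) atTop
          (nhds (c - Real.log K * 0)) :=
        (tendsto_inv_atTop_nhds_zero_nat.const_mul _).const_sub _
      rw [mul_zero, sub_zero] at hlim
      filter_upwards [hK, hlim.eventually (lt_mem_nhds hc2), eventually_gt_atTop 0] with n hn h1 hn0
      refine ENNReal.ofReal_le_ofReal ?_
      have hn0' : (0 : ℝ) < n := Nat.cast_pos.2 hn0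
      have hKpos : (0 : ℝ) < K := by
        by_contra hcon
        have := (hpos n).trans_le hn
        have h2 := mul_nonpos_of_nonpos_of_nonneg (not_lt.1 hcon) (Real.exp_pos (-(n * c))).le
        linarith
      have h2 := Real.log_le_log (hpos n) hn
      rw [Real.log_mul hKpos.ne' (Real.exp_pos _).ne', Real.log_exp] at h2
      calc c' ≤ c - Real.log K * (n : ℝ)⁻¹ := h1.le
        _ = (n : ℝ)⁻¹ * (n * c - Real.log K) := by field_simp
        _ ≤ _ := by gcongr; linarith
    have hfat := lintegral_liminf_le (μ := ν) (u := atTop) (f := fun (n : ℕ) (ω : ℕ → Fin m) =>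
        ENNReal.ofReal ((n : ℝ)⁻¹ * -Real.log (wordMass ν (pre ω n))))
        (fun n => measurable_comp_pre (fun w => ENNReal.ofReal ((n : ℝ)⁻¹ *
          -Real.log (wordMass ν w))) n)
    have heq : ∀ n : ℕ, ∫⁻ ω, ENNReal.ofReal ((n : ℝ)⁻¹ * -Real.log (wordMass ν (pre ω n))) ∂ν =
        ENNReal.ofReal ((n : ℝ)⁻¹ * ∫ ω, -Real.log (wordMass ν (pre ω n)) ∂ν) := fun n => by
      rw [← integral_const_mul, ofReal_integral_eq_lintegral_ofReal
        (integrable_comp_pre (fun w => (n : ℝ)⁻¹ * -Real.log (wordMass ν w)) n)]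
      exact Eventually.of_forall fun ω => mul_nonneg (by positivity) (neg_log_wordMass_nonneg _)
    simp_rw [heq] at hfat
    rw [(ENNReal.tendsto_ofReal hh).liminf_eq] at hfat
    have h3 := (lintegral_mono_ae hlow).trans hfat
    rw [lintegral_const, measure_univ, mul_one] at h3
    rw [ENNReal.ofReal_le_ofReal_iff h0] at h3
    linarith

end EntropyFormula

section Factorization

variable {m : ℕ}

open Classical in
/-- The number of visits to `Bᶜ` among the first `N` shifts of a sequence. -/
noncomputable def badCount (B : Set (ℕ → Fin m)) : ℕ → (ℕ → Fin m) → ℕ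
  | 0, _ => 0
  | N + 1, ω => (if ω ∈ B then 0 else 1) + badCount B N (shift ω)

theorem badCount_shift_iterate_le (B : Set (ℕ → Fin m)) (n N : ℕ) (ω : ℕ → Fin m) :
    badCount B N (shift^[n] ω) ≤ badCount B (N + n) ω := by
  induction n generalizing ω with
  | zero => rfl
  | succ n ih =>
    rw [Function.iterate_succ_apply, ← add_assoc, badCount]
    exact (ih _).trans (Nat.le_add_left _ _)

theorem measurable_badCount {B : Set (ℕ → Fin m)} (hB : MeasurableSet B) (N : ℕ) :
    Measurable (badCount B N) := by
  induction N with
  | zero => exact measurable_const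
  | succ N ih =>
    exact (Measurable.ite hB measurable_const measurable_const).add (ih.comp measurable_shift)

theorem badCount_le (B : Set (ℕ → Fin m)) (N : ℕ) (ω : ℕ → Fin m) : badCount B N ω ≤ N := by
  induction N generalizing ω with
  | zero => rfl
  | succ N ih =>
    rw [badCount]
    have := ih (shift ω)
    split_ifs <;> omega

variable {ν : Measure (ℕ → Fin m)} [IsProbabilityMeasure ν]

/-- Gibbs' inequality for words of length `n`. -/
theorem integral_neg_log_wordMass_le {Q : List (Fin m) → ℝ} {n : ℕ} (hQ0 : ∀ w, 0 ≤ Q w)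
    (hQ : ∀ ω, 0 < Q (pre ω n))
    (hQ1 : wordSum n Q ≤ 1) :
    ∫ ω, -Real.log (wordMass ν (pre ω n)) ∂ν ≤ ∫ ω, -Real.log (Q (pre ω n)) ∂ν := by
  rw [integral_comp_pre (fun w => -Real.log (wordMass ν w)),
    integral_comp_pre (fun w => -Real.log (Q w)), ← sub_nonpos]
  have h1 : wordSum n Q - wordSum n (wordMass ν) ≤ 0 := by rw [wordSum_wordMass]; linarith
  refine le_trans ?_ h1
  simp_rw [← sum_ofFn_eq_wordSum]
  rw [← Finset.sum_sub_distrib, ← Finset.sum_sub_distrib]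
  refine Finset.sum_le_sum fun w _ => ?_
  by_cases hP : wordMass ν (List.ofFn w) = 0
  · simpa [hP] using hQ0 _
  have hPpos : 0 < wordMass ν (List.ofFn w) := (wordMass_nonneg _).lt_of_ne' hP
  have hQpos : 0 < Q (List.ofFn w) := by
    have hne : {τ | pre τ (List.ofFn w).length = List.ofFn w} ≠ ∅ := fun he => hP (by
      rw [wordMass, he, measureReal_empty])
    obtain ⟨τ, hτ⟩ := nonempty_iff_ne_empty.2 hne
    rw [mem_ofPred_eq, List.length_ofFn] at hτ
    rw [← hτ]
    exact hQ τ
  have h2 := Real.log_le_sub_one_of_pos (div_pos hQpos hPpos)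
  rw [Real.log_div hQpos.ne' hP] at h2
  have h3 := mul_le_mul_of_nonneg_left h2 hPpos.le
  have h4 : wordMass ν (List.ofFn w) * (Q (List.ofFn w) / wordMass ν (List.ofFn w) - 1) =
      Q (List.ofFn w) - wordMass ν (List.ofFn w) := by field_simp
  linarith

theorem integrable_badCount {B : Set (ℕ → Fin m)} (hB : MeasurableSet B) (N : ℕ) :
    Integrable (fun ω => (badCount B N ω : ℝ)) ν :=
  Integrable.of_bound (measurable_from_nat.comp (measurable_badCount hB N)).aestronglyMeasurable N
    (Eventually.of_forall fun ω => by simpa using badCount_le B N ω)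

theorem integral_badCount (hν : MeasurePreserving shift ν ν) {B : Set (ℕ → Fin m)}
    (hB : MeasurableSet B) (N : ℕ) : ∫ ω, (badCount B N ω : ℝ) ∂ν = N * ν.real Bᶜ := by
  induction N with
  | zero => simp [badCount]
  | succ N ih =>
    have h1 : ∀ ω, (badCount B (N + 1) ω : ℝ) =
        Bᶜ.indicator 1 ω + (badCount B N (shift ω) : ℝ) := fun ω => by
      rw [badCount]
      by_cases h : ω ∈ B <;> simp [h]
    simp_rw [h1]
    have h2 : ∫ ω, (badCount B N (shift ω) : ℝ) ∂ν = ∫ ω, (badCount B N ω : ℝ) ∂ν := by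
      conv_rhs => rw [← hν.map_eq]
      exact (integral_map measurable_shift.aemeasurable
        (measurable_from_nat.comp (measurable_badCount hB N)).aestronglyMeasurable).symm
    have h3 : Integrable (fun ω => (badCount B N (shift ω) : ℝ)) ν :=
      (hν.integrable_comp (integrable_badCount hB N).aestronglyMeasurable).2
        (integrable_badCount hB N)
    have h4 : Integrable (Bᶜ.indicator (1 : (ℕ → Fin m) → ℝ)) ν :=
      (integrable_const (1 : ℝ)).indicator hB.compl
    rw [integral_add h4 h3, h2, ih,
      integral_indicator_one hB.compl]
    push_cast
    ring

variable {q : List (Fin m) → ℝ}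

theorem le_factorWeight {b : ℝ} (hb : 0 ≤ b) (hq : ∀ w, 0 ≤ q w) (hq1 : ∀ i, b ≤ q [i])
    (N : ℕ) (ω : ℕ → Fin m) : b ^ N ≤ factorWeight q N (pre ω N) := by
  induction N generalizing ω with
  | zero => simp [factorWeight]
  | succ N ih =>
    refine le_trans ?_ (mul_factorWeight_le hq le_rfl (by omega : 1 ≤ N + 1) (pre ω (N + 1)))
    rw [take_pre _ (by omega), drop_pre _ (by omega), pow_succ', pre_succ, pre_zero]
    exact mul_le_mul (hq1 _) (ih _) (by positivity) (hq _)

theorem le_factorWeight_of_returns {b c : ℝ} {L : ℕ} {B : Set (ℕ → Fin m)} (hb : 0 < b)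
    (hb1 : b ≤ 1) (hc : 0 ≤ c) (hq : ∀ w, 0 ≤ q w) (hq1 : ∀ i, b ≤ q [i])
    (hB : ∀ ω ∈ B, ∃ n, 1 ≤ n ∧ n ≤ L ∧ Real.exp (-(n * c)) ≤ q (pre ω n))
    (N : ℕ) (ω : ℕ → Fin m) :
    Real.exp (-(N * c)) * b ^ (badCount B N ω + L) ≤ factorWeight q N (pre ω N) := by
  induction N using Nat.strong_induction_on generalizing ω with
  | _ N ih =>
    rcases le_or_gt N L with hNL | hNL
    · refine le_trans ?_ (le_factorWeight hb.le hq hq1 N ω)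
      calc Real.exp (-(N * c)) * b ^ (badCount B N ω + L) ≤ 1 * b ^ N := by
            refine mul_le_mul ?_ (pow_le_pow_of_le_one hb.le hb1 (by omega)) (by positivity)
              zero_le_one
            rw [Real.exp_le_one_iff, neg_nonpos]
            positivity
        _ = b ^ N := one_mul _
    by_cases hω : ω ∈ B
    · obtain ⟨n, hn1, hnL, hqn⟩ := hB ω hω
      obtain ⟨k, rfl⟩ := Nat.exists_eq_add_of_le' (show n ≤ N by omega)
      refine le_trans ?_ (mul_factorWeight_le hq hn1 (by omega : n ≤ k + n) (pre ω (k + n)))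
      rw [take_pre _ (by omega), drop_pre _ (by omega), Nat.add_sub_cancel]
      refine le_trans ?_ (mul_le_mul hqn (ih k (by omega) (shift^[n] ω)) (by positivity) (hq _))
      rw [← mul_assoc, ← Real.exp_add]
      refine mul_le_mul (le_of_eq ?_) (pow_le_pow_of_le_one hb.le hb1 ?_) (by positivity)
        (by positivity)
      · congr 1; push_cast; ring
      · have := badCount_shift_iterate_le B n k ω
        omega
    · obtain ⟨k, rfl⟩ := Nat.exists_eq_add_of_le' (show 1 ≤ N by omega)
      refine le_trans ?_ (mul_factorWeight_le hq le_rfl (by omega : 1 ≤ k + 1) (pre ω (k + 1)))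
      rw [take_pre _ (by omega), drop_pre _ (by omega), Nat.add_sub_cancel]
      have h1 : b ≤ q (pre ω 1) := by rw [pre_succ, pre_zero]; exact hq1 _
      refine le_trans ?_ (mul_le_mul h1 (ih k (by omega) (shift^[1] ω)) (by positivity) (hq _))
      rw [badCount, if_neg hω, Function.iterate_one, mul_left_comm, ← pow_succ']
      refine mul_le_mul (Real.exp_le_exp.2 ?_) (le_of_eq (by congr 1; omega)) (by positivity)
        (by positivity)
      push_cast
      nlinarith

end Factorization

section LocalEntropy

variable {m : ℕ} {ν : Measure (ℕ → Fin m)} [IsProbabilityMeasure ν]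

theorem exists_weight (hm : 0 < m) {ε : ℝ} (hε : 0 < ε) : ∃ κ > 0, ∃ q : List (Fin m) → ℝ,
    (∀ w, 0 ≤ q w) ∧ (∀ i, (2 * m : ℝ)⁻¹ ≤ q [i]) ∧
    (∀ w, κ * Real.exp (-(w.length * ε)) * wordMass ν w ≤ q w) ∧
    ∀ N, ∑ n ∈ Finset.range N, wordSum (n + 1) q ≤ 1 := by
  have hs : Summable fun n : ℕ => Real.exp (-((n + 1 : ℕ) * ε)) := by
    have h1 : Summable fun n : ℕ => Real.exp (-ε) ^ n :=
      summable_geometric_of_lt_one (Real.exp_pos _).le (by rwa [Real.exp_lt_one_iff, neg_lt_zero])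
    refine ((summable_nat_add_iff 1).2 h1).congr fun n => ?_
    rw [← Real.exp_nat_mul]
    congr 1; ring
  set S := ∑' n : ℕ, Real.exp (-((n + 1 : ℕ) * ε)) with hS
  have hS0 : 0 ≤ S := tsum_nonneg fun n => (Real.exp_pos _).le
  have hm' : (0 : ℝ) < m := Nat.cast_pos.2 hm
  refine ⟨(2 * (1 + S))⁻¹, by positivity, fun w => (if w.length = 1 then (2 * m : ℝ)⁻¹ else 0) +
    (2 * (1 + S))⁻¹ * Real.exp (-(w.length * ε)) * wordMass ν w, fun w => ?_, fun i => ?_,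
    fun w => ?_, fun N => ?_⟩
  · have := wordMass_nonneg (ν := ν) w
    dsimp only
    split_ifs <;> positivity
  · have := wordMass_nonneg (ν := ν) [i]
    simp only [List.length_singleton, if_true]
    exact le_add_of_nonneg_right (by positivity)
  · refine le_add_of_nonneg_left ?_
    split_ifs <;> positivity
  · have h1 : ∀ n : ℕ, wordSum (n + 1) (fun w : List (Fin m) =>
        (if w.length = 1 then (2 * m : ℝ)⁻¹ else 0) +
        (2 * (1 + S))⁻¹ * Real.exp (-(w.length * ε)) * wordMass ν w) =
        (if n = 0 then 2⁻¹ else 0) + (2 * (1 + S))⁻¹ * Real.exp (-((n + 1 : ℕ) * ε)) := fun n => by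
      rw [← sum_ofFn_eq_wordSum]
      simp only [List.length_ofFn]
      rw [Finset.sum_add_distrib, ← Finset.mul_sum, sum_ofFn_eq_wordSum, wordSum_wordMass, mul_one]
      congr 1
      rcases n.eq_zero_or_pos with rfl | hn
      · simp
        field_simp
      · simp [hn.ne']
    simp_rw [h1]
    rw [Finset.sum_add_distrib, ← Finset.mul_sum]
    have h2 : ∑ n ∈ Finset.range N, (if n = 0 then (2 : ℝ)⁻¹ else 0) ≤ 2⁻¹ := by
      rw [Finset.sum_ite_eq']
      split_ifs <;> norm_num
    have h3 : ∑ n ∈ Finset.range N, Real.exp (-((n + 1 : ℕ) * ε)) ≤ 1 + S :=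
      (hs.sum_le_tsum _ fun n _ => (Real.exp_pos _).le).trans (by linarith)
    have h4 : (2 * (1 + S))⁻¹ * ∑ n ∈ Finset.range N, Real.exp (-((n + 1 : ℕ) * ε)) ≤
        (2 * (1 + S))⁻¹ * (1 + S) := by gcongr
    have h5 : (2 * (1 + S))⁻¹ * (1 + S) = 2⁻¹ := by field_simp
    linarith

theorem entropy_le_of_ae_frequently (hm : 0 < m) (hν : MeasurePreserving shift ν ν) {h c : ℝ}
    (hh : Tendsto (fun n : ℕ => (n : ℝ)⁻¹ * ∫ ω, -Real.log (wordMass ν (pre ω n)) ∂ν) atTop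
      (nhds h)) (hc : 0 ≤ c)
    (hfr : ∀ᵐ ω ∂ν, ∃ᶠ n : ℕ in atTop, Real.exp (-(n * c)) < wordMass ν (pre ω n))
    {ε δ : ℝ} (hε : 0 < ε) (hδ : 0 < δ) : h ≤ c + 2 * ε + δ * Real.log (2 * m) := by
  obtain ⟨κ, hκ, q, hq0, hq1, hqκ, hqsum⟩ := exists_weight (ν := ν) hm hε
  have hm' : (1 : ℝ) ≤ m := Nat.one_le_cast.2 hm
  have hlog : 0 ≤ Real.log (2 * m) := Real.log_nonneg (by linarith)
  obtain ⟨K, hK⟩ : ∃ K : ℕ, ∀ n : ℕ, K ≤ n → Real.exp (-(n * ε)) ≤ κ := by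
    have h1 : Tendsto (fun n : ℕ => Real.exp (-(n * ε))) atTop (nhds 0) :=
      Real.tendsto_exp_neg_atTop_nhds_zero.comp
        (tendsto_natCast_atTop_atTop.atTop_mul_const hε)
    exact eventually_atTop.1 (h1.eventually_le_const hκ)
  let B : ℕ → Set (ℕ → Fin m) := fun L =>
    {ω | ∃ n, 1 ≤ n ∧ K ≤ n ∧ n ≤ L ∧ Real.exp (-(n * c)) ≤ wordMass ν (pre ω n)}
  have hBm : ∀ L, MeasurableSet (B L) := fun L => by
    have : B L = ⋃ n, ⋃ _ : 1 ≤ n ∧ K ≤ n ∧ n ≤ L,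
        {ω | Real.exp (-(n * c)) ≤ wordMass ν (pre ω n)} := by
      ext ω; simp [B, and_assoc]
    rw [this]
    exact MeasurableSet.iUnion fun n => MeasurableSet.iUnion fun _ =>
      measurableSet_le measurable_const (measurable_comp_pre _ n)
  have hBmono : Monotone B := fun L L' hLL ω ⟨n, h1, h2, h3, h4⟩ => ⟨n, h1, h2, h3.trans hLL, h4⟩
  have hBfull : ν (⋃ L, B L) = 1 := by
    rw [← measure_univ (μ := ν)]
    refine measure_congr ?_
    filter_upwards [hfr] with ω hω
    refine propext ⟨fun _ => trivial, fun _ => ?_⟩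
    obtain ⟨n, hn, hn2⟩ := (hω.and_eventually (eventually_ge_atTop (K + 1))).exists
    exact mem_iUnion.2 ⟨n, n, by omega, by omega, le_rfl, hn.le⟩
  obtain ⟨L, hL⟩ : ∃ L, ν.real (B L)ᶜ ≤ δ := by
    have h1 := tendsto_measure_iUnion_atTop (μ := ν) hBmono
    rw [hBfull] at h1
    have h2 := (ENNReal.tendsto_toReal ENNReal.one_ne_top).comp h1
    obtain ⟨L, hL⟩ := (h2.eventually (lt_mem_nhds (show 1 - δ < (1 : ℝ≥0∞).toReal by
      simpa using hδ))).exists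
    refine ⟨L, ?_⟩
    rw [probReal_compl_eq_one_sub (hBm L)]
    have : 1 - δ < ν.real (B L) := hL
    linarith
  set b : ℝ := (2 * m : ℝ)⁻¹ with hb
  have hb0 : 0 < b := by positivity
  have hb1 : b ≤ 1 := inv_le_one_of_one_le₀ (by linarith)
  have hlow : ∀ (N : ℕ) (ω : ℕ → Fin m),
      Real.exp (-(N * (c + 2 * ε))) * b ^ (badCount (B L) N ω + L) ≤
      factorWeight q N (pre ω N) := by
    refine le_factorWeight_of_returns hb0 hb1 (by positivity) hq0 hq1 ?_
    rintro ω ⟨n, h1, h2, h3, h4⟩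
    refine ⟨n, h1, h3, le_trans ?_ (hqκ _)⟩
    rw [length_pre]
    calc Real.exp (-(n * (c + 2 * ε))) =
          Real.exp (-(n * ε)) * Real.exp (-(n * ε)) * Real.exp (-(n * c)) := by
          rw [← Real.exp_add, ← Real.exp_add]; congr 1; ring
      _ ≤ _ := by gcongr; exact hK n h2
  have hpos : ∀ (N : ℕ) (ω : ℕ → Fin m), 0 < factorWeight q N (pre ω N) := fun N ω =>
    lt_of_lt_of_le (by positivity) (hlow N ω)
  have hbound : ∀ N : ℕ, ∫ ω, -Real.log (wordMass ν (pre ω N)) ∂ν ≤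
      N * (c + 2 * ε) + (N * δ + L) * Real.log (2 * m) := fun N => by
    refine (integral_neg_log_wordMass_le (factorWeight_nonneg hq0 N) (hpos N)
      (wordSum_factorWeight_le_one hq0 hqsum N)).trans ?_
    have hintegrable : Integrable (fun ω => (N * (c + 2 * ε) + L * Real.log (2 * m)) +
        (badCount (B L) N ω : ℝ) * Real.log (2 * m)) ν :=
      (integrable_const _).add ((integrable_badCount (hBm L) N).mul_const _)
    calc ∫ ω, -Real.log (factorWeight q N (pre ω N)) ∂ν
        ≤ ∫ ω, (N * (c + 2 * ε) + L * Real.log (2 * m)) +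
            (badCount (B L) N ω : ℝ) * Real.log (2 * m) ∂ν := by
          refine integral_mono (integrable_comp_pre (fun w => -Real.log (factorWeight q N w)) N)
            hintegrable fun ω => ?_
          have h1 := Real.log_le_log (by positivity) (hlow N ω)
          rw [Real.log_mul (Real.exp_pos _).ne' (by positivity), Real.log_exp, Real.log_pow, hb,
            Real.log_inv] at h1
          push_cast at h1
          simp only
          linarith
      _ = (N * (c + 2 * ε) + L * Real.log (2 * m)) + N * ν.real (B L)ᶜ * Real.log (2 * m) := by
          rw [integral_add (integrable_const _) ((integrable_badCount (hBm L) N).mul_const _),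
            integral_const, integral_mul_const, integral_badCount hν (hBm L)]
          simp
      _ ≤ (N * (c + 2 * ε) + L * Real.log (2 * m)) + N * δ * Real.log (2 * m) := by gcongr
      _ = _ := by ring
  have hlim : Tendsto (fun n : ℕ => c + 2 * ε + δ * Real.log (2 * m) +
      L * Real.log (2 * m) * (n : ℝ)⁻¹) atTop
      (nhds (c + 2 * ε + δ * Real.log (2 * m) + L * Real.log (2 * m) * 0)) :=
    (tendsto_inv_atTop_nhds_zero_nat.const_mul _).const_add _
  rw [mul_zero, add_zero] at hlim
  refine le_of_tendsto_of_tendsto hh hlim ?_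
  filter_upwards [eventually_gt_atTop 0] with n hn
  have hn' : (0 : ℝ) < n := Nat.cast_pos.2 hn
  calc (n : ℝ)⁻¹ * ∫ ω, -Real.log (wordMass ν (pre ω n)) ∂ν
      ≤ (n : ℝ)⁻¹ * (n * (c + 2 * ε) + (n * δ + L) * Real.log (2 * m)) := by
        gcongr; exact hbound n
    _ = _ := by field_simp; ring

theorem measure_eventually_wordMass_le_ne_zero (hm : 0 < m) (hν : MeasurePreserving shift ν ν)
    {h c : ℝ}
    (hh : Tendsto (fun n : ℕ => (n : ℝ)⁻¹ * ∫ ω, -Real.log (wordMass ν (pre ω n)) ∂ν) atTop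
      (nhds h)) (hc : 0 ≤ c) (hch : c < h) :
    ν {ω | ∀ᶠ n : ℕ in atTop, wordMass ν (pre ω n) ≤ Real.exp (-(n * c))} ≠ 0 := by
  intro h0
  have hfr : ∀ᵐ ω ∂ν, ∃ᶠ n : ℕ in atTop, Real.exp (-(n * c)) < wordMass ν (pre ω n) := by
    filter_upwards [measure_eq_zero_iff_ae_notMem.1 h0] with ω hω hcon
    exact hω (by simpa using hcon)
  have hm' : (1 : ℝ) ≤ m := Nat.one_le_cast.2 hm
  have hlog : 0 < Real.log (2 * m) := Real.log_pos (by linarith)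
  have h1 := entropy_le_of_ae_frequently hm hν hh hc hfr (ε := (h - c) / 8)
    (δ := (h - c) / 4 / Real.log (2 * m)) (by linarith) (by
      have : 0 < h - c := by linarith
      positivity)
  rw [div_mul_cancel₀ _ hlog.ne'] at h1
  linarith

end LocalEntropy

theorem dimHMeasure_map_le {Ω X : Type*} [MeasurableSpace Ω] [EMetricSpace X] [MeasurableSpace X]
    [BorelSpace X] {ν : Measure Ω} {f : Ω → X} (hf : Measurable f) {G : Set Ω} (hG : ν Gᶜ = 0)
    {s : ℝ} (hs : 0 ≤ s) (h : Measure.hausdorffMeasure s (f '' G) ≠ ∞) :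
    dimHMeasure (Measure.map f ν) ≤ ENNReal.ofReal s := by
  let T := toMeasurable (Measure.hausdorffMeasure s) (f '' G)
  have hT : MeasurableSet T := measurableSet_toMeasurable _ _
  have hsub : f '' G ⊆ T := subset_toMeasurable _ _
  have h1 : Measure.map f ν Tᶜ = 0 → dimHMeasure (Measure.map f ν) ≤ dimH T := fun h0 =>
    sInf_le ⟨T, h0, rfl⟩
  refine (h1 ?_).trans (dimH_le_of_hausdorffMeasure_ne_top (d := s.toNNReal) ?_)
  · rw [Measure.map_apply hf hT.compl]
    exact measure_mono_null (fun ω hω hωG => hω (hsub ⟨ω, hωG, rfl⟩)) hG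
  · rw [Real.coe_toNNReal _ hs, measure_toMeasurable]
    exact h

theorem hausdorffMeasure_limsup_ne_top {X : Type*} [EMetricSpace X] [MeasurableSpace X]
    [BorelSpace X] {ι : ℕ → Type*} [∀ n, Fintype (ι n)] (U : ∀ n, ι n → Set X)
    {s C c θ p : ℝ} (hs : 0 ≤ s) (hC : 0 ≤ C) (hc : 0 ≤ c) (hθ : 0 < θ) (hθ1 : θ < 1) (hp : 0 ≤ p)
    (hpθ : p * θ ^ s < 1) (hcard : ∀ n, (Fintype.card (ι n) : ℝ) ≤ C * p ^ n)
    (hdiam : ∀ n i, Metric.ediam (U n i) ≤ ENNReal.ofReal (c * θ ^ n)) :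
    Measure.hausdorffMeasure s {x | ∃ᶠ n in atTop, x ∈ ⋃ i, U n i} ≠ ∞ := by
  set a : ℕ → ℝ≥0∞ := fun n => ENNReal.ofReal (C * c ^ s * (p * θ ^ s) ^ n) with ha
  have hasum : ∑' n, a n ≠ ∞ := by
    have h1 : Summable fun n => C * c ^ s * (p * θ ^ s) ^ n :=
      (summable_geometric_of_lt_one (by positivity) hpθ).mul_left _
    rw [ha, ← ENNReal.ofReal_tsum_of_nonneg (fun n => by positivity) h1]
    exact ENNReal.ofReal_ne_top
  have hterm : ∀ n, ∑ i, Metric.ediam (U n i) ^ s ≤ a n := fun n => by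
    calc ∑ i, Metric.ediam (U n i) ^ s
        ≤ ∑ _i : ι n, ENNReal.ofReal (c * θ ^ n) ^ s :=
          Finset.sum_le_sum fun i _ => ENNReal.rpow_le_rpow (hdiam n i) hs
      _ = ENNReal.ofReal (Fintype.card (ι n)) * ENNReal.ofReal ((c * θ ^ n) ^ s) := by
          rw [Finset.sum_const, Finset.card_univ, nsmul_eq_mul, ENNReal.ofReal_natCast,
            ENNReal.ofReal_rpow_of_nonneg (by positivity) hs]
      _ ≤ ENNReal.ofReal (C * p ^ n) * ENNReal.ofReal ((c * θ ^ n) ^ s) := by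
          gcongr; exact hcard n
      _ = a n := by
          rw [← ENNReal.ofReal_mul (by positivity), ha]
          congr 1
          rw [Real.mul_rpow hc (by positivity), mul_pow, ← Real.rpow_natCast, ← Real.rpow_natCast,
            ← Real.rpow_natCast, ← Real.rpow_mul hθ.le, ← Real.rpow_mul hθ.le, mul_comm s]
          ring
  have hr : Tendsto (fun N : ℕ => ENNReal.ofReal (c * θ ^ N)) atTop (nhds 0) := by
    have := ENNReal.tendsto_ofReal ((tendsto_pow_atTop_nhds_zero_of_lt_one hθ.le hθ1).const_mul c)
    simpa using this
  refine ne_top_of_le_ne_top hasum ?_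
  refine (Measure.hausdorffMeasure_le_liminf_tsum (ι := fun N => Σ n, ι (n + N)) s _ _ hr
    (fun N i => U (i.1 + N) i.2) (Eventually.of_forall fun N i => (hdiam _ _).trans ?_)
    (Eventually.of_forall fun N x hx => ?_)).trans ?_
  · refine ENNReal.ofReal_le_ofReal (mul_le_mul_of_nonneg_left ?_ hc)
    exact pow_le_pow_of_le_one hθ.le hθ1.le (by omega)
  · obtain ⟨n, hn, hnN⟩ := (Frequently.and_eventually hx (eventually_ge_atTop N)).exists
    obtain ⟨i, hi⟩ := mem_iUnion.1 hn
    obtain ⟨k, rfl⟩ := Nat.exists_eq_add_of_le' hnN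
    exact mem_iUnion.2 ⟨⟨k, i⟩, hi⟩
  · refine liminf_le_of_le (by isBoundedDefault) fun b hb => ?_
    obtain ⟨N, hN⟩ := hb.exists
    refine hN.trans ?_
    rw [ENNReal.tsum_sigma']
    calc ∑' n, ∑' i, Metric.ediam (U (n + N) i) ^ s ≤ ∑' n, a (n + N) :=
          ENNReal.tsum_le_tsum fun n => by rw [tsum_fintype]; exact hterm _
      _ ≤ ∑' n, a n := ENNReal.tsum_comp_le_tsum_of_injective (add_left_injective N) a

theorem exists_grid {d : ℕ} (B : EuclideanSpace ℝ (Fin d) →L[ℝ] EuclideanSpace ℝ (Fin d))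
    {ρ β : ℝ} (hβ : 0 < β) : ∃ g : EuclideanSpace ℝ (Fin d) → Fin d → ℕ,
      (∀ x, ‖x‖ ≤ ρ → ∀ i : Fin d, g x i ≤ ⌊2 * ρ * (singVal B (i + 1) / β)⌋₊) ∧
      ∀ x y, ‖x‖ ≤ ρ → ‖y‖ ≤ ρ → g x = g y → ‖B x - B y‖ ≤ d * β := by
  obtain ⟨e, -, he⟩ := exists_basis_singVal B
  have habs : ∀ x i, ‖x‖ ≤ ρ → |inner ℝ (e i) x| ≤ ρ := fun x i hx => by
    have := abs_real_inner_le_norm (e i) x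
    rw [e.norm_eq_one, one_mul] at this
    exact this.trans hx
  have hα : ∀ i : Fin d, 0 ≤ singVal B (i + 1) / β := fun i => by
    rw [← (he i).1]; positivity
  refine ⟨fun x i => ⌊(inner ℝ (e i) x + ρ) * (singVal B (i + 1) / β)⌋₊, fun x hx i => ?_,
    fun x y hx hy hxy => ?_⟩
  · refine Nat.floor_le_floor (mul_le_mul_of_nonneg_right ?_ (hα i))
    have := (abs_le.1 (habs x i hx)).2
    linarith
  · have hexp : B x - B y = ∑ i, (inner ℝ (e i) x - inner ℝ (e i) y) • B (e i) := by
      rw [← map_sub]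
      conv_lhs => rw [← e.sum_repr' (x - y)]
      simp [map_sum, inner_sub_right]
    rw [hexp]
    refine (norm_sum_le _ _).trans ?_
    have : ∀ i ∈ Finset.univ, ‖(inner ℝ (e i) x - inner ℝ (e i) y) • B (e i)‖ ≤ β := fun i _ => by
      rw [norm_smul, (he i).1, Real.norm_eq_abs]
      have h0 : ∀ z, ‖z‖ ≤ ρ → 0 ≤ (inner ℝ (e i) z + ρ) * (singVal B (i + 1) / β) := fun z hz =>
        mul_nonneg (by have := (abs_le.1 (habs z i hz)).1; linarith) (hα i)
      have h1 := congrFun hxy i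
      simp only at h1
      have hx1 := Nat.floor_le (h0 x hx)
      have hx2 := Nat.lt_floor_add_one ((inner ℝ (e i) x + ρ) * (singVal B (i + 1) / β))
      have hy1 := Nat.floor_le (h0 y hy)
      have hy2 := Nat.lt_floor_add_one ((inner ℝ (e i) y + ρ) * (singVal B (i + 1) / β))
      rw [h1] at hx1 hx2
      have h2 : |inner ℝ (e i) x - inner ℝ (e i) y| * (singVal B (i + 1) / β) ≤ 1 := by
        rw [← abs_of_nonneg (hα i), ← abs_mul, abs_le]
        constructor <;> nlinarith
      rw [← mul_div_assoc, div_le_one hβ] at h2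
      exact h2
    refine (Finset.sum_le_card_nsmul _ _ _ this).trans (le_of_eq ?_)
    simp

theorem card_le_of_exp_le_wordMass {m : ℕ} {ν : Measure (ℕ → Fin m)} [IsProbabilityMeasure ν]
    (n : ℕ) (c : ℝ) (p : (Fin n → Fin m) → Prop) [DecidablePred p]
    (hp : ∀ w, p w → Real.exp (-(n * c)) ≤ wordMass ν (List.ofFn w)) :
    (Fintype.card {w // p w} : ℝ) ≤ Real.exp c ^ n := by
  have h1 : (Fintype.card {w // p w} : ℝ) * Real.exp (-(n * c)) ≤ 1 := by
    rw [← wordSum_wordMass (ν := ν) n, ← sum_ofFn_eq_wordSum, Fintype.card_subtype,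
      ← nsmul_eq_mul]
    refine (Finset.card_nsmul_le_sum _ (fun w => wordMass ν (List.ofFn w)) _ fun w hw =>
      hp w (Finset.mem_filter.1 hw).2).trans ?_
    exact Finset.sum_le_sum_of_subset_of_nonneg (Finset.subset_univ _) fun w _ _ =>
      wordMass_nonneg _
  rwa [Real.exp_neg, ← div_eq_mul_inv, div_le_one (Real.exp_pos _), mul_comm, Real.exp_mul,
    Real.rpow_natCast] at h1

theorem prod_floor_le {d k : ℕ} {x : Fin d → ℝ} (hx : Antitone x) (hk : k < d) {ρ : ℝ} (hρ : 0 ≤ ρ)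
    (n : ℕ) : ((∏ i : Fin d, (⌊2 * ρ * Real.exp (n * (x i - x ⟨k, hk⟩))⌋₊ + 1) : ℕ) : ℝ) ≤
      (2 * ρ + 1) ^ d * Real.exp (∑ i : Fin d, if (i : ℕ) < k then x i - x ⟨k, hk⟩ else 0) ^ n := by
  rw [← Real.exp_nat_mul, Finset.mul_sum, Real.exp_sum]
  have h1 : (2 * ρ + 1) ^ d = ∏ _i : Fin d, (2 * ρ + 1) := by simp
  rw [h1, ← Finset.prod_mul_distrib]
  push_cast
  refine Finset.prod_le_prod (fun i _ => by positivity) fun i _ => ?_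
  have h2 : (⌊2 * ρ * Real.exp (n * (x i - x ⟨k, hk⟩))⌋₊ : ℝ) ≤
      2 * ρ * Real.exp (n * (x i - x ⟨k, hk⟩)) := Nat.floor_le (by positivity)
  refine (add_le_add_left h2 1).trans ?_
  split_ifs with hik
  · have h3 : 1 ≤ Real.exp (n * (x i - x ⟨k, hk⟩)) := by
      refine Real.one_le_exp (mul_nonneg (by positivity) (sub_nonneg.2 (hx ?_)))
      exact hik.le
    linarith
  · have h3 : Real.exp (n * (x i - x ⟨k, hk⟩)) ≤ 1 := by
      refine Real.exp_le_one_iff.2 (mul_nonpos_of_nonneg_of_nonpos (by positivity)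
        (sub_nonpos.2 (hx ?_)))
      exact not_lt.1 hik
    rw [mul_zero, Real.exp_zero, mul_one]
    have := mul_le_mul_of_nonneg_left h3 (show 0 ≤ 2 * ρ by positivity)
    linarith

theorem dimHMeasure_map_proj_le {d m : ℕ}
    {A : Fin m → (EuclideanSpace ℝ (Fin d) →L[ℝ] EuclideanSpace ℝ (Fin d))}
    {proj : (Fin m → EuclideanSpace ℝ (Fin d)) → (ℕ → Fin m) → EuclideanSpace ℝ (Fin d)}
    (hA : ∀ i, ‖A i‖ ≤ 1 / 2) (hinj : ∀ i, Function.Injective (A i))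
    (hproj : ∀ t ω, Tendsto (fun n => affWord A t (pre ω n) 0) atTop (nhds (proj t ω)))
    {ν : Measure (ℕ → Fin m)} [IsProbabilityMeasure ν] (hν : Ergodic shift ν) {x : Fin d → ℝ}
    (hx : Antitone x) (hχ : ∀ i : Fin d, ∀ᵐ ω ∂ν, Tendsto (fun n : ℕ => (n : ℝ)⁻¹ *
      Real.log (singVal (wordProd A (pre ω n)) (i + 1))) atTop (nhds (x i))) {h : ℝ}
    (hh : Tendsto (fun n : ℕ => (n : ℝ)⁻¹ * ∫ ω, -Real.log (wordMass ν (pre ω n)) ∂ν) atTop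
      (nhds h)) {k : ℕ} (hk : k < d) (hxk : x ⟨k, hk⟩ < 0) {s : ℝ} (hs : 0 ≤ s)
    (hneg : h + ∑ i : Fin d, (if (i : ℕ) < k then x i - x ⟨k, hk⟩ else 0) + s * x ⟨k, hk⟩ < 0)
    (t : Fin m → EuclideanSpace ℝ (Fin d)) :
    dimHMeasure (Measure.map (proj t) ν) ≤ ENNReal.ofReal s := by
  classical
  set y := x ⟨k, hk⟩ with hy
  set σ := ∑ i : Fin d, (if (i : ℕ) < k then x i - y else 0) with hσ
  obtain ⟨ε, hε, hε1, hε2⟩ : ∃ ε > 0, y + ε < 0 ∧ h + ε + σ + s * (y + ε) < 0 := by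
    refine ⟨min (-y / 2) (-(h + σ + s * y) / (2 * (1 + s))), lt_min (by linarith)
      (div_pos (by linarith) (by linarith)), ?_, ?_⟩
    · have := min_le_left (-y / 2) (-(h + σ + s * y) / (2 * (1 + s)))
      linarith
    · have := min_le_right (-y / 2) (-(h + σ + s * y) / (2 * (1 + s)))
      rw [le_div_iff₀ (by linarith)] at this
      nlinarith
  obtain ⟨R, hR0, hR⟩ : ∃ R : ℝ, 0 ≤ R ∧ ∀ i, ‖t i‖ ≤ R := ⟨‖t‖, norm_nonneg _, norm_le_pi_norm t⟩
  have hnorm := norm_proj_le hA le_rfl hproj hR0 hR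
  set β : ℕ → ℝ := fun n => Real.exp (y + ε) ^ n with hβ
  have hβ0 : ∀ n, 0 < β n := fun n => by positivity
  choose g hg1 hg2 using fun (w : List (Fin m)) =>
    exists_grid (wordProd A w) (ρ := 2 * R) (hβ0 w.length)
  let Good : List (Fin m) → Prop := fun w => Real.exp (-(w.length * (h + ε))) ≤ wordMass ν w ∧
    ∀ i : Fin d, singVal (wordProd A w) (i + 1) ≤ Real.exp (w.length * (x i + ε))
  let M : ℕ → Fin d → ℕ := fun n i => ⌊2 * (2 * R) * Real.exp (n * (x i - y))⌋₊
  let ι : ℕ → Type := fun n => {w : Fin n → Fin m // Good (List.ofFn w)} × (∀ i, Fin (M n i + 1))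
  let U : ∀ n, ι n → Set (EuclideanSpace ℝ (Fin d)) := fun n j =>
    {z | ∃ ω, pre ω n = List.ofFn j.1.1 ∧
    (∀ i, g (pre ω n) (proj t (shift^[n] ω)) i = j.2 i) ∧ proj t ω = z}
  have hgood : ∀ᵐ ω ∂ν, ∃ᶠ n in atTop, Good (pre ω n) := by
    filter_upwards [ae_frequently_exp_lt_wordMass hν hh (show h < h + ε by linarith),
      ae_all_iff.2 hχ] with ω hω1 hω2
    have hev : ∀ᶠ n : ℕ in atTop, ∀ i : Fin d, (n : ℝ)⁻¹ *
        Real.log (singVal (wordProd A (pre ω n)) (i + 1)) < x i + ε :=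
      eventually_all.2 fun i => (hω2 i).eventually (gt_mem_nhds (by linarith))
    refine (hω1.and_eventually (hev.and (eventually_gt_atTop 0))).mono ?_
    rintro n ⟨h1, h2, hn⟩
    have hn' : (0 : ℝ) < n := Nat.cast_pos.2 hn
    refine ⟨by rw [length_pre]; exact h1.le, fun i => ?_⟩
    rw [length_pre, ← Real.log_le_iff_le_exp (singVal_pos _ (wordProd_injective hinj _) i)]
    have := h2 i
    rw [inv_mul_lt_iff₀ hn'] at this
    exact this.le
  let G : Set (ℕ → Fin m) := {ω | ∃ᶠ n in atTop, Good (pre ω n)}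
  have hptm : Measurable (proj t) :=
    (measurable_proj_uncurry hproj).comp (measurable_const.prodMk measurable_id)
  refine dimHMeasure_map_le hptm (G := G) hgood hs ?_
  have hlim := hausdorffMeasure_limsup_ne_top (ι := ι) U hs (C := (2 * (2 * R) + 1) ^ d) (c := d)
    (θ := Real.exp (y + ε)) (p := Real.exp (h + ε) * Real.exp σ) (by positivity) (by positivity)
    (Real.exp_pos _) (Real.exp_lt_one_iff.2 hε1) (by positivity) ?_ ?_ ?_
  · refine ne_top_of_le_ne_top hlim (measure_mono ?_)
    rintro _ ⟨ω, hω, rfl⟩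
    refine Frequently.mono hω fun n hn => ?_
    have hj : ∀ i, g (pre ω n) (proj t (shift^[n] ω)) i < M n i + 1 := fun i => by
      refine Nat.lt_succ_of_le ((hg1 (pre ω n) _ (hnorm _) i).trans (Nat.floor_le_floor ?_))
      refine mul_le_mul_of_nonneg_left ?_ (by positivity)
      rw [div_le_iff₀ (hβ0 _)]
      refine (hn.2 i).trans (le_of_eq ?_)
      rw [hβ, length_pre]
      simp only
      rw [← Real.exp_nat_mul, ← Real.exp_add]
      congr 1; ring
    exact mem_iUnion.2 ⟨⟨⟨fun j => ω j, hn⟩, fun i => ⟨_, hj i⟩⟩, ω, rfl, fun i => rfl, rfl⟩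
  · rw [← Real.exp_mul, ← Real.exp_add, ← Real.exp_add]
    exact Real.exp_lt_one_iff.2 (by linarith)
  · intro n
    rw [Fintype.card_prod, Fintype.card_pi]
    simp only [Fintype.card_fin]
    rw [Nat.cast_mul, mul_pow, mul_left_comm]
    refine mul_le_mul (card_le_of_exp_le_wordMass (ν := ν) n (h + ε) _ fun w hw => ?_)
      (prod_floor_le hx hk (by positivity) n) (by positivity) (by positivity)
    simpa using hw.1
  · rintro n ⟨w, j⟩
    refine Metric.ediam_le ?_
    rintro _ ⟨ω, hω1, hω2, rfl⟩ _ ⟨τ, hτ1, hτ2, rfl⟩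
    have hωτ : pre ω n = pre τ n := hω1.trans hτ1.symm
    rw [edist_dist]
    refine ENNReal.ofReal_le_ofReal ?_
    rw [dist_eq_norm, proj_sub_eq hproj t ω τ n ((pre_eq_pre_iff _ _ _).1 hωτ), map_sub]
    have h1 := hg2 (pre ω n) _ _ (hnorm (shift^[n] ω)) (hnorm (shift^[n] τ)) (by
      funext i
      rw [hω2 i, hωτ, hτ2 i])
    rwa [length_pre] at h1

section LowerBound

variable {d m : ℕ} {A : Fin m → (EuclideanSpace ℝ (Fin d) →L[ℝ] EuclideanSpace ℝ (Fin d))}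
  {ν : Measure (ℕ → Fin m)} {x : Fin d → ℝ}

theorem ae_tendsto_log_prod_singVal_rpow (hinj : ∀ i, Function.Injective (A i))
    (hχ : ∀ i : Fin d, ∀ᵐ ω ∂ν, Tendsto (fun n : ℕ => (n : ℝ)⁻¹ *
      Real.log (singVal (wordProd A (pre ω n)) (i + 1))) atTop (nhds (x i))) (a : Fin d → ℝ) :
    ∀ᵐ ω ∂ν, Tendsto (fun n : ℕ => (n : ℝ)⁻¹ *
      Real.log (∏ i : Fin d, singVal (wordProd A (pre ω n)) (i + 1) ^ (-a i))) atTop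
      (nhds (-∑ i, a i * x i)) := by
  filter_upwards [ae_all_iff.2 hχ] with ω hω
  have h1 := (tendsto_finsetSum Finset.univ fun i _ => (hω i).const_mul (a i)).neg
  refine h1.congr fun n => ?_
  have hpos := singVal_pos _ (wordProd_injective hinj (pre ω n))
  rw [Real.log_prod fun i _ => (Real.rpow_pos_of_pos (hpos i) _).ne', Finset.mul_sum,
    ← Finset.sum_neg_distrib]
  refine Finset.sum_congr rfl fun i _ => ?_
  rw [Real.log_rpow (hpos i)]
  ring

variable [IsProbabilityMeasure ν]

theorem antitone_of_tendsto_log_singVal (hinj : ∀ i, Function.Injective (A i))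
    (hχ : ∀ i : Fin d, ∀ᵐ ω ∂ν, Tendsto (fun n : ℕ => (n : ℝ)⁻¹ *
      Real.log (singVal (wordProd A (pre ω n)) (i + 1))) atTop (nhds (x i))) : Antitone x := by
  intro i j hij
  obtain ⟨ω, hω⟩ := (ae_all_iff.2 hχ).exists
  refine le_of_tendsto_of_tendsto' (hω j) (hω i) fun n => ?_
  obtain ⟨e, he, -⟩ := exists_basis_singVal (wordProd A (pre ω n))
  have := singVal_pos _ (wordProd_injective hinj (pre ω n)) j
  gcongr
  exact he hij

theorem neg_of_tendsto_log_singVal (hA : ∀ i, ‖A i‖ ≤ 1 / 2)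
    (hinj : ∀ i, Function.Injective (A i))
    (hχ : ∀ i : Fin d, ∀ᵐ ω ∂ν, Tendsto (fun n : ℕ => (n : ℝ)⁻¹ *
      Real.log (singVal (wordProd A (pre ω n)) (i + 1))) atTop (nhds (x i))) (i : Fin d) :
    x i < 0 := by
  obtain ⟨ω, hω⟩ := (hχ i).exists
  have hlog : Real.log (1 / 2) < 0 := Real.log_neg (by norm_num) (by norm_num)
  refine (le_of_tendsto hω ((eventually_gt_atTop 0).mono fun n hn => ?_)).trans_lt hlog
  have hpos := singVal_pos _ (wordProd_injective hinj (pre ω n)) i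
  have h1 := Real.log_le_log hpos ((singVal_le_norm _ (by omega)).trans
    (norm_wordProd_le hA ω n))
  rw [Real.log_pow] at h1
  have hn' : (0 : ℝ) < n := Nat.cast_pos.2 hn
  rw [inv_mul_le_iff₀ hn']
  exact h1

theorem exists_measure_forall_mul_wordMass_le_ne_zero (hm : 0 < m)
    (hν : MeasurePreserving shift ν ν) {h y : ℝ}
    (hh : Tendsto (fun n : ℕ => (n : ℝ)⁻¹ * ∫ ω, -Real.log (wordMass ν (pre ω n)) ∂ν) atTop
      (nhds h)) {M : List (Fin m) → ℝ} (hM : ∀ w, 0 < M w)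
    (hlim : ∀ᵐ ω ∂ν, Tendsto (fun n : ℕ => (n : ℝ)⁻¹ * Real.log (M (pre ω n))) atTop (nhds y))
    (hy : 0 ≤ y) (hyh : y < h) :
    ∃ δ > 0, ∃ K : ℝ, ν {ω | ∀ n : ℕ, (M (pre ω n) + 1) * wordMass ν (pre ω n) ≤
      K * Real.exp (-(n * δ))} ≠ 0 := by
  obtain ⟨δ, hδ, hδy⟩ : ∃ δ > 0, y + 2 * δ < h := ⟨(h - y) / 4, by linarith, by linarith⟩
  refine ⟨δ, hδ, ?_⟩
  by_contra! hcon
  refine measure_eventually_wordMass_le_ne_zero hm hν hh (c := y + 2 * δ) (by linarith) hδy ?_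
  have h0 : ∀ᵐ ω ∂ν, ∀ K : ℕ, ¬ ∀ n : ℕ, (M (pre ω n) + 1) * wordMass ν (pre ω n) ≤
      K * Real.exp (-(n * δ)) :=
    ae_all_iff.2 fun K => measure_eq_zero_iff_ae_notMem.1 (hcon K)
  rw [measure_eq_zero_iff_ae_notMem]
  filter_upwards [h0, hlim] with ω hω hωlim hev
  have h1 : ∀ᶠ n : ℕ in atTop, (M (pre ω n) + 1) * wordMass ν (pre ω n) * Real.exp (n * δ) ≤ 2 := by
    filter_upwards [hev, hωlim.eventually_lt_const (show y < y + δ by linarith),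
      eventually_gt_atTop 0] with n hn1 hn2 hn
    have hn' : (0 : ℝ) < n := Nat.cast_pos.2 hn
    rw [inv_mul_lt_iff₀ hn', Real.log_lt_iff_lt_exp (hM _)] at hn2
    have h2 : (1 : ℝ) ≤ Real.exp (n * (y + δ)) := Real.one_le_exp (by positivity)
    calc _ ≤ (Real.exp (n * (y + δ)) + Real.exp (n * (y + δ))) * Real.exp (-(n * (y + 2 * δ))) *
        Real.exp (n * δ) := by
          have := wordMass_nonneg (ν := ν) (pre ω n)
          gcongr
      _ = 2 * Real.exp (n * (y + δ) + -(n * (y + 2 * δ)) + n * δ) := by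
          rw [Real.exp_add, Real.exp_add]; ring
      _ = 2 := by
          rw [show (n : ℝ) * (y + δ) + -(n * (y + 2 * δ)) + n * δ = 0 by ring]; simp
  obtain ⟨K, hK⟩ := (isBoundedUnder_of_eventually_le h1).bddAbove_range
  obtain ⟨N, hN⟩ := exists_nat_ge K
  refine hω N fun n => ?_
  rw [Real.exp_neg, ← div_eq_mul_inv, le_div_iff₀ (Real.exp_pos _)]
  exact (hK ⟨n, rfl⟩).trans hN

theorem ae_ofReal_sum_le_dimHMeasure (hm : 0 < m) {r : ℝ} (hA : ∀ i, ‖A i‖ ≤ r) (hr0 : 0 ≤ r)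
    (hr : r < 1 / 2) (hinj : ∀ i, Function.Injective (A i))
    {proj : (Fin m → EuclideanSpace ℝ (Fin d)) → (ℕ → Fin m) → EuclideanSpace ℝ (Fin d)}
    (hproj : ∀ t ω, Tendsto (fun n => affWord A t (pre ω n) 0) atTop (nhds (proj t ω)))
    (hν : MeasurePreserving shift ν ν)
    (hχ : ∀ i : Fin d, ∀ᵐ ω ∂ν, Tendsto (fun n : ℕ => (n : ℝ)⁻¹ *
      Real.log (singVal (wordProd A (pre ω n)) (i + 1))) atTop (nhds (x i))) {h : ℝ}
    (hh : Tendsto (fun n : ℕ => (n : ℝ)⁻¹ * ∫ ω, -Real.log (wordMass ν (pre ω n)) ∂ν) atTop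
      (nhds h)) (a : Fin d → ℝ) (ha0 : ∀ i, 0 < a i) (ha1 : ∀ i, a i < 1)
    (hpos : 0 < h + ∑ i, a i * x i) :
    ∀ᵐ t ∂(volume : Measure (Fin m → EuclideanSpace ℝ (Fin d))),
      ENNReal.ofReal (∑ i, a i) ≤ dimHMeasure (Measure.map (proj t) ν) := by
  rcases (Finset.sum_nonneg fun i _ => (ha0 i).le : 0 ≤ ∑ i, a i).eq_or_lt with hs | hs
  · simp [← hs]
  have hx := neg_of_tendsto_log_singVal (fun i => (hA i).trans hr.le) hinj hχ
  obtain ⟨M, hM⟩ : ∃ M : List (Fin m) → ℝ, ∀ w, M w =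
    ∏ i : Fin d, singVal (wordProd A w) (i + 1) ^ (-a i) := ⟨_, fun _ => rfl⟩
  have hM0 : ∀ w, 0 < M w := fun w => by
    rw [hM]
    exact Finset.prod_pos fun i _ => Real.rpow_pos_of_pos
      (singVal_pos _ (wordProd_injective hinj w) i) _
  have hlim := ae_tendsto_log_prod_singVal_rpow hinj hχ a
  simp_rw [← hM] at hlim
  obtain ⟨δ, hδ, K, hK⟩ := exists_measure_forall_mul_wordMass_le_ne_zero hm hν hh hM0 hlim
    (neg_nonneg.2 (Finset.sum_nonpos fun i _ =>
      mul_nonpos_of_nonneg_of_nonpos (ha0 i).le (hx i).le))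
    (by linarith)
  set E := {ω : ℕ → Fin m | ∀ n : ℕ, (M (pre ω n) + 1) * wordMass ν (pre ω n) ≤
      K * Real.exp (-(n * δ))} with hE
  have hEm : MeasurableSet E := by
    rw [hE, Set.ofPred_forall]
    exact MeasurableSet.iInter fun n => measurableSet_le
      (measurable_comp_pre (fun w => (M w + 1) * wordMass ν w) n) measurable_const
  have hsum : Summable fun n : ℕ => K * Real.exp (-(n * δ)) := by
    have h1 : Summable fun n : ℕ => Real.exp (-δ) ^ n :=
      summable_geometric_of_lt_one (Real.exp_pos _).le (by rwa [Real.exp_lt_one_iff, neg_lt_zero])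
    refine (h1.congr fun n => ?_).mul_left K
    rw [← Real.exp_nat_mul]
    congr 1; ring
  have hR : ∀ R : ℕ, ∀ᵐ t ∂volume.restrict (univ.pi fun _ : Fin m =>
      Metric.closedBall (0 : EuclideanSpace ℝ (Fin d)) R),
      ENNReal.ofReal (∑ i, a i) ≤ dimHMeasure (Measure.map (proj t) ν) := by
    intro R
    obtain ⟨C, hC, hCle⟩ := exists_lintegral_proj_rpow_le hA hr0 hr hinj hproj
      (Nat.cast_nonneg R) a ha0 ha1
    refine ae_ofReal_le_dimHMeasure_map (measurable_proj_uncurry hproj) ν hEm hK hs fun ω hω => ?_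
    have hω' : ∀ n : ℕ, (M (pre ω n) + 1) * wordMass ν (pre ω n) ≤ K * Real.exp (-(n * δ)) := hω
    have hmass : ∀ n : ℕ, ν.real {τ | pre τ n = pre ω n} ≤ K * Real.exp (-(n * δ)) := fun n => by
      rw [← wordMass_pre]
      have := mul_nonneg (hM0 (pre ω n)).le (wordMass_nonneg (ν := ν) (pre ω n))
      linarith [hω' n]
    have hatom : ν {ω} = 0 := by
      have h1 : ν.real {ω} ≤ 0 := ge_of_tendsto' hsum.tendsto_atTop_zero fun n =>
        (measureReal_mono (by rintro τ rfl; rfl)).trans (hmass n)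
      exact (measureReal_eq_zero_iff).1 (h1.antisymm measureReal_nonneg)
    have hle : ∀ᵐ τ ∂ν, ∫⁻ t in univ.pi fun _ : Fin m =>
        Metric.closedBall (0 : EuclideanSpace ℝ (Fin d)) R, ‖proj t ω - proj t τ‖ₑ ^ (-∑ i, a i) ≤
        ∑' n : ℕ, {τ | pre τ n = pre ω n}.indicator
          (fun _ => C * ENNReal.ofReal (M (pre ω n))) τ := by
      filter_upwards [measure_eq_zero_iff_ae_notMem.1 hatom] with τ hτ
      have hex : ∃ n, ω n ≠ τ n := by
        by_contra! hcon
        exact hτ (funext fun n => (hcon n).symm)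
      classical
      have hlt : ∀ k < Nat.find hex, ω k = τ k := fun k hk => not_not.1 (Nat.find_min hex hk)
      refine (hCle ω τ _ hlt (Nat.find_spec hex)).trans ?_
      refine le_trans ?_ (ENNReal.le_tsum (Nat.find hex))
      have hmem : τ ∈ {τ | pre τ (Nat.find hex) = pre ω (Nat.find hex)} :=
        (pre_eq_pre_iff _ _ _).2 fun k hk => (hlt k hk).symm
      rw [Set.indicator_of_mem hmem, hM,
        ENNReal.ofReal_prod_of_nonneg fun i _ => (Real.rpow_pos_of_pos
          (singVal_pos _ (wordProd_injective hinj _) i) _).le]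
    refine ((lintegral_mono_ae hle).trans_lt ?_).ne
    rw [lintegral_tsum fun n => (measurable_const.indicator
      (measurableSet_pre_eq (pre ω n) n)).aemeasurable]
    calc _ ≤ ∑' n : ℕ, C * ENNReal.ofReal (K * Real.exp (-(n * δ))) := by
          refine ENNReal.tsum_le_tsum fun n => ?_
          rw [lintegral_indicator_const (measurableSet_pre_eq (pre ω n) n), mul_assoc]
          gcongr
          rw [← ofReal_measureReal, ← ENNReal.ofReal_mul (hM0 _).le, ← wordMass_pre]
          refine ENNReal.ofReal_le_ofReal (le_trans ?_ (hω' n))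
          linarith [wordMass_nonneg (ν := ν) (pre ω n)]
      _ < ∞ := by
          rw [ENNReal.tsum_mul_left]
          exact ENNReal.mul_lt_top hC hsum.tsum_ofReal_lt_top
  have hcover : (⋃ R : ℕ, univ.pi fun _ : Fin m =>
      Metric.closedBall (0 : EuclideanSpace ℝ (Fin d)) R) = univ := by
    refine eq_univ_of_forall fun t => ?_
    obtain ⟨R, hRt⟩ := exists_nat_ge ‖t‖
    exact mem_iUnion.2 ⟨R, fun i _ => mem_closedBall_zero_iff.2 ((norm_le_pi_norm t i).trans hRt)⟩
  rw [← Measure.restrict_univ (μ := volume), ← hcover, ae_restrict_iUnion_iff]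
  exact hR

end LowerBound

theorem sum_fin_ite_lt {d k : ℕ} (hk : k ≤ d) (g : ℕ → ℝ) :
    (∑ i : Fin d, if (i : ℕ) < k then g i else 0) = ∑ i ∈ Finset.range k, g i := by
  rw [Fin.sum_univ_eq_sum_range (fun i => if i < k then g i else 0), ← Finset.sum_filter]
  congr 1
  ext i
  simp only [Finset.mem_filter, Finset.mem_range]
  omega

theorem sum_Icc_one_eq_sum_range (g : ℕ → ℝ) (k : ℕ) :
    ∑ i ∈ Finset.Icc 1 k, g i = ∑ i ∈ Finset.range k, g (i + 1) := by
  induction k with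
  | zero => simp
  | succ k ih => rw [Finset.sum_Icc_succ_top (by omega), ih, Finset.sum_range_succ]

theorem exists_pos_lt_one_of_nonneg_le_one {d : ℕ} {x b : Fin d → ℝ} {h c : ℝ}
    (hb0 : ∀ i, 0 ≤ b i) (hb1 : ∀ i, b i ≤ 1) (hpos : 0 < h + ∑ i, b i * x i)
    (hc : c < ∑ i, b i) :
    ∃ a : Fin d → ℝ, (∀ i, 0 < a i) ∧ (∀ i, a i < 1) ∧ 0 < h + ∑ i, a i * x i ∧ c ≤ ∑ i, a i := by
  have h1 : Tendsto (fun η : ℝ => h + ∑ i, ((1 - η) * b i + η / 2) * x i) (nhdsWithin 0 (Ioi 0))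
      (nhds (h + ∑ i, ((1 - 0) * b i + 0 / 2) * x i)) :=
    (Continuous.tendsto (by fun_prop) 0).mono_left nhdsWithin_le_nhds
  have h2 : Tendsto (fun η : ℝ => ∑ i, ((1 - η) * b i + η / 2)) (nhdsWithin 0 (Ioi 0))
      (nhds (∑ i, ((1 - 0) * b i + 0 / 2))) :=
    (Continuous.tendsto (by fun_prop) 0).mono_left nhdsWithin_le_nhds
  have h3 : ∀ᶠ η : ℝ in nhdsWithin 0 (Ioi 0), η < 1 :=
    nhdsWithin_le_nhds (eventually_lt_nhds one_pos)
  obtain ⟨η, hη1, hη2, hη3, hη0⟩ := ((h1.eventually_const_lt (by simpa using hpos)).and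
    ((h2.eventually_const_lt (by simpa using hc)).and
      (h3.and self_mem_nhdsWithin))).exists
  have hη0 : 0 < η := hη0
  refine ⟨fun i => (1 - η) * b i + η / 2, fun i => ?_, fun i => ?_, hη1, hη2.le⟩
  · have := mul_nonneg (sub_nonneg.2 hη3.le) (hb0 i)
    dsimp only
    linarith
  · have := mul_le_mul_of_nonneg_left (hb1 i) (sub_nonneg.2 hη3.le)
    dsimp only
    linarith

theorem dimHMeasure_le_natCast {d : ℕ} (μ : Measure (EuclideanSpace ℝ (Fin d))) :
    dimHMeasure μ ≤ d := by
  refine sInf_le ⟨univ, by simp, ?_⟩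
  rw [Real.dimH_univ_eq_finrank, finrank_euclideanSpace_fin]

theorem stmt12 {d m : ℕ} (hd : 1 ≤ d) (hm : 2 ≤ m)
    (A : Fin m → (EuclideanSpace ℝ (Fin d) →L[ℝ] EuclideanSpace ℝ (Fin d)))
    (hinv : ∀ i, Function.Bijective (A i))
    (hnorm : ∀ i, ‖A i‖ < 1 / 2)
    -- an ergodic shift-invariant measure on the full shift
    (ν : Measure (ℕ → Fin m)) [IsProbabilityMeasure ν]
    (herg : Ergodic (fun ω n => ω (n + 1)) ν)
    -- the Lyapunov exponents of ν
    (χ : ℕ → ℝ)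
    (hχ : ∀ k : ℕ, 1 ≤ k → k ≤ d → ∀ᵐ ω ∂ν,
      Tendsto (fun n : ℕ => (n : ℝ)⁻¹ *
          Real.log (singVal (wordProd A (List.ofFn fun j : Fin n => ω j)) k))
        atTop (nhds (χ k)))
    -- the entropy of ν
    (h : ℝ)
    (hh : Tendsto (fun n : ℕ => -(n : ℝ)⁻¹ * ∑ w : Fin n → Fin m,
        ((ν {ω | ∀ j : Fin n, ω j = w j}).toReal *
          Real.log (ν {ω | ∀ j : Fin n, ω j = w j}).toReal))
      atTop (nhds h))
    -- the Lyapunov dimension D(ν)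
    (D : ℝ)
    (hD : (∃ k : ℕ, k < d ∧ (0 < h + ∑ i ∈ Finset.Icc 1 k, χ i) ∧
            ¬(0 < h + ∑ i ∈ Finset.Icc 1 (k + 1), χ i) ∧
            D = k + (h + ∑ i ∈ Finset.Icc 1 k, χ i) / (-χ (k + 1))) ∨
          ((0 < h + ∑ i ∈ Finset.Icc 1 d, χ i) ∧
            D = d * h / (-(∑ i ∈ Finset.Icc 1 d, χ i))))
    -- the natural projections Π^t
    (proj : (Fin m → EuclideanSpace ℝ (Fin d)) → (ℕ → Fin m) → EuclideanSpace ℝ (Fin d))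
    (hproj : ∀ t ω, Tendsto (fun n : ℕ => affWord A t (List.ofFn fun k : Fin n => ω k) 0)
      atTop (nhds (proj t ω))) :
    ∀ᵐ t ∂(volume : Measure (Fin m → EuclideanSpace ℝ (Fin d))),
      dimHMeasure (Measure.map (proj t) ν) = ENNReal.ofReal (min (d : ℝ) D) := by
  have hproj' : ∀ t ω, Tendsto (fun n => affWord A t (pre ω n) 0) atTop (nhds (proj t ω)) := hproj
  have herg' : Ergodic shift ν := herg
  have hinj : ∀ i, Function.Injective (A i) := fun i => (hinv i).1
  have hχ' : ∀ i : Fin d, ∀ᵐ ω ∂ν, Tendsto (fun n : ℕ => (n : ℝ)⁻¹ *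
      Real.log (singVal (wordProd A (pre ω n)) (i + 1))) atTop (nhds (χ (i + 1))) :=
    fun i => hχ (i + 1) (by omega) (by omega)
  have hh' : Tendsto (fun n : ℕ => (n : ℝ)⁻¹ * ∫ ω, -Real.log (wordMass ν (pre ω n)) ∂ν) atTop
      (nhds h) := by
    refine hh.congr fun n => ?_
    rw [integral_neg_log_wordMass]
    ring
  have hanti := antitone_of_tendsto_log_singVal (x := fun i : Fin d => χ (i + 1)) hinj hχ'
  have hneg := neg_of_tendsto_log_singVal (x := fun i : Fin d => χ (i + 1))
    (fun i => (hnorm i).le) hinj hχ'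
  obtain ⟨r, hr0, hr, hA⟩ : ∃ r : ℝ, 0 ≤ r ∧ r < 1 / 2 ∧ ∀ i, ‖A i‖ ≤ r := by
    have : Nonempty (Fin m) := ⟨⟨0, by omega⟩⟩
    obtain ⟨i, hi⟩ := Finite.exists_max fun i => ‖A i‖
    exact ⟨‖A i‖, norm_nonneg _, hnorm i, hi⟩
  simp_rw [sum_Icc_one_eq_sum_range] at hD
  have hlow : ∀ c < min (d : ℝ) D, ∃ b : Fin d → ℝ, (∀ i, 0 ≤ b i) ∧ (∀ i, b i ≤ 1) ∧
      0 < h + ∑ i, b i * χ (i + 1) ∧ c < ∑ i, b i := by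
    intro c hc
    obtain ⟨hcd, hcD⟩ := lt_min_iff.1 hc
    rcases hD with ⟨k, hk, hpos, hnpos, rfl⟩ | ⟨hpos, -⟩
    · have hk0 : χ (k + 1) < 0 := hneg ⟨k, hk⟩
      rw [Finset.sum_range_succ] at hnpos
      obtain ⟨θ, hθ1, hθ2⟩ := exists_between (show max 0 (c - k) <
        (h + ∑ i ∈ Finset.range k, χ (i + 1)) / (-χ (k + 1)) from
        max_lt (div_pos hpos (by linarith)) (by linarith))
      obtain ⟨hθ0, hθc⟩ := max_lt_iff.1 hθ1
      rw [lt_div_iff₀ (by linarith)] at hθ2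
      have hθ3 : θ ≤ 1 := by
        by_contra! hcon
        nlinarith
      have hsum : ∀ g : ℕ → ℝ, ∑ i : Fin d, (if (i : ℕ) < k then 1 else
          if (i : ℕ) = k then θ else 0) * g i = ∑ i ∈ Finset.range k, g i + θ * g k := fun g => by
        rw [← sum_fin_ite_lt hk.le, ← sub_eq_iff_eq_add', ← Finset.sum_sub_distrib,
          Finset.sum_eq_single (⟨k, hk⟩ : Fin d)]
        · simp
        · intro i _ hi
          have hi' : (i : ℕ) ≠ k := fun h => hi (Fin.ext h)
          by_cases hik : (i : ℕ) < k <;> simp [hik, hi']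
        · simp
      refine ⟨fun i => if (i : ℕ) < k then 1 else if (i : ℕ) = k then θ else 0, fun i => ?_,
        fun i => ?_, ?_, ?_⟩
      · dsimp only
        split_ifs <;> linarith
      · dsimp only
        split_ifs <;> linarith
      · rw [hsum fun i => χ (i + 1)]
        linarith
      · have h1 := hsum fun _ => 1
        simp only [mul_one, Finset.sum_const, Finset.card_range, nsmul_eq_mul] at h1
        rw [h1]
        linarith
    · refine ⟨fun _ => 1, fun _ => zero_le_one, fun _ => le_rfl, ?_, by simpa using hcd⟩
      simpa [Fin.sum_univ_eq_sum_range fun i => χ (i + 1)] using hpos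
  have hup : ∀ t, dimHMeasure (Measure.map (proj t) ν) ≤ ENNReal.ofReal (min (d : ℝ) D) := by
    intro t
    rcases hD with ⟨k, hk, hpos, hnpos, hDk⟩ | ⟨hpos, hDd⟩
    · have hk0 : χ (k + 1) < 0 := hneg ⟨k, hk⟩
      have hdiv := div_pos hpos (neg_pos.2 hk0)
      have hD1 : D ≤ d := by
        rw [Finset.sum_range_succ] at hnpos
        have h1 : (h + ∑ i ∈ Finset.range k, χ (i + 1)) / (-χ (k + 1)) ≤ 1 := by
          rw [div_le_one (by linarith)]
          linarith
        have h2 : (k : ℝ) + 1 ≤ d := by exact_mod_cast hk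
        linarith
      have hD0 : 0 ≤ D := by rw [hDk]; positivity
      rw [min_eq_right hD1]
      have hs : ∀ s, D < s → dimHMeasure (Measure.map (proj t) ν) ≤ ENNReal.ofReal s := by
        intro s hs
        refine dimHMeasure_map_proj_le (fun i => (hnorm i).le) hinj hproj' herg' hanti hχ' hh' hk
          hk0 (hD0.trans hs.le) ?_ t
        rw [sum_fin_ite_lt hk.le fun i => χ (i + 1) - χ (k + 1)]
        simp only [Finset.sum_sub_distrib, Finset.sum_const, Finset.card_range, nsmul_eq_mul]
        rw [hDk, ← lt_sub_iff_add_lt', div_lt_iff₀ (by linarith)] at hs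
        linarith
      have hlim : Tendsto ENNReal.ofReal (nhdsWithin D (Ioi D)) (nhds (ENNReal.ofReal D)) :=
        (ENNReal.continuous_ofReal.tendsto D).mono_left nhdsWithin_le_nhds
      refine ge_of_tendsto hlim ?_
      filter_upwards [self_mem_nhdsWithin] with s hs' using hs s hs'
    · have hS : ∑ i ∈ Finset.range d, χ (i + 1) < 0 :=
        Finset.sum_neg (fun i hi => hneg ⟨i, Finset.mem_range.1 hi⟩) ⟨0, Finset.mem_range.2 hd⟩
      have hD1 : (d : ℝ) ≤ D := by
        rw [hDd, le_div_iff₀ (by linarith)]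
        gcongr
        linarith
      rw [min_eq_left hD1, ENNReal.ofReal_natCast]
      exact dimHMeasure_le_natCast _
  have hae : ∀ᵐ t ∂(volume : Measure (Fin m → EuclideanSpace ℝ (Fin d))), ∀ j : ℕ,
      ENNReal.ofReal (min (d : ℝ) D - 1 / ((j : ℝ) + 1)) ≤
        dimHMeasure (Measure.map (proj t) ν) := by
    refine ae_all_iff.2 fun j => ?_
    obtain ⟨b, hb0, hb1, hbpos, hbc⟩ := hlow (min (d : ℝ) D - 1 / ((j : ℝ) + 1))
      (sub_lt_self _ (by positivity))
    obtain ⟨a, ha0, ha1, hapos, hac⟩ := exists_pos_lt_one_of_nonneg_le_one hb0 hb1 hbpos hbc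
    filter_upwards [ae_ofReal_sum_le_dimHMeasure (by omega) hA hr0 hr hinj hproj'
      herg'.toMeasurePreserving hχ' hh' a ha0 ha1 hapos] with t ht
    exact (ENNReal.ofReal_le_ofReal hac).trans ht
  filter_upwards [hae] with t ht
  have h1 := (tendsto_one_div_add_atTop_nhds_zero_nat (𝕜 := ℝ)).const_sub (min (d : ℝ) D)
  rw [sub_zero] at h1
  exact (hup t).antisymm
    (le_of_tendsto' ((ENNReal.continuous_ofReal.tendsto _).comp h1) ht)
end
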